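/- arXiv:2407.02739 — 2 statements merged into one kernel-verified Lean document; each statement's English description precedes it below -/
import Mathlib

section
/- Suppose a finitely generated subgroup Γ ≤ Aut(A²) preserves a curve, i.e., there exists a nonconstant polynomial f ∈ k[x,y] such that every φ ∈ Γ maps the radical of the principal ideal (f) onto itself: φ(√(f)) = √(f). Then Γ is of bounded degree in Aut(A²). -/
open MvPolynomial

variable {k : Type*} [Field k]

/-- The subgroup `Aff` of affine automorphisms: both components have degree `1`. -/
def IsAff (φ : MvPolynomial (Fin 2) k ≃ₐ[k] MvPolynomial (Fin 2) k) : Prop :=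
  (φ (X 0)).totalDegree = 1 ∧ (φ (X 1)).totalDegree = 1

/-- The de Jonquières subgroup `J`: automorphisms of the form
`(a x + P(y), b y + c)` with `a, b ∈ kˣ`, `c ∈ k`, `P ∈ k[y]`. -/
def IsJonq (φ : MvPolynomial (Fin 2) k ≃ₐ[k] MvPolynomial (Fin 2) k) : Prop :=
  ∃ (a b : kˣ) (c : k) (P : Polynomial k),
    φ (X 0) = C (a : k) * X 0 + Polynomial.aeval (X 1) P ∧
      φ (X 1) = C (b : k) * X 1 + C c

/-- The degree of a polynomial automorphism: the maximum of the total degrees of its two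
components. -/
noncomputable def adeg (φ : MvPolynomial (Fin 2) k ≃ₐ[k] MvPolynomial (Fin 2) k) : ℕ :=
  max (φ (X 0)).totalDegree (φ (X 1)).totalDegree



namespace PlaneAut

section Lead

variable {ι κ : Type*}

/-- All exponents of `u` have weight in `S`. -/
def WSup (w : ι → ℚ) (S : Set ℚ) (u : MvPolynomial ι k) : Prop :=
  ∀ d, coeff d u ≠ 0 → Finsupp.weight w d ∈ S

abbrev WLe (w : ι → ℚ) (N : ℚ) (u : MvPolynomial ι k) : Prop := WSup w (Set.Iic N) u

abbrev WLt (w : ι → ℚ) (N : ℚ) (u : MvPolynomial ι k) : Prop := WSup w (Set.Iio N) u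

abbrev WHom (w : ι → ℚ) (N : ℚ) (u : MvPolynomial ι k) : Prop := WSup w {N} u

lemma WSup.mono {w : ι → ℚ} {S T : Set ℚ} (h : S ⊆ T) {u : MvPolynomial ι k} (hu : WSup w S u) :
    WSup w T u := fun d hd => h (hu d hd)

lemma WSup.zero (w : ι → ℚ) (S : Set ℚ) : WSup w S (0 : MvPolynomial ι k) := by
  intro d hd; simp at hd

lemma WSup.add {w : ι → ℚ} {S : Set ℚ} {u v : MvPolynomial ι k} (hu : WSup w S u)
    (hv : WSup w S v) : WSup w S (u + v) := by
  intro d hd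
  by_cases h : coeff d u = 0
  · apply hv; intro h'; apply hd; simp [h, h']
  · exact hu d h

lemma WSup.neg {w : ι → ℚ} {S : Set ℚ} {u : MvPolynomial ι k} (hu : WSup w S u) :
    WSup w S (-u) := by
  intro d hd; apply hu; intro h; apply hd; simp [h]

lemma WSup.sub {w : ι → ℚ} {S : Set ℚ} {u v : MvPolynomial ι k} (hu : WSup w S u)
    (hv : WSup w S v) : WSup w S (u - v) := by
  rw [sub_eq_add_neg]; exact hu.add hv.neg

lemma WSup.mul {w : ι → ℚ} {S T U : Set ℚ} {u v : MvPolynomial ι k} (hu : WSup w S u)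
    (hv : WSup w T v) (h : ∀ s ∈ S, ∀ t ∈ T, s + t ∈ U) : WSup w U (u * v) := by
  classical
  intro d hd
  rw [coeff_mul] at hd
  obtain ⟨x, hx, hx'⟩ := Finset.exists_ne_zero_of_sum_ne_zero hd
  rw [Finset.HasAntidiagonal.mem_antidiagonal] at hx
  rw [← hx, map_add]
  exact h _ (hu _ (left_ne_zero_of_mul hx')) _ (hv _ (right_ne_zero_of_mul hx'))

lemma WSup.C_mul {w : ι → ℚ} {S : Set ℚ} {u : MvPolynomial ι k} (hu : WSup w S u) (r : k) :
    WSup w S (C r * u) := by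
  intro d hd; apply hu; intro h; apply hd; simp [h]

lemma WSup.sum {w : ι → ℚ} {S : Set ℚ} {α : Type*} (s : Finset α) (u : α → MvPolynomial ι k)
    (hu : ∀ a ∈ s, WSup w S (u a)) : WSup w S (∑ a ∈ s, u a) := by
  classical
  induction s using Finset.induction_on with
  | empty => simpa using WSup.zero w S
  | insert a s ha ih =>
    rw [Finset.sum_insert ha]
    exact (hu a (by simp)).add (ih fun b hb => hu b (by simp [hb]))

lemma WHom_X (w : ι → ℚ) (i : ι) : WHom w (w i) (X i : MvPolynomial ι k) := by
  classical
  intro d hd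
  rw [coeff_X] at hd
  have : Finsupp.single i 1 = d := by by_contra h; simp [h] at hd
  simp [← this, Finsupp.weight_single]

lemma WHom_C (w : ι → ℚ) (r : k) : WHom w 0 (C r : MvPolynomial ι k) := by
  classical
  intro d hd
  rw [coeff_C] at hd
  have : 0 = d := by by_contra h; simp [h] at hd
  simp [← this]

lemma WHom.mul {w : ι → ℚ} {N M : ℚ} {u v : MvPolynomial ι k} (hu : WHom w N u)
    (hv : WHom w M v) : WHom w (N + M) (u * v) :=
  WSup.mul hu hv (by rintro _ rfl _ rfl; rfl)

lemma WLe.mul {w : ι → ℚ} {N M : ℚ} {u v : MvPolynomial ι k} (hu : WLe w N u)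
    (hv : WLe w M v) : WLe w (N + M) (u * v) :=
  WSup.mul hu hv (by intro s hs t ht; rw [Set.mem_Iic] at *; exact add_le_add hs ht)

/-- `u` has all weights at most `N`, and its part of weight `N` is `u0`. -/
def IsLead (w : ι → ℚ) (N : ℚ) (u u0 : MvPolynomial ι k) : Prop :=
  WHom w N u0 ∧ WLt w N (u - u0)

lemma WHom.isLead {w : ι → ℚ} {N : ℚ} {u : MvPolynomial ι k} (h : WHom w N u) :
    IsLead w N u u := ⟨h, by simpa using WSup.zero w _⟩

lemma WLt.isLead {w : ι → ℚ} {N : ℚ} {u : MvPolynomial ι k} (h : WLt w N u) :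
    IsLead w N u 0 := ⟨WSup.zero w _, by simpa using h⟩

lemma WLe.isLead {w : ι → ℚ} {N M : ℚ} {u : MvPolynomial ι k} (h : WLe w N u) (hM : N < M) :
    IsLead w M u 0 := WLt.isLead (h.mono (Set.Iic_subset_Iio.2 hM))

lemma IsLead.wle {w : ι → ℚ} {N : ℚ} {u u0 : MvPolynomial ι k} (h : IsLead w N u u0) :
    WLe w N u := by
  have : u = u0 + (u - u0) := by ring
  rw [this]
  exact (h.1.mono (by simp)).add (h.2.mono Set.Iio_subset_Iic_self)

lemma IsLead.add {w : ι → ℚ} {N : ℚ} {u u0 v v0 : MvPolynomial ι k} (hu : IsLead w N u u0)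
    (hv : IsLead w N v v0) : IsLead w N (u + v) (u0 + v0) :=
  ⟨hu.1.add hv.1, by
    have : u + v - (u0 + v0) = (u - u0) + (v - v0) := by ring
    rw [this]; exact hu.2.add hv.2⟩

lemma IsLead.sum {w : ι → ℚ} {N : ℚ} {α : Type*} (s : Finset α) (u u0 : α → MvPolynomial ι k)
    (hu : ∀ a ∈ s, IsLead w N (u a) (u0 a)) : IsLead w N (∑ a ∈ s, u a) (∑ a ∈ s, u0 a) :=
  ⟨WSup.sum _ _ fun a ha => (hu a ha).1, by
    rw [← Finset.sum_sub_distrib]; exact WSup.sum _ _ fun a ha => (hu a ha).2⟩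

lemma IsLead.C_mul {w : ι → ℚ} {N : ℚ} {u u0 : MvPolynomial ι k} (hu : IsLead w N u u0) (r : k) :
    IsLead w N (C r * u) (C r * u0) :=
  ⟨hu.1.C_mul r, by rw [← mul_sub]; exact hu.2.C_mul r⟩

lemma IsLead.mul {w : ι → ℚ} {N M : ℚ} {u u0 v v0 : MvPolynomial ι k} (hu : IsLead w N u u0)
    (hv : IsLead w M v v0) : IsLead w (N + M) (u * v) (u0 * v0) :=
  ⟨WHom.mul hu.1 hv.1, by
    have : u * v - u0 * v0 = (u - u0) * v + u0 * (v - v0) := by ring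
    rw [this]
    refine WSup.add (WSup.mul hu.2 hv.wle ?_) (WSup.mul hu.1 hv.2 ?_)
    · intro s hs t ht; rw [Set.mem_Iic] at ht; rw [Set.mem_Iio] at *; exact add_lt_add_of_lt_of_le hs ht
    · rintro _ rfl t ht; rw [Set.mem_Iio] at *; exact add_lt_add_of_le_of_lt le_rfl ht⟩

lemma isLead_one (w : ι → ℚ) : IsLead w 0 (1 : MvPolynomial ι k) 1 := by
  have := (WHom_C (ι := ι) w (1 : k)).isLead
  simpa using this

lemma IsLead.pow {w : ι → ℚ} {N : ℚ} {u u0 : MvPolynomial ι k} (hu : IsLead w N u u0) (n : ℕ) :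
    IsLead w (n * N) (u ^ n) (u0 ^ n) := by
  induction n with
  | zero => simpa using isLead_one w
  | succ n ih =>
    rw [pow_succ, pow_succ]
    have := ih.mul hu
    convert this using 1
    push_cast; ring

lemma IsLead.prod {w : ι → ℚ} {α : Type*} (s : Finset α) (N : α → ℚ) (u u0 : α → MvPolynomial ι k)
    (hu : ∀ a ∈ s, IsLead w (N a) (u a) (u0 a)) :
    IsLead w (∑ a ∈ s, N a) (∏ a ∈ s, u a) (∏ a ∈ s, u0 a) := by
  classical
  induction s using Finset.induction_on with
  | empty => simpa using isLead_one w
  | insert a s ha ih =>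
    rw [Finset.sum_insert ha, Finset.prod_insert ha, Finset.prod_insert ha]
    exact (hu a (by simp)).mul (ih fun b hb => hu b (by simp [hb]))

lemma IsLead.coeff_eq {w : ι → ℚ} {N : ℚ} {u u0 : MvPolynomial ι k} (hu : IsLead w N u u0)
    {d : ι →₀ ℕ} (hd : Finsupp.weight w d = N) : coeff d u0 = coeff d u := by
  by_contra h
  have := hu.2 d (by rw [coeff_sub, sub_ne_zero]; exact fun h' => h h'.symm)
  simp [hd] at this

lemma IsLead.coeff_ne {w : ι → ℚ} {N : ℚ} {u u0 : MvPolynomial ι k} (hu : IsLead w N u u0)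
    {d : ι →₀ ℕ} (hd : coeff d u0 ≠ 0) : coeff d u ≠ 0 := by
  rw [← hu.coeff_eq (hu.1 d hd)]; exact hd

lemma IsLead.unique {w : ι → ℚ} {N : ℚ} {u u0 u1 : MvPolynomial ι k} (h0 : IsLead w N u u0)
    (h1 : IsLead w N u u1) : u0 = u1 := by
  ext d
  by_cases hd : Finsupp.weight w d = N
  · rw [h0.coeff_eq hd, h1.coeff_eq hd]
  · have a0 : coeff d u0 = 0 := by by_contra h; exact hd (h0.1 d h)
    have a1 : coeff d u1 = 0 := by by_contra h; exact hd (h1.1 d h)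
    rw [a0, a1]

lemma WLe.exists_isLead {w : ι → ℚ} {N : ℚ} {u : MvPolynomial ι k} (h : WLe w N u) :
    ∃ u0, IsLead w N u u0 := by
  classical
  refine ⟨weightedHomogeneousComponent w N u, ?_, ?_⟩
  · intro d hd
    rw [coeff_weightedHomogeneousComponent] at hd
    by_contra h; exact hd (if_neg h)
  · intro d hd
    rw [coeff_sub, coeff_weightedHomogeneousComponent] at hd
    split_ifs at hd with h'
    · simp at hd
    · exact lt_of_le_of_ne (h d (by simpa using hd)) h'

lemma exists_lead (w : ι → ℚ) {u : MvPolynomial ι k} (hu : u ≠ 0) :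
    ∃ N u0 d, IsLead w N u u0 ∧ coeff d u ≠ 0 ∧ Finsupp.weight w d = N := by
  classical
  have hne : u.support.Nonempty := by simpa [Finset.nonempty_iff_ne_empty] using hu
  obtain ⟨d, hd, hmax⟩ := Finset.exists_max_image u.support (Finsupp.weight w) hne
  have : WLe w (Finsupp.weight w d) u := fun e he => hmax e (by simpa using he)
  obtain ⟨u0, h0⟩ := this.exists_isLead
  exact ⟨_, u0, d, h0, by simpa using hd, rfl⟩

lemma IsLead.ne_zero {w : ι → ℚ} {N : ℚ} {u u0 : MvPolynomial ι k} (hu : IsLead w N u u0)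
    {d : ι →₀ ℕ} (hd : coeff d u ≠ 0) (hN : Finsupp.weight w d = N) : u0 ≠ 0 := by
  rintro rfl
  exact hd (by rw [← hu.coeff_eq hN]; simp)

lemma isLead_monomial_aeval {w : ι → ℚ} {w' : κ → ℚ} {g g0 : κ → MvPolynomial ι k}
    (hg : ∀ i, IsLead w (w' i) (g i) (g0 i)) (d : κ →₀ ℕ) (r : k) :
    IsLead w (Finsupp.weight w' d) (aeval g (monomial d r)) (aeval g0 (monomial d r)) := by
  rw [aeval_monomial, aeval_monomial, algebraMap_eq]
  apply IsLead.C_mul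
  rw [Finsupp.weight_apply, Finsupp.prod, Finsupp.prod, Finsupp.sum]
  apply IsLead.prod
  intro i _
  rw [nsmul_eq_mul]
  exact (hg i).pow _

lemma IsLead.aeval {w : ι → ℚ} {w' : κ → ℚ} {g g0 : κ → MvPolynomial ι k}
    (hg : ∀ i, IsLead w (w' i) (g i) (g0 i)) {N : ℚ} {u u0 : MvPolynomial κ k}
    (hu : IsLead w' N u u0) : IsLead w N (aeval g u) (aeval g0 u0) := by
  have key : ∀ v : MvPolynomial κ k, WHom w' N v → IsLead w N (MvPolynomial.aeval g v)
      (MvPolynomial.aeval g0 v) := by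
    intro v hv
    rw [v.as_sum, map_sum, map_sum]
    apply IsLead.sum
    intro d hd
    have h1 := hv d (by simpa using hd)
    have := isLead_monomial_aeval hg d (coeff d v)
    rwa [show Finsupp.weight w' d = N from h1] at this
  have h1 := key u0 hu.1
  have h2 : IsLead w N (MvPolynomial.aeval g (u - u0)) 0 := by
    apply WLt.isLead
    rw [(u - u0).as_sum, map_sum]
    apply WSup.sum
    intro d hd
    have h1 := hu.2 d (by simpa using hd)
    exact ((isLead_monomial_aeval hg d (coeff d (u - u0))).wle).mono
      (Set.Iic_subset_Iio.2 h1)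
  have := h1.add h2
  rw [← map_add] at this
  simpa using this

lemma WLe.aeval {w : ι → ℚ} {w' : κ → ℚ} {g : κ → MvPolynomial ι k}
    (hg : ∀ i, WLe w (w' i) (g i)) {N : ℚ} {u : MvPolynomial κ k}
    (hu : WLe w' N u) : WLe w N (aeval g u) := by
  choose g0 hg0 using fun i => (hg i).exists_isLead
  obtain ⟨u0, hu0⟩ := hu.exists_isLead
  exact (IsLead.aeval hg0 hu0).wle

end Lead

end PlaneAut


namespace PlaneAut

section Mason

/-- degree in the variable `0` -/
noncomputable abbrev tdeg {n : ℕ} (u : MvPolynomial (Fin (n + 1)) k) : ℕ :=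
  (finSuccEquiv k n u).natDegree

lemma tdeg_mul {n : ℕ} {u v : MvPolynomial (Fin (n + 1)) k} (hu : u ≠ 0) (hv : v ≠ 0) :
    tdeg (u * v) = tdeg u + tdeg v := by
  unfold tdeg
  rw [map_mul, Polynomial.natDegree_mul] <;> simpa

lemma tdeg_pow {n : ℕ} (u : MvPolynomial (Fin (n + 1)) k) (m : ℕ) :
    tdeg (u ^ m) = m * tdeg u := by
  unfold tdeg
  rw [map_pow, Polynomial.natDegree_pow]

lemma finSuccEquiv_pderiv_zero {n : ℕ} (u : MvPolynomial (Fin (n + 1)) k) :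
    finSuccEquiv k n (pderiv 0 u) = Polynomial.derivative (finSuccEquiv k n u) := by
  induction u using MvPolynomial.induction_on with
  | C a => simp [finSuccEquiv_apply]
  | add p q hp hq => simp [hp, hq]
  | mul_X p i hp =>
    rw [Derivation.leibniz, map_mul, Polynomial.derivative_mul, map_add, smul_eq_mul, smul_eq_mul,
      map_mul, map_mul, hp]
    refine Fin.cases ?_ (fun j => ?_) i
    · simp [finSuccEquiv_X_zero]; ring
    · rw [pderiv_X_of_ne (Fin.succ_ne_zero j)]; simp [finSuccEquiv_X_succ]; ring

lemma tdeg_pderiv_zero_lt {n : ℕ} {u : MvPolynomial (Fin (n + 1)) k} (h : pderiv 0 u ≠ 0) :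
    tdeg (pderiv 0 u) + 1 ≤ tdeg u := by
  unfold tdeg
  rw [finSuccEquiv_pderiv_zero]
  apply Polynomial.natDegree_derivative_lt
  intro h0
  apply h
  apply (map_eq_zero_iff _ (finSuccEquiv k n).injective).1
  rw [finSuccEquiv_pderiv_zero]
  exact Polynomial.derivative_of_natDegree_zero h0

lemma tdeg_le_of_dvd {n : ℕ} {u v : MvPolynomial (Fin (n + 1)) k} (h : u ∣ v) (hv : v ≠ 0) :
    tdeg u ≤ tdeg v := by
  unfold tdeg
  exact Polynomial.natDegree_le_of_dvd (map_dvd (finSuccEquiv k n) h) (by simpa)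

lemma tdeg_X_one : tdeg (X 1 : MvPolynomial (Fin 3) k) = 0 := by
  unfold tdeg
  rw [show (1 : Fin 3) = Fin.succ 0 from rfl, finSuccEquiv_X_succ]; simp

lemma tdeg_X_two : tdeg (X 2 : MvPolynomial (Fin 3) k) = 0 := by
  unfold tdeg
  rw [show (2 : Fin 3) = Fin.succ 1 from rfl, finSuccEquiv_X_succ]; simp

lemma mason_other (n m : ℕ) (hm : m ≠ 0) (c : k) (hc : c ≠ 0) (U V : MvPolynomial (Fin 3) k)
    (h : V ^ n - C c * U ^ m = X 2 ^ n - C c * X 1 ^ m) (hV : tdeg V = 0) : tdeg U = 0 := by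
  have hC : (C c : MvPolynomial (Fin 3) k) ≠ 0 := by simpa using hc
  have e5 : C c * U ^ m = V ^ n - (X 2 ^ n - C c * X 1 ^ m) := by linear_combination -h
  have e6 : tdeg (V ^ n - (X 2 ^ n - C c * X 1 ^ m)) ≤ 0 := by
    unfold tdeg
    rw [map_sub, map_sub]
    refine (Polynomial.natDegree_sub_le _ _).trans (max_le ?_ ((Polynomial.natDegree_sub_le _ _).trans
      (max_le ?_ ?_)))
    · have := tdeg_pow V n
      unfold tdeg at this hV
      rw [this, hV, mul_zero]
    · have := tdeg_pow (X 2 : MvPolynomial (Fin 3) k) n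
      have h2 := tdeg_X_two (k := k)
      unfold tdeg at this h2
      rw [this, h2, mul_zero]
    · have h2 : tdeg (C c * X 1 ^ m : MvPolynomial (Fin 3) k) = 0 := by
        rw [tdeg_mul hC (pow_ne_zero _ (X_ne_zero _)), tdeg_pow, tdeg_X_one]
        simp [tdeg, finSuccEquiv_apply]
      exact h2.le
  rw [← e5] at e6
  by_cases hU : U = 0
  · simp [hU, tdeg]
  rw [tdeg_mul hC (pow_ne_zero _ hU), tdeg_pow] at e6
  have e7 : m * tdeg U = 0 := by omega
  simpa [hm] using e7

/-- The polynomial parametrizations of `y ^ n - c x ^ m = const`. -/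
lemma mason_aux (n m : ℕ) (hn : 2 ≤ n) (hm : 2 ≤ m) (hnm : n.Coprime m) (c : k) (hc : c ≠ 0) :
    ∀ (D : ℕ) (U V : MvPolynomial (Fin 3) k), tdeg U ≤ D →
      V ^ n - C c * U ^ m = X 2 ^ n - C c * X 1 ^ m → tdeg U = 0 := by
  intro D
  induction D using Nat.strong_induction_on with
  | _ D ih =>
  intro U V hD h
  have hC : (C c : MvPolynomial (Fin 3) k) ≠ 0 := by simpa using hc
  have d0 := congrArg (pderiv (0 : Fin 3)) h
  have d1 := congrArg (pderiv (1 : Fin 3)) h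
  have d2 := congrArg (pderiv (2 : Fin 3)) h
  simp only [map_sub, Derivation.leibniz, Derivation.leibniz_pow, pderiv_C, smul_eq_mul, smul_zero,
    nsmul_eq_mul, pderiv_X_self, pderiv_X_of_ne (show (1 : Fin 3) ≠ 0 by decide),
    pderiv_X_of_ne (show (2 : Fin 3) ≠ 0 by decide), pderiv_X_of_ne (show (2 : Fin 3) ≠ 1 by decide),
    pderiv_X_of_ne (show (1 : Fin 3) ≠ 2 by decide), mul_zero, mul_one, add_zero, sub_zero,
    zero_sub] at d0 d1 d2
  have hcast : ∀ j : ℕ, ((j : MvPolynomial (Fin 3) k) = 0 ↔ (j : k) = 0) := by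
    intro j
    rw [← map_natCast (C : k →+* MvPolynomial (Fin 3) k), map_eq_zero_iff _ (C_injective _ _)]
  have hU0 : U ≠ 0 ∨ V ≠ 0 := by
    by_contra hh
    push Not at hh
    rw [hh.1, hh.2, zero_pow (by omega), zero_pow (by omega)] at h
    have := congrArg (MvPolynomial.eval (![0, 0, 1] : Fin 3 → k)) h
    simp [zero_pow (show m ≠ 0 by omega)] at this
  by_cases hn0 : (n : k) = 0
  · have hm0 : (m : k) ≠ 0 := by
      intro hm0
      have h1 := (ringChar.spec k n).1 hn0
      have h2 := (ringChar.spec k m).1 hm0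
      have h3 := Nat.dvd_gcd h1 h2
      rw [hnm] at h3
      have := CharP.ringChar_ne_one (R := k)
      exact this (Nat.dvd_one.1 h3)
    have hn0' := (hcast n).2 hn0
    have hm0' : (m : MvPolynomial (Fin 3) k) ≠ 0 := fun hh => hm0 ((hcast m).1 hh)
    rw [hn0'] at d1
    have e1 : (C c * (m : MvPolynomial (Fin 3) k)) * (U ^ (m - 1) * pderiv 1 U) =
        (C c * (m : MvPolynomial (Fin 3) k)) * X 1 ^ (m - 1) := by
      linear_combination -d1
    have e2 := mul_left_cancel₀ (mul_ne_zero hC hm0') e1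
    have e3 : U ^ (m - 1) ∣ X 1 ^ (m - 1) := ⟨_, e2.symm⟩
    have e4 := tdeg_le_of_dvd e3 (pow_ne_zero _ (X_ne_zero _))
    rw [tdeg_pow, tdeg_pow, tdeg_X_one, mul_zero] at e4
    have : m - 1 ≠ 0 := by omega
    simpa [this] using e4
  by_cases hm0 : (m : k) = 0
  · have hm0' := (hcast m).2 hm0
    have hn0' : (n : MvPolynomial (Fin 3) k) ≠ 0 := fun hh => hn0 ((hcast n).1 hh)
    rw [hm0'] at d2
    have e1 : ((n : MvPolynomial (Fin 3) k)) * (V ^ (n - 1) * pderiv 2 V) =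
        ((n : MvPolynomial (Fin 3) k)) * X 2 ^ (n - 1) := by
      linear_combination d2
    have e2 := mul_left_cancel₀ (hn0') e1
    have e3 : V ^ (n - 1) ∣ X 2 ^ (n - 1) := ⟨_, e2.symm⟩
    have e4 := tdeg_le_of_dvd e3 (pow_ne_zero _ (X_ne_zero _))
    rw [tdeg_pow, tdeg_pow, tdeg_X_two, mul_zero] at e4
    have : n - 1 ≠ 0 := by omega
    have hV : tdeg V = 0 := by simpa [this] using e4
    exact mason_other n m (by omega) c hc U V h hV
  have hm0' : (m : MvPolynomial (Fin 3) k) ≠ 0 := fun hh => hm0 ((hcast m).1 hh)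
  have hn0' : (n : MvPolynomial (Fin 3) k) ≠ 0 := fun hh => hn0 ((hcast n).1 hh)
  by_cases hUt : pderiv 0 U = 0
  · -- descent
    by_cases hVz : V = 0
    · exact mason_other n m (by omega) c hc U V h (by simp [hVz, tdeg])
    have hVt : pderiv 0 V = 0 := by
      rw [hUt] at d0
      have : (n : MvPolynomial (Fin 3) k) * (V ^ (n - 1) * pderiv 0 V) = 0 := by
        linear_combination d0
      rcases mul_eq_zero.1 this with h | h
      · exact absurd h hn0'
      · rcases mul_eq_zero.1 h with h | h
        · exact absurd h (pow_ne_zero _ hVz)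
        · exact h
    have hUt' := finSuccEquiv_pderiv_zero U
    have hVt' := finSuccEquiv_pderiv_zero V
    rw [hUt, map_zero] at hUt'
    rw [hVt, map_zero] at hVt'
    obtain ⟨p, hp⟩ := CharP.exists k
    have : CharP (MvPolynomial (Fin 2) k) p := inferInstance
    by_cases hp0 : p = 0
    · subst hp0
      have : CharZero (MvPolynomial (Fin 2) k) := CharP.charP_to_charZero _
      exact Polynomial.derivative_eq_zero.1 hUt'.symm
    have hp1 : p ≠ 1 := CharP.char_ne_one k p
    have eU := Polynomial.expand_contract p hUt'.symm hp0
    have eV := Polynomial.expand_contract p hVt'.symm hp0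
    have hF := congrArg (finSuccEquiv k 2) h
    have hCc : finSuccEquiv k 2 (C c) = Polynomial.C (C c) := by simp [finSuccEquiv_apply]
    rw [show (2 : Fin 3) = Fin.succ 1 from rfl, show (1 : Fin 3) = Fin.succ 0 from rfl] at hF
    simp only [map_sub, map_mul, map_pow, finSuccEquiv_X_succ, hCc] at hF
    rw [← eU, ← eV] at hF
    have key := ih (tdeg ((finSuccEquiv k 2).symm (Polynomial.contract p (finSuccEquiv k 2 U))))
    have hdeg : tdeg U = tdeg ((finSuccEquiv k 2).symm
        (Polynomial.contract p (finSuccEquiv k 2 U))) * p := by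
      unfold tdeg
      rw [AlgEquiv.apply_symm_apply, ← Polynomial.natDegree_expand, eU]
    by_contra hne
    have hlt : tdeg ((finSuccEquiv k 2).symm
        (Polynomial.contract p (finSuccEquiv k 2 U))) < D := by
      refine lt_of_lt_of_le ?_ hD
      rw [hdeg]
      rw [hdeg] at hne
      have h1 : tdeg ((finSuccEquiv k 2).symm
        (Polynomial.contract p (finSuccEquiv k 2 U))) ≠ 0 := fun h => hne (by rw [h, zero_mul])
      have h2 : 2 ≤ p := by omega
      nlinarith [Nat.pos_of_ne_zero h1]
    have := key hlt _ ((finSuccEquiv k 2).symm (Polynomial.contract p (finSuccEquiv k 2 V))) le_rfl (by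
      apply (finSuccEquiv k 2).injective
      rw [show (2 : Fin 3) = Fin.succ 1 from rfl, show (1 : Fin 3) = Fin.succ 0 from rfl]
      simp only [map_sub, map_mul, map_pow, finSuccEquiv_X_succ, hCc, AlgEquiv.apply_symm_apply]
      apply Polynomial.expand_injective (Nat.pos_of_ne_zero hp0)
      simp only [map_sub, map_mul, map_pow, Polynomial.expand_C]
      exact hF)
    rw [this] at hdeg
    exact hne (by rw [hdeg, zero_mul])
  · exfalso
    have hU : U ≠ 0 := by rintro rfl; simp at hUt
    have hVt : pderiv 0 V ≠ 0 := by
      intro hVt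
      rw [hVt] at d0
      have : (C c * (m : MvPolynomial (Fin 3) k)) * (U ^ (m - 1) * pderiv 0 U) = 0 := by
        linear_combination -d0
      exact mul_ne_zero (mul_ne_zero hC hm0') (mul_ne_zero (pow_ne_zero _ hU) hUt) this
    have a1 : V ^ (n - 1) ∣ (C c * (m : MvPolynomial (Fin 3) k)) * (X 1 ^ (m - 1) * pderiv 0 U) :=
      ⟨n * (pderiv 0 V * pderiv 1 U - pderiv 1 V * pderiv 0 U), by
        linear_combination (pderiv 0 U) * d1 - pderiv 1 U * d0⟩
    have a2 : U ^ (m - 1) ∣ ((n : MvPolynomial (Fin 3) k)) * (X 2 ^ (n - 1) * pderiv 0 V) :=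
      ⟨C c * (m : MvPolynomial (Fin 3) k) * (pderiv 0 U * pderiv 2 V - pderiv 2 U * pderiv 0 V), by
        linear_combination (-pderiv 0 V) * d2 + pderiv 2 V * d0⟩
    have hx1 : (X 1 ^ (m - 1) : MvPolynomial (Fin 3) k) ≠ 0 := pow_ne_zero _ (X_ne_zero _)
    have hx2 : (X 2 ^ (n - 1) : MvPolynomial (Fin 3) k) ≠ 0 := pow_ne_zero _ (X_ne_zero _)
    have tC : ∀ r : k, tdeg (C r : MvPolynomial (Fin 3) k) = 0 := by
      intro r; simp [tdeg, finSuccEquiv_apply]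
    have tN : ∀ r : ℕ, tdeg (r : MvPolynomial (Fin 3) k) = 0 := by
      intro r; rw [← map_natCast (C : k →+* MvPolynomial (Fin 3) k)]; exact tC _
    have b1 := tdeg_le_of_dvd a1 (mul_ne_zero (mul_ne_zero hC hm0') (mul_ne_zero hx1 hUt))
    have b2 := tdeg_le_of_dvd a2 (mul_ne_zero hn0' (mul_ne_zero hx2 hVt))
    rw [tdeg_mul (mul_ne_zero hC hm0') (mul_ne_zero hx1 hUt), tdeg_mul hC hm0', tdeg_mul hx1 hUt,
      tC, tN, tdeg_pow, tdeg_pow, tdeg_X_one] at b1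
    rw [tdeg_mul hn0' (mul_ne_zero hx2 hVt), tdeg_mul hx2 hVt, tN, tdeg_pow, tdeg_pow,
      tdeg_X_two] at b2
    have c1 := tdeg_pderiv_zero_lt hUt
    have c2 := tdeg_pderiv_zero_lt hVt
    obtain ⟨n', rfl⟩ : ∃ n', n = n' + 2 := ⟨n - 2, by omega⟩
    obtain ⟨m', rfl⟩ : ∃ m', m = m' + 2 := ⟨m - 2, by omega⟩
    have e1 : n' + 2 - 1 = n' + 1 := by omega
    have e2 : m' + 2 - 1 = m' + 1 := by omega
    rw [e1] at b1 b2
    rw [e2] at b1 b2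
    have f1 : tdeg V ≤ (n' + 1) * tdeg V := Nat.le_mul_of_pos_left _ (by omega)
    have f2 : tdeg U ≤ (m' + 1) * tdeg U := Nat.le_mul_of_pos_left _ (by omega)
    omega

/-- Over the plane, `y ^ n - c x ^ m` cannot be moved along a nontrivial deformation. -/
lemma mason (n m : ℕ) (hn : 2 ≤ n) (hm : 2 ≤ m) (hnm : n.Coprime m) (c : k) (hc : c ≠ 0)
    (U V : MvPolynomial (Fin 3) k) (h : V ^ n - C c * U ^ m = X 2 ^ n - C c * X 1 ^ m) :
    tdeg U = 0 ∧ tdeg V = 0 := by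
  have hU := mason_aux n m hn hm hnm c hc _ U V le_rfl h
  refine ⟨hU, ?_⟩
  have hC : (C c : MvPolynomial (Fin 3) k) ≠ 0 := by simpa using hc
  have e5 : V ^ n = X 2 ^ n + (C c * U ^ m - C c * X 1 ^ m) := by linear_combination h
  have e6 : tdeg (X 2 ^ n + (C c * U ^ m - C c * X 1 ^ m) : MvPolynomial (Fin 3) k) ≤ 0 := by
    unfold tdeg
    rw [map_add, map_sub]
    refine (Polynomial.natDegree_add_le _ _).trans (max_le ?_ ((Polynomial.natDegree_sub_le _ _).trans
      (max_le ?_ ?_)))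
    · have := tdeg_pow (X 2 : MvPolynomial (Fin 3) k) n
      have h2 := tdeg_X_two (k := k)
      unfold tdeg at this h2
      rw [this, h2, mul_zero]
    · by_cases hU0 : U = 0
      · simp [hU0, zero_pow (show m ≠ 0 by omega)]
      have h2 : tdeg (C c * U ^ m : MvPolynomial (Fin 3) k) = 0 := by
        rw [tdeg_mul hC (pow_ne_zero _ hU0), tdeg_pow, hU]
        simp [tdeg, finSuccEquiv_apply]
      exact h2.le
    · have h2 : tdeg (C c * X 1 ^ m : MvPolynomial (Fin 3) k) = 0 := by
        rw [tdeg_mul hC (pow_ne_zero _ (X_ne_zero _)), tdeg_pow, tdeg_X_one]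
        simp [tdeg, finSuccEquiv_apply]
      exact h2.le
  rw [← e5, tdeg_pow] at e6
  have e7 : n * tdeg V = 0 := by omega
  have : n ≠ 0 := by omega
  simpa [this] using e7

end Mason


end PlaneAut


namespace PlaneAut

section Binary

lemma weight_fin2 (w : Fin 2 → ℚ) (d : Fin 2 →₀ ℕ) :
    Finsupp.weight w d = d 0 * w 0 + d 1 * w 1 := by
  rw [Finsupp.weight_apply, Finsupp.sum_fintype _ _ (by simp)]
  simp

lemma aeval_fin2 {A : Type*} [CommRing A] [Algebra k A] (g : Fin 2 → A)
    (P : MvPolynomial (Fin 2) k) :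
    aeval g P = ∑ d ∈ P.support, algebraMap k A (coeff d P) * (g 0 ^ d 0 * g 1 ^ d 1) := by
  rw [aeval_def, eval₂_eq']
  apply Finset.sum_congr rfl
  intro d _
  rw [Fin.prod_univ_two]

lemma field_aux {K : Type*} [Field K] (a b Y q r : K) (hb : b ≠ 0) (e : ℕ) :
    a * b ^ e * r * (q * (Y ^ e / b ^ e)) = q * (a * (r * Y ^ e)) := by
  field_simp

lemma field_aux2 {K : Type*} [Field K] (a b : K) (hb : b ≠ 0) : a = a / b * b := by
  field_simp

lemma whom_root [IsAlgClosed k] (n m : ℕ) (hn : 0 < n) (hm : 0 < m) (hnm : n.Coprime m)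
    {P : MvPolynomial (Fin 2) k} (hP : P ≠ 0) {N : ℚ} {w : Fin 2 → ℚ} (hw0 : w 0 = n) (hw1 : w 1 = m)
    (hPW : WHom w N P)
    {A : Type*} [CommRing A] [IsDomain A] [Algebra k A] (g : Fin 2 → A) (hx : g 0 ≠ 0) (hy : g 1 ≠ 0)
    (h : aeval g P = 0) :
    ∃ c : k, c ≠ 0 ∧ g 1 ^ n = algebraMap k A c * g 0 ^ m ∧ (X 1 ^ n - C c * X 0 ^ m) ∣ P := by
  classical
  have hne : P.support.Nonempty := by simpa [Finset.nonempty_iff_ne_empty] using hP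
  obtain ⟨d0, hd0, hmin⟩ := Finset.exists_min_image P.support (fun d => d 1) hne
  have hl : ∀ d ∈ P.support, ∃ l : ℕ, d 1 = d0 1 + n * l ∧ d0 0 = d 0 + m * l := by
    intro d hd
    have h1 := hPW d (mem_support_iff.1 hd)
    have h2 := hPW d0 (mem_support_iff.1 hd0)
    rw [Set.mem_singleton_iff, weight_fin2, hw0, hw1] at h1 h2
    have h3 : d 0 * n + d 1 * m = d0 0 * n + d0 1 * m := by exact_mod_cast h1.trans h2.symm
    obtain ⟨e, he⟩ := Nat.exists_eq_add_of_le (hmin d hd)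
    rw [he] at h3
    have h4 : d 0 * n + e * m = d0 0 * n := by nlinarith
    have h5 : n ∣ e * m := by
      have : n ∣ d 0 * n + e * m := h4 ▸ Dvd.intro_left _ rfl
      exact (Nat.dvd_add_right (Dvd.intro_left _ rfl)).1 this
    obtain ⟨l, rfl⟩ := hnm.dvd_of_dvd_mul_right h5
    refine ⟨l, he, ?_⟩
    have : n * d0 0 = n * (d 0 + m * l) := by nlinarith
    exact Nat.eq_of_mul_eq_mul_left hn this
  choose! l hl1 hl2 using hl
  have hd00 : l d0 = 0 := by
    have := hl1 d0 hd0
    have : n * l d0 = 0 := by omega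
    rcases Nat.mul_eq_zero.1 this with h | h
    · omega
    · exact h
  set U : Polynomial k := ∑ d ∈ P.support, Polynomial.monomial (l d) (coeff d P) with hU
  have hU0 : U ≠ 0 := by
    intro h0
    have := congrArg (fun u => Polynomial.coeff u 0) h0
    simp only [hU, Polynomial.finsetSum_coeff, Polynomial.coeff_zero, Polynomial.coeff_monomial] at this
    rw [Finset.sum_eq_single d0] at this
    · rw [if_pos hd00] at this
      exact mem_support_iff.1 hd0 this
    · intro d hd hdd
      rw [if_neg]
      intro hld
      apply hdd
      have h1 := hl1 d hd
      have h2 := hl2 d hd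
      rw [hld] at h1 h2
      ext i; fin_cases i <;> simp <;> omega
    · intro h; exact absurd hd0 h
  let K := FractionRing A
  let x : K := algebraMap A K (g 0)
  let y : K := algebraMap A K (g 1)
  have hx' : x ≠ 0 := by simpa [x] using hx
  have hy' : y ≠ 0 := by simpa [y] using hy
  have hroot : Polynomial.aeval (y ^ n / x ^ m) U = 0 := by
    have h1 := congrArg (algebraMap A K) h
    rw [aeval_fin2, map_sum, map_zero] at h1
    have h2 : x ^ d0 0 * y ^ d0 1 * Polynomial.aeval (y ^ n / x ^ m) U = 0 := by
      rw [← h1, hU, map_sum, Finset.mul_sum]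
      apply Finset.sum_congr rfl
      intro d hd
      rw [Polynomial.aeval_monomial, map_mul, map_mul, map_pow, map_pow,
        ← IsScalarTower.algebraMap_apply k A K]
      change _ = _ * (x ^ d 0 * y ^ d 1)
      rw [hl1 d hd, hl2 d hd, pow_add, pow_add, div_pow, pow_mul, pow_mul]
      exact field_aux _ _ _ _ _ (pow_ne_zero _ hx') _
    exact (mul_eq_zero.1 h2).resolve_left (mul_ne_zero (pow_ne_zero _ hx') (pow_ne_zero _ hy'))
  obtain ⟨c, hc⟩ : ∃ c : k, algebraMap k K c = y ^ n / x ^ m := by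
    refine (IsAlgClosed.splits U).mem_range_of_isRoot hU0 (i := algebraMap k K) ?_
    rw [Polynomial.IsRoot.def, Polynomial.eval_map_algebraMap]
    exact hroot
  have hcU : U.eval c = 0 := by
    rw [← hc, Polynomial.aeval_algebraMap_apply] at hroot
    simpa using hroot
  refine ⟨c, ?_, ?_, ?_⟩
  · rintro rfl
    rw [map_zero, eq_comm] at hc
    exact div_ne_zero (pow_ne_zero _ hy') (pow_ne_zero _ hx') hc
  · apply IsFractionRing.injective A K
    rw [map_pow, map_mul, map_pow, ← IsScalarTower.algebraMap_apply k A K, hc]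
    exact field_aux2 _ _ (pow_ne_zero _ hx')
  · have e0 : P = aeval (X : Fin 2 → MvPolynomial (Fin 2) k) P := by simp
    have e1 : P = ∑ d ∈ P.support, C (coeff d P) * (X 0 ^ d 0 * X 1 ^ d 1) := by
      conv_lhs => rw [e0, aeval_fin2]
      rfl
    have e2 : ∑ d ∈ P.support, C (coeff d P) * C c ^ l d * (X 0 ^ d0 0 * X 1 ^ d0 1) =
        (0 : MvPolynomial (Fin 2) k) := by
      have : U.eval c = ∑ d ∈ P.support, coeff d P * c ^ l d := by
        rw [hU, Polynomial.eval_finsetSum]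
        simp
      rw [hcU] at this
      rw [← Finset.sum_mul]
      have h3 := congrArg (C : k →+* MvPolynomial (Fin 2) k) this
      rw [map_zero, map_sum] at h3
      simp only [map_mul, map_pow] at h3
      rw [← h3, zero_mul]
    have e3 : P = ∑ d ∈ P.support, C (coeff d P) * X 0 ^ d 0 * X 1 ^ d0 1 *
        ((X 1 ^ n) ^ l d - (C c * X 0 ^ m) ^ l d) := by
      conv_lhs => rw [e1, ← sub_zero (∑ d ∈ P.support, _), ← e2, ← Finset.sum_sub_distrib]
      apply Finset.sum_congr rfl
      intro d hd
      rw [hl2 d hd]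
      nth_rewrite 1 [hl1 d hd]
      ring
    rw [e3]
    apply Finset.dvd_sum
    intro d _
    exact Dvd.dvd.mul_left (sub_dvd_pow_sub_pow _ _ _) _

end Binary


end PlaneAut


namespace PlaneAut

section Degeneration

lemma tdeg_eq_zero_of_X_dvd {n : ℕ} {u : MvPolynomial (Fin (n + 1)) k} (h : X 0 ∣ u)
    (hu : tdeg u = 0) : u = 0 := by
  by_contra hne
  obtain ⟨v, rfl⟩ := h
  rw [tdeg_mul (X_ne_zero _) (right_ne_zero_of_mul hne)] at hu
  have : tdeg (X 0 : MvPolynomial (Fin (n + 1)) k) = 1 := by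
    simp [tdeg, finSuccEquiv_X_zero]
  omega

lemma tdeg_sub_le {n : ℕ} {u v : MvPolynomial (Fin (n + 1)) k} (hu : tdeg u = 0)
    (hv : tdeg v = 0) : tdeg (u - v) = 0 := by
  unfold tdeg at *
  rw [map_sub]
  have := Polynomial.natDegree_sub_le (finSuccEquiv k n u) (finSuccEquiv k n v)
  rw [hu, hv] at this
  simpa using this

/-- The inclusion of the plane polynomials as the polynomials not involving the first variable. -/
noncomputable def jj : MvPolynomial (Fin 2) k →ₐ[k] MvPolynomial (Fin 3) k :=
  aeval ![X 1, X 2]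

/-- Setting the first variable to zero. -/
noncomputable def ee : MvPolynomial (Fin 3) k →ₐ[k] MvPolynomial (Fin 2) k :=
  aeval ![0, X 0, X 1]

lemma ee_jj (u : MvPolynomial (Fin 2) k) : ee (jj u) = u := by
  have : (ee.comp jj : MvPolynomial (Fin 2) k →ₐ[k] _) = AlgHom.id k _ := by
    apply MvPolynomial.algHom_ext
    intro i
    fin_cases i <;> simp [ee, jj]
  exact DFunLike.congr_fun this u

lemma tdeg_jj (u : MvPolynomial (Fin 2) k) : tdeg (jj u) = 0 := by
  have h : ∀ u : MvPolynomial (Fin 2) k, finSuccEquiv k 2 (jj u) = Polynomial.C u := by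
    intro u
    have : ((finSuccEquiv k 2).toAlgHom.comp jj : MvPolynomial (Fin 2) k →ₐ[k] _) =
        Polynomial.CAlgHom := by
      apply MvPolynomial.algHom_ext
      intro i
      fin_cases i
      · simpa [jj] using finSuccEquiv_X_succ (R := k) (n := 2) (j := 0)
      · simpa [jj] using finSuccEquiv_X_succ (R := k) (n := 2) (j := 1)
    exact DFunLike.congr_fun this u
  unfold tdeg
  rw [h]; simp

lemma X_dvd_sub_jj_ee (u : MvPolynomial (Fin 3) k) : X 0 ∣ u - jj (ee u) := by
  induction u using MvPolynomial.induction_on with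
  | C a => simp [ee, jj]
  | add p q hp hq =>
    have := dvd_add hp hq
    convert this using 1
    simp only [map_add]; ring
  | mul_X p i hp =>
    have hi : X 0 ∣ X i - jj (ee (X i : MvPolynomial (Fin 3) k)) := by
      fin_cases i <;> simp [ee, jj]
    have := dvd_add (hp.mul_right (X i)) (hi.mul_left (jj (ee p)))
    convert this using 1
    simp only [map_mul]; ring

lemma weight_fin3 (w : Fin 3 → ℚ) (d : Fin 3 →₀ ℕ) :
    Finsupp.weight w d = d 0 * w 0 + d 1 * w 1 + d 2 * w 2 := by
  rw [Finsupp.weight_apply, Finsupp.sum_fintype _ _ (by simp), Fin.sum_univ_three]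
  simp

/-- choice of the weight of the deformation parameter -/
lemma exists_sigma (a b : ℚ) (U V : MvPolynomial (Fin 3) k) (h : U ≠ 0 ∨ V ≠ 0) :
    ∃ (s : ℚ) (U0 V0 : MvPolynomial (Fin 3) k), IsLead ![s, a, b] (a - s) U U0 ∧
      IsLead ![s, a, b] (b - s) V V0 ∧ (U0 ≠ 0 ∨ V0 ≠ 0) := by
  classical
  let fU : (Fin 3 →₀ ℕ) → ℚ := fun d => (a - d 1 * a - d 2 * b) / (d 0 + 1)
  let fV : (Fin 3 →₀ ℕ) → ℚ := fun d => (b - d 1 * a - d 2 * b) / (d 0 + 1)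
  let S : Finset ℚ := U.support.image fU ∪ V.support.image fV
  have hS : S.Nonempty := by
    rcases h with h | h
    · have hne : U.support.Nonempty := by simpa [Finset.nonempty_iff_ne_empty] using h
      exact (hne.image fU).mono Finset.subset_union_left
    · have hne : V.support.Nonempty := by simpa [Finset.nonempty_iff_ne_empty] using h
      exact (hne.image fV).mono Finset.subset_union_right
  obtain ⟨s, hs, hmin⟩ := Finset.exists_min_image S id hS
  have hU : WLe ![s, a, b] (a - s) U := by
    intro d hd
    have h1 : s ≤ fU d := hmin _ (Finset.mem_union_left _
      (Finset.mem_image_of_mem _ (mem_support_iff.2 hd)))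
    have h2 : (0 : ℚ) < d 0 + 1 := by positivity
    simp only [fU] at h1
    rw [le_div_iff₀ h2] at h1
    rw [Set.mem_Iic, weight_fin3]
    simp
    linarith
  have hV : WLe ![s, a, b] (b - s) V := by
    intro d hd
    have h1 : s ≤ fV d := hmin _ (Finset.mem_union_right _
      (Finset.mem_image_of_mem _ (mem_support_iff.2 hd)))
    have h2 : (0 : ℚ) < d 0 + 1 := by positivity
    simp only [fV] at h1
    rw [le_div_iff₀ h2] at h1
    rw [Set.mem_Iic, weight_fin3]
    simp
    linarith
  obtain ⟨U0, hU0⟩ := hU.exists_isLead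
  obtain ⟨V0, hV0⟩ := hV.exists_isLead
  refine ⟨s, U0, V0, hU0, hV0, ?_⟩
  rcases Finset.mem_union.1 hs with hs | hs
  · obtain ⟨d, hd, hds⟩ := Finset.mem_image.1 hs
    left
    refine hU0.ne_zero (mem_support_iff.1 hd) ?_
    have h2 : (d 0 + 1 : ℚ) ≠ 0 := by positivity
    simp only [fU] at hds
    rw [div_eq_iff h2] at hds
    rw [weight_fin3]
    simp
    linarith
  · obtain ⟨d, hd, hds⟩ := Finset.mem_image.1 hs
    right
    refine hV0.ne_zero (mem_support_iff.1 hd) ?_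
    have h2 : (d 0 + 1 : ℚ) ≠ 0 := by positivity
    simp only [fV] at hds
    rw [div_eq_iff h2] at hds
    rw [weight_fin3]
    simp
    linarith

lemma rigid (θ : MvPolynomial (Fin 2) k ≃ₐ[k] MvPolynomial (Fin 2) k) (n m : ℕ) (hn : 2 ≤ n)
    (hm : 2 ≤ m) (hnm : n.Coprime m) (c : k) (hc : c ≠ 0) (P P0 : MvPolynomial (Fin 2) k)
    (N : ℚ) (hP : IsLead ![(n : ℚ), (m : ℚ)] N P P0) (hP0 : P0 ≠ 0) (hθ : θ P = X 1)
    (hdvd : (X 1 ^ n - C c * X 0 ^ m) ∣ P0) : False := by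
  set Q := θ.symm (X 0) with hQ
  let Ψ : MvPolynomial (Fin 2) k →ₐ[k] MvPolynomial (Fin 3) k :=
    (aeval ![jj Q + X 0, jj P]).comp θ.toAlgHom
  have hΨP : Ψ P = jj P := by simp [Ψ, hθ]
  have hΨQ : Ψ Q = jj Q + X 0 := by simp [Ψ, hQ]
  have heΨ : ∀ u, ee (Ψ u) = u := by
    have : (ee.comp Ψ).comp θ.symm.toAlgHom = θ.symm.toAlgHom := by
      apply MvPolynomial.algHom_ext
      intro i
      fin_cases i
      · have : ee (X 0 : MvPolynomial (Fin 3) k) = 0 := by simp [ee]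
        simp [Ψ, ee_jj, hQ, this]
      · have : θ.symm (X 1) = P := by rw [← hθ]; simp
        simp [Ψ, ee_jj, this, hθ]
    intro u
    have := DFunLike.congr_fun this (θ u)
    simpa using this
  obtain ⟨U, hU⟩ := X_dvd_sub_jj_ee (Ψ (X 0))
  obtain ⟨V, hV⟩ := X_dvd_sub_jj_ee (Ψ (X 1))
  rw [heΨ, show jj (X 0 : MvPolynomial (Fin 2) k) = X 1 by simp [jj], sub_eq_iff_eq_add] at hU
  rw [heΨ, show jj (X 1 : MvPolynomial (Fin 2) k) = X 2 by simp [jj], sub_eq_iff_eq_add] at hV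
  have hUV : U ≠ 0 ∨ V ≠ 0 := by
    by_contra hh
    push Not at hh
    rw [hh.1, mul_zero, zero_add] at hU
    rw [hh.2, mul_zero, zero_add] at hV
    have : Ψ = jj := by
      apply MvPolynomial.algHom_ext
      intro i
      fin_cases i
      · simpa [jj] using hU
      · simpa [jj] using hV
    rw [this] at hΨQ
    have := X_ne_zero (R := k) (0 : Fin 3)
    apply this
    linear_combination -hΨQ
  obtain ⟨s, U0, V0, hU0, hV0, hUV0⟩ := exists_sigma (n : ℚ) (m : ℚ) U V hUV
  set w : Fin 3 → ℚ := ![s, n, m] with hw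
  have lX0 : IsLead w s (X 0 : MvPolynomial (Fin 3) k) (X 0) := (WHom_X w 0).isLead
  have lX1 : IsLead w n (X 1 : MvPolynomial (Fin 3) k) (X 1) := (WHom_X w 1).isLead
  have lX2 : IsLead w m (X 2 : MvPolynomial (Fin 3) k) (X 2) := (WHom_X w 2).isLead
  have lU : IsLead w n (Ψ (X 0)) (X 0 * U0 + X 1) := by
    rw [hU]
    have := lX0.mul hU0
    rw [add_sub_cancel] at this
    exact this.add lX1
  have lV : IsLead w m (Ψ (X 1)) (X 0 * V0 + X 2) := by
    rw [hV]
    have := lX0.mul hV0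
    rw [add_sub_cancel] at this
    exact this.add lX2
  have l1 := IsLead.aeval (w := w) (g := ![Ψ (X 0), Ψ (X 1)]) (g0 := ![X 0 * U0 + X 1, X 0 * V0 + X 2])
    (by intro i; fin_cases i; exacts [lU, lV]) hP
  have l2 := IsLead.aeval (w := w) (g := ![X 1, X 2]) (g0 := ![X 1, X 2])
    (by intro i; fin_cases i; exacts [lX1, lX2]) hP
  have hΨa : aeval ![Ψ (X 0), Ψ (X 1)] P = Ψ P := by
    have : aeval ![Ψ (X 0), Ψ (X 1)] = Ψ := by
      apply MvPolynomial.algHom_ext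
      intro i
      fin_cases i <;> simp
    rw [this]
  rw [hΨa, hΨP] at l1
  have e1 : aeval ![X 0 * U0 + X 1, X 0 * V0 + X 2] P0 = jj P0 := l1.unique l2
  have hj0 : jj P0 ≠ 0 := by
    intro h
    apply hP0
    rw [← ee_jj P0, h, map_zero]
  have e2 := map_dvd (aeval ![X 0 * U0 + X 1, X 0 * V0 + X 2]) hdvd
  rw [e1] at e2
  have e3 := tdeg_le_of_dvd e2 hj0
  rw [tdeg_jj] at e3
  simp only [map_sub, map_pow, map_mul, aeval_X, algHom_C, algebraMap_eq, Matrix.cons_val_zero,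
    Matrix.cons_val_one, Nat.le_zero] at e3
  have e4 : X 0 ∣ ((X 0 * V0 + X 2) ^ n - C c * (X 0 * U0 + X 1) ^ m) -
      (X 2 ^ n - C c * X 1 ^ m) := by
    have a1 : X 0 ∣ (X 0 * V0 + X 2) ^ n - X 2 ^ n :=
      (Dvd.intro V0 (by ring)).trans (sub_dvd_pow_sub_pow (X 0 * V0 + X 2) (X 2) n)
    have a2 : X 0 ∣ (X 0 * U0 + X 1) ^ m - X 1 ^ m :=
      (Dvd.intro U0 (by ring)).trans (sub_dvd_pow_sub_pow (X 0 * U0 + X 1) (X 1) m)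
    have := dvd_sub a1 (a2.mul_left (C c))
    convert this using 1
    ring
  have tj : tdeg (X 2 ^ n - C c * X 1 ^ m : MvPolynomial (Fin 3) k) = 0 := by
    have := tdeg_jj (X 1 ^ n - C c * X 0 ^ m : MvPolynomial (Fin 2) k)
    simpa [jj] using this
  have e5 := sub_eq_zero.1 (tdeg_eq_zero_of_X_dvd e4 (tdeg_sub_le e3 tj))
  obtain ⟨m1, m2⟩ := mason n m hn hm hnm c hc _ _ e5
  have f1 : X 0 * U0 = 0 := by
    apply tdeg_eq_zero_of_X_dvd (Dvd.intro U0 rfl)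
    rw [show X 0 * U0 = (X 0 * U0 + X 1) - X 1 by ring]
    exact tdeg_sub_le m1 tdeg_X_one
  have f2 : X 0 * V0 = 0 := by
    apply tdeg_eq_zero_of_X_dvd (Dvd.intro V0 rfl)
    rw [show X 0 * V0 = (X 0 * V0 + X 2) - X 2 by ring]
    exact tdeg_sub_le m2 tdeg_X_two
  rcases hUV0 with h | h
  · exact mul_ne_zero (X_ne_zero _) h f1
  · exact mul_ne_zero (X_ne_zero _) h f2

end Degeneration


end PlaneAut


namespace PlaneAut

section JungStep

lemma tdeg_le_iff {u : MvPolynomial (Fin 2) k} {N : ℕ} :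
    tdeg u ≤ N ↔ ∀ d, coeff d u ≠ 0 → d 0 ≤ N := by
  unfold tdeg
  rw [natDegree_finSuccEquiv, degreeOf_le_iff]
  simp only [mem_support_iff]

lemma tdeg_lead (s : ℚ) (hs : 0 < s) {u : MvPolynomial (Fin 2) k} (hu : u ≠ 0) :
    ∃ u0, u0 ≠ 0 ∧ IsLead ![s, 0] (tdeg u * s) u u0 := by
  have h1 : WLe ![s, 0] (tdeg u * s) u := by
    intro d hd
    have := tdeg_le_iff.1 (le_refl (tdeg u)) d hd
    rw [Set.mem_Iic, weight_fin2]
    simp only [Matrix.cons_val_zero, Matrix.cons_val_one, mul_zero, add_zero]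
    gcongr
  obtain ⟨u0, hu0⟩ := h1.exists_isLead
  refine ⟨u0, ?_, hu0⟩
  rintro rfl
  have hlt : ∀ d, coeff d u ≠ 0 → d 0 < tdeg u := by
    intro d hd
    have := hu0.2 d (by simpa using hd)
    rw [Set.mem_Iio, weight_fin2] at this
    simp only [Matrix.cons_val_zero, Matrix.cons_val_one, mul_zero, add_zero] at this
    exact_mod_cast lt_of_mul_lt_mul_right this hs.le
  rcases Nat.eq_zero_or_pos (tdeg u) with h0 | h0
  · apply hu
    ext d
    by_contra hd
    have := hlt d (by simpa using hd)
    omega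
  · have : tdeg u ≤ tdeg u - 1 := tdeg_le_iff.2 fun d hd => by have := hlt d hd; omega
    omega

lemma tdeg_lt_of_lead (s : ℚ) (hs : 0 < s) {u : MvPolynomial (Fin 2) k} {N : ℕ} (hN : 0 < N)
    (h : IsLead ![s, 0] (N * s) u 0) : tdeg u < N := by
  have : tdeg u ≤ N - 1 := tdeg_le_iff.2 fun d hd => by
    have := h.2 d (by simpa using hd)
    rw [Set.mem_Iio, weight_fin2] at this
    simp only [Matrix.cons_val_zero, Matrix.cons_val_one, mul_zero, add_zero] at this
    have : d 0 < N := by exact_mod_cast lt_of_mul_lt_mul_right this hs.le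
    omega
  omega

lemma jung_step [IsAlgClosed k] (θ : MvPolynomial (Fin 2) k ≃ₐ[k] MvPolynomial (Fin 2) k)
    (h0 : 0 < tdeg (θ (X 0))) (h1 : 0 < tdeg (θ (X 1))) :
    ∃ (c : k) (e : ℕ), tdeg (θ (X 0) - C c * θ (X 1) ^ e) < tdeg (θ (X 0)) ∨
      tdeg (θ (X 1) - C c * θ (X 0) ^ e) < tdeg (θ (X 1)) := by
  obtain ⟨g, n, m, hg, hnm, hgn, hgm⟩ := Nat.exists_coprime' (Nat.gcd_pos_of_pos_left
    (tdeg (θ (X 1))) h0)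
  have hn : 0 < n := by
    rcases Nat.eq_zero_or_pos n with h | h
    · rw [h] at hgn; omega
    · exact h
  have hm : 0 < m := by
    rcases Nat.eq_zero_or_pos m with h | h
    · rw [h] at hgm; omega
    · exact h
  set s : ℚ := 1 / g with hs
  have hg' : (0 : ℚ) < g := by exact_mod_cast hg
  have hs0 : 0 < s := by positivity
  have hne : ∀ i, θ (X i) ≠ 0 := fun i => by simp
  obtain ⟨x, hx, lx⟩ := tdeg_lead s hs0 (hne 0)
  obtain ⟨y, hy, ly⟩ := tdeg_lead s hs0 (hne 1)
  have en : (tdeg (θ (X 0)) * s : ℚ) = n := by rw [hgn, hs]; push_cast; field_simp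
  have em : (tdeg (θ (X 1)) * s : ℚ) = m := by rw [hgm, hs]; push_cast; field_simp
  rw [en] at lx
  rw [em] at ly
  have hP : θ.symm (X 1) ≠ 0 := by simp
  obtain ⟨N, P0, d, lP, hd, hdN⟩ := exists_lead ![(n : ℚ), (m : ℚ)] hP
  have hP0 := lP.ne_zero hd hdN
  have hN : 0 < N := by
    by_contra hN
    have hN' : N ≤ 0 := not_lt.1 hN
    have : θ.symm (X 1) = C (coeff 0 (θ.symm (X 1))) := by
      ext d'
      rw [coeff_C]
      split_ifs with h
      · rw [h]
      · by_contra hd'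
        have := lP.wle d' hd'
        rw [Set.mem_Iic, weight_fin2] at this
        simp only [Matrix.cons_val_zero, Matrix.cons_val_one] at this
        have hle : d' 0 * n + d' 1 * m ≤ 0 := by exact_mod_cast this.trans hN'
        apply h
        ext i
        fin_cases i
        · simp; by_contra hh
          have := Nat.mul_pos (Nat.pos_of_ne_zero (Ne.symm hh)) hn
          omega
        · simp; by_contra hh
          have := Nat.mul_pos (Nat.pos_of_ne_zero (Ne.symm hh)) hm
          omega
    have h2 := congrArg θ this
    rw [AlgEquiv.apply_symm_apply, ← algebraMap_eq, AlgEquiv.commutes, algebraMap_eq] at h2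
    have h3 := congrArg totalDegree h2
    simp at h3
  have l1 := IsLead.aeval (w := ![s, 0]) (g := ![θ (X 0), θ (X 1)]) (g0 := ![x, y])
    (by intro i; fin_cases i; exacts [lx, ly]) lP
  have e1 : aeval ![θ (X 0), θ (X 1)] (θ.symm (X 1)) = X 1 := by
    have : aeval ![θ (X 0), θ (X 1)] = θ.toAlgHom := by
      apply MvPolynomial.algHom_ext
      intro i
      fin_cases i <;> simp
    rw [this]; simp
  rw [e1] at l1
  have l2 : IsLead ![s, 0] N (X 1 : MvPolynomial (Fin 2) k) 0 := by
    apply WLe.isLead (N := 0) _ hN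
    have := (WHom_X (k := k) ![s, 0] 1)
    exact this.mono (by simp)
  have e2 := l1.unique l2
  obtain ⟨c, hc, hxy, hdvd⟩ := whom_root n m hn hm hnm hP0 rfl rfl lP.1 ![x, y] hx hy e2
  simp only [Matrix.cons_val_zero, Matrix.cons_val_one, algebraMap_eq] at hxy
  have hn1 : n = 1 ∨ m = 1 := by
    by_contra hh
    push Not at hh
    exact rigid θ n m (by omega) (by omega) hnm c hc _ P0 N lP hP0 (by simp) hdvd
  rcases hn1 with rfl | rfl
  · refine ⟨c, m, Or.inr (tdeg_lt_of_lead s hs0 h1 ?_)⟩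
    rw [em]
    have := ly.add ((lx.pow m).C_mul (-c) |> fun t => by
      have e : ((m : ℚ) * ((1 : ℕ) : ℚ)) = m := by simp
      rw [e] at t; exact t)
    convert this using 1
    · rw [map_neg]; ring
    · rw [map_neg]; linear_combination -hxy
  · refine ⟨c⁻¹, n, Or.inl (tdeg_lt_of_lead s hs0 h0 ?_)⟩
    rw [en]
    have := lx.add ((ly.pow n).C_mul (-c⁻¹) |> fun t => by
      have e : ((n : ℚ) * ((1 : ℕ) : ℚ)) = n := by simp
      rw [e] at t; exact t)
    convert this using 1
    · rw [map_neg]; ring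
    · have hcc : (C c⁻¹ * C c : MvPolynomial (Fin 2) k) = 1 := by
        rw [← C_mul, inv_mul_cancel₀ hc, C_1]
      rw [map_neg]; linear_combination C c⁻¹ * hxy + x * hcc

end JungStep

section Structure

lemma finSuccEquiv_aeval_X_one (q : MvPolynomial (Fin 1) k) :
    finSuccEquiv k 1 (Polynomial.aeval (X 1) (aeval (fun _ => (Polynomial.X : Polynomial k)) q)) =
      Polynomial.C q := by
  have h1 := finSuccEquiv_X_succ (R := k) (n := 1) (j := 0)
  rw [Fin.succ_zero_eq_one] at h1
  have : ((finSuccEquiv k 1).toAlgHom.comp ((Polynomial.aeval (X 1)).comp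
      (aeval (fun _ => (Polynomial.X : Polynomial k))))) =
      (Polynomial.CAlgHom : MvPolynomial (Fin 1) k →ₐ[k] _) := by
    apply MvPolynomial.algHom_ext
    intro i
    fin_cases i
    simpa using h1
  exact DFunLike.congr_fun this q

lemma tdeg_eq_zero_iff {u : MvPolynomial (Fin 2) k} (h : tdeg u = 0) :
    ∃ P : Polynomial k, u = Polynomial.aeval (X 1) P := by
  unfold tdeg at h
  refine ⟨aeval (fun _ => (Polynomial.X : Polynomial k)) ((finSuccEquiv k 1 u).coeff 0), ?_⟩
  apply (finSuccEquiv k 1).injective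
  rw [finSuccEquiv_aeval_X_one]
  exact Polynomial.eq_C_of_natDegree_eq_zero h

lemma X_one_of_tdeg_zero (θ : MvPolynomial (Fin 2) k ≃ₐ[k] MvPolynomial (Fin 2) k)
    (h : tdeg (θ (X 1)) = 0) : ∃ b c : k, θ (X 1) = C b * X 1 + C c := by
  obtain ⟨P, hP⟩ := tdeg_eq_zero_iff h
  let η : MvPolynomial (Fin 2) k →ₐ[k] Polynomial k := aeval ![0, Polynomial.X]
  have h1 : Polynomial.X = P.comp (η (θ.symm (X 1))) := by
    have h2 := congrArg (fun u => η (θ.symm u)) hP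
    simp only [AlgEquiv.symm_apply_apply] at h2
    have h3 : η (X 1) = Polynomial.X := by simp [η]
    rw [h3] at h2
    rw [h2, ← Polynomial.aeval_algHom_apply, ← Polynomial.aeval_algHom_apply]
    rfl
  have h2 := congrArg Polynomial.natDegree h1
  rw [Polynomial.natDegree_comp, Polynomial.natDegree_X] at h2
  have h3 : P.natDegree ≤ 1 := (Nat.eq_one_of_mul_eq_one_right h2.symm).le
  refine ⟨P.coeff 1, P.coeff 0, ?_⟩
  rw [hP]
  conv_lhs => rw [Polynomial.eq_X_add_C_of_natDegree_le_one h3]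
  simp [algebraMap_eq]

lemma X_zero_of_X_one (φ : MvPolynomial (Fin 2) k ≃ₐ[k] MvPolynomial (Fin 2) k) (b c : k)
    (h : φ (X 1) = C b * X 1 + C c) :
    ∃ (a : k) (P : Polynomial k), a ≠ 0 ∧ φ (X 0) = C a * X 0 + Polynomial.aeval (X 1) P := by
  have hX1 := finSuccEquiv_X_succ (R := k) (n := 1) (j := 0)
  rw [Fin.succ_zero_eq_one] at hX1
  have hCc : ∀ r, finSuccEquiv k 1 (C r) = Polynomial.C (C r) := by
    intro r; simp [finSuccEquiv_apply]
  let τ : MvPolynomial (Fin 1) k →ₐ[k] MvPolynomial (Fin 1) k := aeval (fun _ => C b * X 0 + C c)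
  set q := finSuccEquiv k 1 (φ (X 0)) with hq
  have key : ∀ u, finSuccEquiv k 1 (φ u) = ((finSuccEquiv k 1 u).map τ.toRingHom).comp q := by
    intro u
    induction u using MvPolynomial.induction_on with
    | C a =>
      rw [← algebraMap_eq, AlgEquiv.commutes, algebraMap_eq, hCc]
      simp [τ]
    | add u v hu hv => simp [hu, hv]
    | mul_X u i hu =>
      rw [map_mul, map_mul, map_mul, Polynomial.map_mul, Polynomial.mul_comp, hu]
      congr 1
      fin_cases i
      · simp [finSuccEquiv_X_zero, hq]
      · simp [h, hX1, hCc, τ]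
  have k1 := key (φ.symm (X 0))
  rw [AlgEquiv.apply_symm_apply, finSuccEquiv_X_zero] at k1
  set v := (finSuccEquiv k 1 (φ.symm (X 0))).map τ.toRingHom with hv
  have k2 := congrArg Polynomial.natDegree k1
  rw [Polynomial.natDegree_comp, Polynomial.natDegree_X] at k2
  have q1 : q.natDegree = 1 := Nat.eq_one_of_mul_eq_one_left k2.symm
  have k3 := congrArg Polynomial.leadingCoeff k1
  rw [Polynomial.leadingCoeff_comp (by omega), Polynomial.leadingCoeff_X,
    (Nat.eq_one_of_mul_eq_one_right k2.symm : v.natDegree = 1), pow_one] at k3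
  have k4 : IsUnit q.leadingCoeff := IsUnit.of_mul_eq_one_right _ k3.symm
  rw [Polynomial.leadingCoeff, q1] at k4
  obtain ⟨a, ha, ha2⟩ := isUnit_iff_eq_C_of_isReduced.1 k4
  refine ⟨a, aeval (fun _ => (Polynomial.X : Polynomial k)) (q.coeff 0), ha.ne_zero, ?_⟩
  apply (finSuccEquiv k 1).injective
  rw [map_add, map_mul, finSuccEquiv_aeval_X_one, hCc, finSuccEquiv_X_zero, ← ha2]
  exact Polynomial.eq_X_add_C_of_natDegree_le_one q1.le

end Structure


end PlaneAut


namespace PlaneAut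

section Groups

/-- The automorphism group of the plane. -/
abbrev G (k : Type*) [Field k] := MvPolynomial (Fin 2) k ≃ₐ[k] MvPolynomial (Fin 2) k

lemma map_C' (φ : G k) (a : k) : φ (C a) = C a := by
  rw [← algebraMap_eq, AlgEquiv.commutes]

/-- Automorphisms preserving the total degree. -/
def Aff (k : Type*) [Field k] : Subgroup (G k) where
  carrier := {φ | ∀ g, (φ g).totalDegree = g.totalDegree}
  mul_mem' := by
    intro a b ha hb g
    rw [AlgEquiv.mul_apply, ha, hb]
  one_mem' := fun g => rfl
  inv_mem' := by
    intro a ha g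
    have := ha (a⁻¹ g)
    rw [← this, ← AlgEquiv.mul_apply, mul_inv_cancel, AlgEquiv.one_apply]

lemma J_b_ne {φ : G k} {b c : k} (h : φ (X 1) = C b * X 1 + C c) : b ≠ 0 := by
  rintro rfl
  rw [map_zero, zero_mul, zero_add] at h
  have h2 : φ (X 1) = φ (C c) := by rw [h, map_C']
  have h3 := congrArg totalDegree (φ.injective h2)
  simp at h3

/-- Automorphisms preserving the pencil of lines `y = const`. -/
def J (k : Type*) [Field k] : Subgroup (G k) where
  carrier := {φ | ∃ b c : k, φ (X 1) = C b * X 1 + C c}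
  mul_mem' := by
    rintro φ ψ ⟨b, c, h⟩ ⟨b', c', h'⟩
    refine ⟨b' * b, b' * c + c', ?_⟩
    rw [AlgEquiv.mul_apply, h', map_add, map_mul, h, map_C', map_C']
    simp only [map_mul, map_add]; ring
  one_mem' := ⟨1, 0, by simp⟩
  inv_mem' := by
    rintro φ ⟨b, c, h⟩
    have hb := J_b_ne h
    refine ⟨b⁻¹, -(b⁻¹ * c), ?_⟩
    have h1 := congrArg (φ⁻¹ : G k) h
    rw [← AlgEquiv.mul_apply, inv_mul_cancel, AlgEquiv.one_apply, map_add, map_mul, map_C', map_C'] at h1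
    have hcc : (C b⁻¹ * C b : MvPolynomial (Fin 2) k) = 1 := by
      rw [← C_mul, inv_mul_cancel₀ hb, C_1]
    simp only [map_neg, map_mul]
    linear_combination (-C b⁻¹) * h1 - (φ⁻¹ (X 1)) * hcc

lemma J_struct {φ : G k} (h : φ ∈ J k) : ∃ (a b c : k) (P : Polynomial k), a ≠ 0 ∧ b ≠ 0 ∧
    φ (X 0) = C a * X 0 + Polynomial.aeval (X 1) P ∧ φ (X 1) = C b * X 1 + C c := by
  obtain ⟨b, c, h⟩ := h
  obtain ⟨a, P, ha, hP⟩ := X_zero_of_X_one φ b c h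
  exact ⟨a, b, c, P, ha, J_b_ne h, hP, h⟩

/-- elementary shear -/
noncomputable def sh (P : Polynomial k) : G k :=
  AlgEquiv.ofAlgHom (aeval ![X 0 + Polynomial.aeval (X 1) P, X 1])
    (aeval ![X 0 - Polynomial.aeval (X 1) P, X 1])
    (by
      apply MvPolynomial.algHom_ext
      intro i
      fin_cases i
      · simp [← Polynomial.aeval_algHom_apply]
      · simp)
    (by
      apply MvPolynomial.algHom_ext
      intro i
      fin_cases i
      · simp [← Polynomial.aeval_algHom_apply]
      · simp)

lemma sh_X0 (P : Polynomial k) : sh P (X 0) = X 0 + Polynomial.aeval (X 1) P := by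
  simp [sh]

lemma sh_X1 (P : Polynomial k) : sh P (X 1) = X 1 := by
  simp [sh]

/-- the swap of the coordinates -/
noncomputable def sw : G k := renameEquiv k (Equiv.swap 0 1)

lemma sw_X0 : (sw : G k) (X 0) = X 1 := by simp [sw]

lemma sw_X1 : (sw : G k) (X 1) = X 0 := by simp [sw]

lemma sw_mem : (sw : G k) ∈ Aff k := by
  intro g
  exact totalDegree_renameEquiv _ g

lemma sh_mem (P : Polynomial k) : sh P ∈ J k := ⟨1, 0, by simp [sh_X1]⟩

theorem jung [IsAlgClosed k] (θ : G k) : θ ∈ Aff k ⊔ J k := by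
  have hA : Aff k ≤ Aff k ⊔ J k := le_sup_left
  have hJ : J k ≤ Aff k ⊔ J k := le_sup_right
  have main : ∀ (N : ℕ) (θ : G k), tdeg (θ (X 0)) + tdeg (θ (X 1)) ≤ N → θ ∈ Aff k ⊔ J k := by
    intro N
    induction N with
    | zero =>
      intro θ h
      exact hJ (X_one_of_tdeg_zero θ (by omega))
    | succ N ih =>
      intro θ h
      by_cases h1 : tdeg (θ (X 1)) = 0
      · exact hJ (X_one_of_tdeg_zero θ h1)
      by_cases h0 : tdeg (θ (X 0)) = 0
      · have : θ * sw ∈ J k := X_one_of_tdeg_zero (θ * sw) (by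
          rw [AlgEquiv.mul_apply, sw_X1]; exact h0)
        exact (Subgroup.mul_mem_cancel_right _ (hA sw_mem)).1 (hJ this)
      obtain ⟨c, e, hce⟩ := jung_step θ (Nat.pos_of_ne_zero h0) (Nat.pos_of_ne_zero h1)
      have hsh : ∀ u : MvPolynomial (Fin 2) k, Polynomial.aeval u
          (Polynomial.C (-c) * Polynomial.X ^ e) = - (C c * u ^ e) := by
        intro u; simp [algebraMap_eq]
      rcases hce with hce | hce
      · have := ih (θ * sh (Polynomial.C (-c) * Polynomial.X ^ e)) (by
          rw [AlgEquiv.mul_apply, AlgEquiv.mul_apply, sh_X0, sh_X1, hsh, map_add, map_neg, map_mul,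
            map_C', map_pow, ← sub_eq_add_neg]
          omega)
        exact (Subgroup.mul_mem_cancel_right _ (hJ (sh_mem _))).1 this
      · have := ih (θ * sw * sh (Polynomial.C (-c) * Polynomial.X ^ e)) (by
          rw [AlgEquiv.mul_apply (θ * sw), AlgEquiv.mul_apply (θ * sw), sh_X0, sh_X1, hsh]
          simp only [AlgEquiv.mul_apply, map_add, map_neg, map_mul, map_C', map_pow, sw_X0, sw_X1]
          rw [← sub_eq_add_neg]
          omega)
        exact (Subgroup.mul_mem_cancel_right _ (hA sw_mem)).1
          ((Subgroup.mul_mem_cancel_right _ (hJ (sh_mem _))).1 this)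
  exact main _ θ le_rfl

end Groups


end PlaneAut


namespace PlaneAut

section Filtration

lemma degree_fin2 (d : Fin 2 →₀ ℕ) : (d.sum fun _ e => e) = d 0 + d 1 := by
  rw [Finsupp.sum_fintype _ _ (by simp), Fin.sum_univ_two]

lemma td_le_iff {u : MvPolynomial (Fin 2) k} {N : ℕ} :
    u.totalDegree ≤ N ↔ ∀ d, coeff d u ≠ 0 → d 0 + d 1 ≤ N := by
  rw [totalDegree, Finset.sup_le_iff]
  simp only [mem_support_iff, degree_fin2]

lemma td_exists {u : MvPolynomial (Fin 2) k} (hu : u ≠ 0) :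
    ∃ d, coeff d u ≠ 0 ∧ d 0 + d 1 = u.totalDegree := by
  have hne : u.support.Nonempty := by simpa [Finset.nonempty_iff_ne_empty] using hu
  obtain ⟨d, hd, h⟩ := Finset.exists_mem_eq_sup u.support hne (fun s => s.sum fun _ e => e)
  refine ⟨d, mem_support_iff.1 hd, ?_⟩
  rw [totalDegree, h, degree_fin2]

lemma wle_one_iff {u : MvPolynomial (Fin 2) k} {N : ℕ} :
    WLe ![1, 1] (N : ℚ) u ↔ u.totalDegree ≤ N := by
  rw [td_le_iff]
  constructor
  · intro h d hd
    have := h d hd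
    rw [Set.mem_Iic, weight_fin2] at this
    simp only [Matrix.cons_val_zero, Matrix.cons_val_one, mul_one] at this
    exact_mod_cast this
  · intro h d hd
    have := h d hd
    rw [Set.mem_Iic, weight_fin2]
    simp only [Matrix.cons_val_zero, Matrix.cons_val_one, mul_one]
    exact_mod_cast this

lemma IsLead.aeval_poly {ι : Type*} {w : ι → ℚ} {r : ℚ} (hr : 0 < r) {u u0 : MvPolynomial ι k}
    (hu : IsLead w r u u0) (P : Polynomial k) (d : ℕ) (hP : P.natDegree ≤ d) :
    IsLead w (d * r) (Polynomial.aeval u P) (C (P.coeff d) * u0 ^ d) := by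
  classical
  rw [Polynomial.aeval_eq_sum_range' (Nat.lt_succ_of_le hP), Finset.sum_range_succ,
    ← zero_add (C (P.coeff d) * u0 ^ d)]
  apply IsLead.add
  · rw [← Finset.sum_const_zero (s := Finset.range d)]
    apply IsLead.sum
    intro i hi
    rw [smul_eq_C_mul]
    have := ((hu.pow i).C_mul (P.coeff i)).wle
    refine this.isLead ?_
    have : (i : ℚ) < d := by exact_mod_cast Finset.mem_range.1 hi
    nlinarith
  · rw [smul_eq_C_mul]
    exact (hu.pow d).C_mul _

lemma wle_J_X1 {e : G k} {b c : k} (h : e (X 1) = C b * X 1 + C c) (d : ℚ) :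
    IsLead ![d, 1] 1 (e (X 1)) (C b * X 1) := by
  rw [h, ← add_zero (C b * X 1)]
  apply IsLead.add
  · rw [add_zero]; exact ((WHom_X ![d, 1] 1).isLead).C_mul b
  · exact WLe.isLead (N := 0) ((WHom_C _ c).mono (by simp)) one_pos

lemma aeval_G (φ : G k) (u : MvPolynomial (Fin 2) k) : aeval ![φ (X 0), φ (X 1)] u = φ u := by
  have : aeval ![φ (X 0), φ (X 1)] = φ.toAlgHom := by
    apply MvPolynomial.algHom_ext
    intro i
    fin_cases i <;> simp
  rw [this]; rfl

lemma J_filt {e : G k} (he : e ∈ J k) {d : ℚ} (h : WLe ![d, 1] d (e (X 0)))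
    {N : ℚ} {u : MvPolynomial (Fin 2) k} (hu : WLe ![d, 1] N u) : WLe ![d, 1] N (e u) := by
  obtain ⟨b, c, hb⟩ := he
  rw [← aeval_G]
  refine WLe.aeval ?_ hu
  intro i
  fin_cases i
  · exact h
  · exact (wle_J_X1 hb d).wle

lemma J_lead_X0 {e : G k} {a : k} {P : Polynomial k}
    (hP : e (X 0) = C a * X 0 + Polynomial.aeval (X 1) P) (d : ℕ) (hd : P.natDegree ≤ d) :
    IsLead ![(d : ℚ), 1] d (e (X 0)) (C a * X 0 + C (P.coeff d) * X 1 ^ d) := by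
  rw [hP]
  apply IsLead.add
  · exact ((WHom_X ![(d : ℚ), 1] 0).isLead).C_mul a
  · have := IsLead.aeval_poly (one_pos) ((WHom_X (k := k) ![(d : ℚ), 1] 1).isLead) P d hd
    rw [mul_one] at this
    exact this

lemma J_filt_inv {e : G k} (he : e ∈ J k) {a : k} {P : Polynomial k} (ha : a ≠ 0)
    (hP : e (X 0) = C a * X 0 + Polynomial.aeval (X 1) P) (d : ℕ) (hd : P.natDegree ≤ d) :
    WLe ![(d : ℚ), 1] d (e⁻¹ (X 0)) := by
  obtain ⟨b, c, hb⟩ := (J k).inv_mem he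
  have h1 := congrArg (e⁻¹ : G k) hP
  rw [← AlgEquiv.mul_apply, inv_mul_cancel, AlgEquiv.one_apply, map_add, map_mul, map_C',
    ← Polynomial.aeval_algHom_apply] at h1
  have h2 : e⁻¹ (X 0) = C a⁻¹ * (X 0 - Polynomial.aeval (e⁻¹ (X 1)) P) := by
    have hcc : (C a⁻¹ * C a : MvPolynomial (Fin 2) k) = 1 := by
      rw [← C_mul, inv_mul_cancel₀ ha, C_1]
    linear_combination (-C a⁻¹) * h1 - (e⁻¹ (X 0)) * hcc
  rw [h2]
  apply WSup.C_mul
  apply WSup.sub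
  · exact (WHom_X (k := k) ![(d : ℚ), 1] 0).isLead.wle
  · have := (IsLead.aeval_poly (one_pos) (wle_J_X1 hb (d : ℚ)) P d hd).wle
    rw [mul_one] at this
    exact this

lemma mem_Aff_of {φ : G k} (h : ∀ (g : MvPolynomial (Fin 2) k), (φ g).totalDegree ≤ g.totalDegree)
    (h' : ∀ (g : MvPolynomial (Fin 2) k), (φ⁻¹ g).totalDegree ≤ g.totalDegree) : φ ∈ Aff k := by
  intro g
  apply le_antisymm (h g)
  have := h' (φ g)
  rwa [← AlgEquiv.mul_apply, inv_mul_cancel, AlgEquiv.one_apply] at this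

lemma J_mem_Aff {e : G k} (he : e ∈ J k) {a : k} {P : Polynomial k} (ha : a ≠ 0)
    (hP : e (X 0) = C a * X 0 + Polynomial.aeval (X 1) P) (hd : P.natDegree ≤ 1) : e ∈ Aff k := by
  have h1 := (J_lead_X0 hP 1 hd).wle
  have h2 := J_filt_inv he ha hP 1 hd
  have he' := (J k).inv_mem he
  rw [Nat.cast_one] at h1 h2
  apply mem_Aff_of
  · intro g
    exact wle_one_iff.1 (J_filt he h1 (wle_one_iff.2 le_rfl))
  · intro g
    exact wle_one_iff.1 (J_filt he' h2 (wle_one_iff.2 le_rfl))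

lemma td_le_one {u : MvPolynomial (Fin 2) k} (h : u.totalDegree ≤ 1) :
    ∃ p q r : k, u = C p * X 0 + C q * X 1 + C r := by
  refine ⟨coeff (Finsupp.single 0 1) u, coeff (Finsupp.single 1 1) u, coeff 0 u, ?_⟩
  have hs : u.support ⊆ {Finsupp.single 0 1, Finsupp.single 1 1, 0} := by
    intro d hd
    have h1 := td_le_iff.1 h d (mem_support_iff.1 hd)
    simp only [Finset.mem_insert, Finset.mem_singleton]
    have : (d 0 = 1 ∧ d 1 = 0) ∨ (d 0 = 0 ∧ d 1 = 1) ∨ (d 0 = 0 ∧ d 1 = 0) := by omega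
    rcases this with ⟨h0, h1⟩ | ⟨h0, h1⟩ | ⟨h0, h1⟩
    · left; ext i; fin_cases i <;> simp [h0, h1]
    · right; left; ext i; fin_cases i <;> simp [h0, h1]
    · right; right; ext i; fin_cases i <;> simp [h0, h1]
  have h01 : (Finsupp.single 0 1 : Fin 2 →₀ ℕ) ≠ Finsupp.single 1 1 := by
    intro h; have := DFunLike.congr_fun h 0; simp at this
  have h02 : (Finsupp.single 0 1 : Fin 2 →₀ ℕ) ≠ 0 := by simp
  have h03 : (Finsupp.single 1 1 : Fin 2 →₀ ℕ) ≠ 0 := by simp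
  conv_lhs => rw [← support_sum_monomial_coeff u]
  rw [Finset.sum_subset hs (by intro d _ hd; rw [notMem_support_iff.1 hd]; simp),
    Finset.sum_insert (by simp [h01]), Finset.sum_insert (by simp), Finset.sum_singleton,
    C_mul_X_eq_monomial, C_mul_X_eq_monomial]
  rw [add_assoc]; rfl

end Filtration

section Univariate

lemma X_pow_dvd {u : MvPolynomial (Fin 2) k} {i : Fin 2} {n : ℕ}
    (h : ∀ d, coeff d u ≠ 0 → n ≤ d i) : X i ^ n ∣ u := by
  rw [← support_sum_monomial_coeff u]
  apply Finset.dvd_sum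
  intro d hd
  rw [X_pow_eq_monomial, monomial_dvd_monomial]
  refine ⟨Or.inr ?_, by simp⟩
  simpa using h d (mem_support_iff.1 hd)

lemma eval_line_ne {w : Fin 2 → ℚ} (hw : w 1 ≠ 0) {N : ℚ} {F : MvPolynomial (Fin 2) k}
    (hF : F ≠ 0) (h : WHom w N F) {b : k} (hb : b ≠ 0) :
    aeval ![Polynomial.X, Polynomial.C b] F ≠ 0 := by
  classical
  obtain ⟨d, hd⟩ := ne_zero_iff.1 hF
  intro h0
  have h1 := congrArg (fun p => Polynomial.coeff p (d 0)) h0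
  rw [aeval_fin2] at h1
  simp only [Polynomial.finsetSum_coeff, Polynomial.algebraMap_eq, Matrix.cons_val_zero,
    Matrix.cons_val_one, ← Polynomial.C_pow, Polynomial.coeff_C_mul, Polynomial.coeff_mul_C,
    Polynomial.coeff_X_pow, Polynomial.coeff_zero] at h1
  rw [Finset.sum_eq_single d] at h1
  · simp [hd, hb] at h1
  · intro d' hd' hne
    rw [if_neg]
    · simp
    · intro heq
      apply hne
      have e1 := h d hd
      have e2 := h d' (mem_support_iff.1 hd')
      rw [Set.mem_singleton_iff, weight_fin2] at e1 e2
      rw [← heq] at e2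
      have : (d' 1 : ℚ) = d 1 := mul_right_cancel₀ hw (by linarith)
      have : d' 1 = d 1 := by exact_mod_cast this
      ext i; fin_cases i
      · exact heq.symm
      · exact this
  · intro hh; exact absurd (mem_support_iff.2 hd) hh

lemma eval_line_deg {F : MvPolynomial (Fin 2) k} {D : ℕ} (h : ∀ d, coeff d F ≠ 0 → d 0 ≤ D) (b : k) :
    (aeval ![Polynomial.X, Polynomial.C b] F).natDegree ≤ D := by
  rw [aeval_fin2]
  apply Polynomial.natDegree_sum_le_of_forall_le
  intro d hd
  simp only [Polynomial.algebraMap_eq, Matrix.cons_val_zero,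
    Matrix.cons_val_one, ← Polynomial.C_pow]
  refine (Polynomial.natDegree_C_mul_le _ _).trans ((Polynomial.natDegree_mul_C_le _ _).trans ?_)
  rw [Polynomial.natDegree_X_pow]
  exact h d (mem_support_iff.1 hd)

end Univariate


end PlaneAut


namespace PlaneAut

section KeyLemmas

/-- the top form is highly divisible by `y` -/
def SS (g : MvPolynomial (Fin 2) k) : Prop :=
  ∀ d, coeff d g ≠ 0 → d 0 + d 1 = g.totalDegree → 3 * d 0 ≤ g.totalDegree

lemma SS_of_J {e : G k} (he : e ∈ J k) (he' : e ∉ Aff k) {g : MvPolynomial (Fin 2) k} (hg : g ≠ 0)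
    (h : (e g).totalDegree ≤ g.totalDegree) : SS g := by
  obtain ⟨a, b, c, P, ha, hb, h0, h1⟩ := J_struct he
  set d := P.natDegree with hd
  have hd2 : 2 ≤ d := by
    by_contra hlt
    exact he' (J_mem_Aff he ha h0 (by omega))
  have hp : P.coeff d ≠ 0 := by
    have : P ≠ 0 := by rintro rfl; simp at hd; omega
    exact Polynomial.leadingCoeff_ne_zero.2 this
  set p := P.coeff d with hpdef
  obtain ⟨M, F, dM, lF, hdM, hM⟩ := exists_lead ![(d : ℚ), 1] hg
  have hF := lF.ne_zero hdM hM
  obtain ⟨M, rfl⟩ : ∃ M' : ℕ, M = M' := ⟨dM 0 * d + dM 1, by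
    rw [← hM, weight_fin2]; simp⟩
  have hle : ∀ d', coeff d' g ≠ 0 → d' 0 * d + d' 1 ≤ M := by
    intro d' hd'
    have := lF.wle d' hd'
    rw [Set.mem_Iic, weight_fin2] at this
    simp only [Matrix.cons_val_zero, Matrix.cons_val_one, mul_one] at this
    exact_mod_cast this
  have hFM : ∀ (F : MvPolynomial (Fin 2) k), WHom ![(d : ℚ), 1] M F → ∀ d', coeff d' F ≠ 0 →
      d' 0 * d + d' 1 = M := by
    intro F hF d' hd'
    have := hF d' hd'
    rw [Set.mem_singleton_iff, weight_fin2] at this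
    simp only [Matrix.cons_val_zero, Matrix.cons_val_one, mul_one] at this
    exact_mod_cast this
  set F' : MvPolynomial (Fin 2) k := aeval ![C a * X 0 + C p * X 1 ^ d, C b * X 1] F with hF'
  have lF' : IsLead ![(d : ℚ), 1] M (e g) F' := by
    have := IsLead.aeval (w := ![(d : ℚ), 1]) (g := ![e (X 0), e (X 1)])
      (g0 := ![C a * X 0 + C p * X 1 ^ d, C b * X 1])
      (by intro i; fin_cases i; exacts [J_lead_X0 h0 d le_rfl, wle_J_X1 h1 _]) lF
    rwa [aeval_G] at this
  set m := g.totalDegree with hm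
  -- the order of divisibility
  obtain ⟨n, hn1, hn2⟩ : ∃ n : ℕ, M ≤ m + (d - 1) * n ∧ ∀ i : ℕ, M ≤ m + (d - 1) * i → n ≤ i := by
    classical
    have hex : ∃ n : ℕ, M ≤ m + (d - 1) * n := ⟨M, by
      have : M ≤ (d - 1) * M := Nat.le_mul_of_pos_left _ (by omega)
      omega⟩
    exact ⟨Nat.find hex, Nat.find_spec hex, fun i hi => Nat.find_min' hex hi⟩
  obtain ⟨d1, hd1⟩ : ∃ d1, d = d1 + 1 := ⟨d - 1, by omega⟩
  have hdiv : ∀ (u F : MvPolynomial (Fin 2) k), IsLead ![(d : ℚ), 1] M u F → u.totalDegree ≤ m →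
      X 0 ^ n ∣ F := by
    intro u F hl hu
    apply X_pow_dvd
    intro d' hd'
    apply hn2
    have e1 := td_le_iff.1 hu d' (hl.coeff_ne hd')
    have e2 := hFM F hl.1 d' hd'
    rw [hd1] at e2 ⊢
    rw [Nat.add_sub_cancel, ← e2]
    nlinarith
  have v1 := hdiv g F lF le_rfl
  have v2 := hdiv (e g) F' lF' h
  set Φ : Polynomial k := aeval ![Polynomial.X, Polynomial.C b] F with hΦ
  have hΦ0 : Φ ≠ 0 := eval_line_ne (by simp) hF lF.1 hb
  have w1 : Polynomial.X ^ n ∣ Φ := by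
    have := map_dvd (aeval ![Polynomial.X, Polynomial.C b] : MvPolynomial (Fin 2) k →ₐ[k] _) v1
    simpa using this
  have w2 : (Polynomial.X - Polynomial.C p) ^ n ∣ Φ := by
    have e1 := map_dvd (aeval ![Polynomial.C a⁻¹ * (Polynomial.X - Polynomial.C p), 1] :
      MvPolynomial (Fin 2) k →ₐ[k] Polynomial k) v2
    have e2 : aeval ![Polynomial.C a⁻¹ * (Polynomial.X - Polynomial.C p), 1] F' = Φ := by
      have hcc : (Polynomial.C a * Polynomial.C a⁻¹ : Polynomial k) = 1 := by
        rw [← Polynomial.C_mul, mul_inv_cancel₀ ha, Polynomial.C_1]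
      rw [hF', hΦ]
      have : ((aeval ![Polynomial.C a⁻¹ * (Polynomial.X - Polynomial.C p), 1] :
          MvPolynomial (Fin 2) k →ₐ[k] Polynomial k).comp
          (aeval ![C a * X 0 + C p * X 1 ^ d, C b * X 1])) =
          aeval ![Polynomial.X, Polynomial.C b] := by
        apply MvPolynomial.algHom_ext
        intro i
        fin_cases i
        · simp
          linear_combination (Polynomial.X - Polynomial.C p) * hcc
        · simp
      exact DFunLike.congr_fun this F
    rw [e2, map_pow, aeval_X] at e1
    refine (pow_dvd_pow_of_dvd ?_ n).trans e1
    exact Dvd.intro_left _ rfl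
  have hcop : IsCoprime ((Polynomial.X : Polynomial k) ^ n) ((Polynomial.X - Polynomial.C p) ^ n) := by
    apply IsCoprime.pow
    have := Polynomial.isCoprime_X_sub_C_of_isUnit_sub (R := k) (a := 0) (b := p)
      (by simpa using hp)
    simpa using this
  have w3 := Polynomial.natDegree_le_of_dvd (hcop.mul_dvd w1 w2) hΦ0
  rw [Polynomial.natDegree_mul (pow_ne_zero _ Polynomial.X_ne_zero)
    (pow_ne_zero _ (Polynomial.X_sub_C_ne_zero p)), Polynomial.natDegree_X_pow,
    Polynomial.natDegree_pow, Polynomial.natDegree_X_sub_C] at w3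
  have w4 : Φ.natDegree ≤ M / d := by
    apply eval_line_deg
    intro d' hd'
    rw [Nat.le_div_iff_mul_le (by omega)]
    have := hFM F lF.1 d' hd'
    omega
  have w5 : (n + n) * d ≤ M := by
    rw [← Nat.le_div_iff_mul_le (by omega)]
    omega
  -- conclusion
  intro d' hd' hsum
  have z1 := hle d' hd'
  rw [hd1] at hn1 w5 z1
  rw [Nat.add_sub_cancel] at hn1
  have hd1' : 1 ≤ d1 := by omega
  generalize d' 0 = i at *
  generalize d' 1 = j at *
  have z2 : (d1 + 2) * M ≤ 2 * (d1 + 1) * m := by nlinarith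
  have z3 : m + d1 * i ≤ M := by nlinarith
  have z4 : d1 * ((d1 + 2) * i) ≤ d1 * m := by nlinarith
  have z5 := Nat.le_of_mul_le_mul_left z4 (by omega)
  nlinarith

lemma SS_of_J' {e : G k} (he : e ∈ J k) (he' : e ∉ Aff k) {g : MvPolynomial (Fin 2) k} (hg : g ≠ 0)
    (h : g.totalDegree ≤ (e g).totalDegree) : SS (e g) := by
  apply SS_of_J ((J k).inv_mem he) (fun hh => he' ((Aff k).inv_mem_iff.1 hh)) (by simpa using hg)
  rwa [← AlgEquiv.mul_apply, inv_mul_cancel, AlgEquiv.one_apply]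

lemma Aff_J_of_SS {α : G k} (hα : α ∈ Aff k) {g : MvPolynomial (Fin 2) k} (hg : 0 < g.totalDegree)
    (h1 : SS g) (h2 : SS (α g)) : α ∈ J k := by
  have hg0 : g ≠ 0 := by rintro rfl; simp at hg
  have hαg0 : α g ≠ 0 := by simpa using hg0
  obtain ⟨p0, q0, r0, e0⟩ := td_le_one (u := α (X 0)) (by rw [hα]; simp)
  obtain ⟨p, q, r, e1⟩ := td_le_one (u := α (X 1)) (by rw [hα]; simp)
  by_cases hp : p = 0
  · refine ⟨q, r, ?_⟩
    rw [e1, hp]; simp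
  exfalso
  have hlin : ∀ p q r : k, IsLead ![1, 1] 1 (C p * X 0 + C q * X 1 + C r : MvPolynomial (Fin 2) k)
      (C p * X 0 + C q * X 1) := by
    intro p q r
    rw [← add_zero (C p * X 0 + C q * X 1)]
    refine IsLead.add ?_ (WLe.isLead (N := 0) ((WHom_C _ r).mono (by simp)) one_pos)
    rw [add_zero]
    exact IsLead.add ((WHom_X ![1, 1] 0).isLead.C_mul p) ((WHom_X ![1, 1] 1).isLead.C_mul q)
  set m := g.totalDegree with hm
  have hwl : ∀ u : MvPolynomial (Fin 2) k, u ≠ 0 → u.totalDegree = m → SS u →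
      ∃ F, F ≠ 0 ∧ IsLead ![1, 1] m u F ∧
      (∀ d, coeff d F ≠ 0 → d 0 ≤ m / 3) ∧ (∀ d, coeff d F ≠ 0 → m - m / 3 ≤ d 1) := by
    intro u hu0 hum hS
    obtain ⟨F, hF⟩ := (wle_one_iff.2 hum.le).exists_isLead
    obtain ⟨d, hd, hdm⟩ := td_exists hu0
    have key : ∀ d, coeff d F ≠ 0 → d 0 ≤ m / 3 ∧ m - m / 3 ≤ d 1 := by
      intro d hd
      have a1 := hF.1 d hd
      rw [Set.mem_singleton_iff, weight_fin2] at a1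
      simp only [Matrix.cons_val_zero, Matrix.cons_val_one, mul_one] at a1
      have a2 : d 0 + d 1 = m := by exact_mod_cast a1
      have a3 := hS d (hF.coeff_ne hd) (by rw [a2, hum])
      rw [hum] at a3
      omega
    refine ⟨F, hF.ne_zero hd ?_, hF, fun d hd => (key d hd).1, fun d hd => (key d hd).2⟩
    rw [weight_fin2, ← hum, ← hdm]
    simp
  obtain ⟨F, hF0, lF, -, hF2⟩ := hwl g hg0 rfl h1
  obtain ⟨F', hF0', lF', hF1', -⟩ := hwl (α g) hαg0 (hα g) h2
  have lF'' := IsLead.aeval (w := ![1, 1]) (w' := ![1, 1]) (g := ![α (X 0), α (X 1)])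
    (g0 := ![C p0 * X 0 + C q0 * X 1, C p * X 0 + C q * X 1])
    (by intro i; fin_cases i
        · change IsLead _ 1 (α (X 0)) _; rw [e0]; exact hlin _ _ _
        · change IsLead _ 1 (α (X 1)) _; rw [e1]; exact hlin _ _ _) lF
  rw [aeval_G] at lF''
  have hFF := lF''.unique lF'
  have v1 := map_dvd (aeval ![C p0 * X 0 + C q0 * X 1, C p * X 0 + C q * X 1] :
    MvPolynomial (Fin 2) k →ₐ[k] MvPolynomial (Fin 2) k) (X_pow_dvd hF2)
  rw [hFF, map_pow, aeval_X] at v1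
  have v2 := map_dvd (aeval ![Polynomial.X, Polynomial.C (1 : k)] : MvPolynomial (Fin 2) k →ₐ[k] _) v1
  have hne := eval_line_ne (by simp) hF0' lF'.1 (one_ne_zero (α := k))
  have v3 := Polynomial.natDegree_le_of_dvd v2 hne
  have v4 := eval_line_deg hF1' 1
  have v5 : (aeval ![Polynomial.X, Polynomial.C (1 : k)] (C p * X 0 + C q * X 1 : MvPolynomial (Fin 2) k) : Polynomial k) =
      Polynomial.C p * Polynomial.X + Polynomial.C q := by simp
  have v6 : (![C p0 * X 0 + C q0 * X 1, C p * X 0 + C q * X 1] : Fin 2 → MvPolynomial (Fin 2) k) 1 =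
      C p * X 0 + C q * X 1 := rfl
  rw [v6, map_pow, v5, Polynomial.natDegree_pow, Polynomial.natDegree_linear hp, mul_one] at v3
  omega

end KeyLemmas


end PlaneAut


namespace PlaneAut

section Words

/-- reduced words -/
inductive Red : ℕ → G k → Prop
  | one (e α : G k) : e ∈ J k → e ∉ Aff k → α ∈ Aff k → Red 1 (e * α)
  | succ (n : ℕ) (e α φ : G k) : Red n φ → e ∈ J k → e ∉ Aff k → α ∈ Aff k → α ∉ J k →
      Red (n + 1) (e * α * φ)

lemma Red.pos {n : ℕ} {φ : G k} (h : Red n φ) : 1 ≤ n := by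
  cases h <;> omega

/-- affine, or an affine map times a reduced word -/
def Word (φ : G k) : Prop := φ ∈ Aff k ∨ ∃ (β φ0 : G k) (n : ℕ), β ∈ Aff k ∧ Red n φ0 ∧ φ = β * φ0

lemma Word.aff_mul {α φ : G k} (hα : α ∈ Aff k) (h : Word φ) : Word (α * φ) := by
  rcases h with h | ⟨β, φ0, n, hβ, hr, rfl⟩
  · exact Or.inl ((Aff k).mul_mem hα h)
  · exact Or.inr ⟨α * β, φ0, n, (Aff k).mul_mem hα hβ, hr, by group⟩

lemma Red.word {n : ℕ} {φ : G k} (h : Red n φ) : Word φ :=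
  Or.inr ⟨1, φ, n, (Aff k).one_mem, h, by group⟩

lemma Word.J_mul {e φ : G k} (he : e ∈ J k) (h : Word φ) : Word (e * φ) := by
  by_cases he' : e ∈ Aff k
  · exact h.aff_mul he'
  rcases h with h | ⟨β, φ0, n, hβ, hr, rfl⟩
  · exact (Red.one e φ he he' h).word
  by_cases hβJ : β ∈ J k
  · have h1 : e * β ∈ J k := (J k).mul_mem he hβJ
    cases hr with
    | one e1 α0 h1J h1A hα0 =>
      have h2 : e * β * e1 ∈ J k := (J k).mul_mem h1 h1J
      by_cases h3 : e * β * e1 ∈ Aff k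
      · left
        have := (Aff k).mul_mem h3 hα0
        convert this using 1; group
      · have := (Red.one _ α0 h2 h3 hα0).word
        convert this using 1; group
    | succ n e1 α φ1 hr1 h1J h1A hα hαJ =>
      have h2 : e * β * e1 ∈ J k := (J k).mul_mem h1 h1J
      by_cases h3 : e * β * e1 ∈ Aff k
      · have := hr1.word.aff_mul ((Aff k).mul_mem h3 hα)
        convert this using 1; group
      · have := (Red.succ n _ α φ1 hr1 h2 h3 hα hαJ).word
        convert this using 1; group
  · have := (Red.succ n e β φ0 hr he he' hβ hβJ).word
    convert this using 1; group

lemma word_all [IsAlgClosed k] (φ : G k) : Word φ := by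
  have h := jung φ
  rw [Subgroup.sup_eq_closure] at h
  induction h using Subgroup.closure_induction_left with
  | one => exact Or.inl (Aff k).one_mem
  | mul_left x hx y _ ih =>
    rcases hx with hx | hx
    · exact ih.aff_mul hx
    · exact ih.J_mul hx
  | inv_mul_cancel x hx y _ ih =>
    rcases hx with hx | hx
    · exact ih.aff_mul ((Aff k).inv_mem hx)
    · exact ih.J_mul ((J k).inv_mem hx)

lemma Red.degree {f : MvPolynomial (Fin 2) k} (hf : 0 < f.totalDegree)
    (hmin : ∀ θ : G k, f.totalDegree ≤ (θ f).totalDegree) {n : ℕ} {φ : G k} (h : Red n φ) :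
    SS (φ f) ∧ (2 ≤ n → f.totalDegree < (φ f).totalDegree) := by
  have hf0 : ∀ θ : G k, θ f ≠ 0 := by
    intro θ h0
    have : f = 0 := by simpa using h0
    rw [this] at hf; simp at hf
  induction h with
  | one e α heJ heA hα =>
    refine ⟨?_, by omega⟩
    rw [AlgEquiv.mul_apply]
    apply SS_of_J' heJ heA (hf0 α)
    rw [hα f, ← AlgEquiv.mul_apply]
    exact hmin _
  | succ n e α φ hr heJ heA hα hαJ ih =>
    rw [AlgEquiv.mul_apply, AlgEquiv.mul_apply]
    have hlt : (α (φ f)).totalDegree < (e (α (φ f))).totalDegree := by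
      by_contra hle
      have h1 : SS (α (φ f)) := SS_of_J heJ heA (by simpa using hf0 φ) (not_lt.1 hle)
      exact hαJ (Aff_J_of_SS hα (lt_of_lt_of_le hf (hmin φ)) ih.1 h1)
    refine ⟨SS_of_J' heJ heA (by simpa using hf0 φ) hlt.le, fun _ => ?_⟩
    refine lt_of_le_of_lt ?_ hlt
    rw [hα]
    exact hmin φ

lemma SS_C_mul {f : MvPolynomial (Fin 2) k} {c : k} (hc : c ≠ 0) :
    (C c * f).totalDegree = f.totalDegree := by
  apply le_antisymm
  · rw [td_le_iff]
    intro d hd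
    rw [coeff_C_mul] at hd
    exact td_le_iff.1 le_rfl d (right_ne_zero_of_mul hd)
  · rw [td_le_iff]
    intro d hd
    apply td_le_iff.1 le_rfl d
    rw [coeff_C_mul]
    exact mul_ne_zero hc hd

lemma pres_ne {f : MvPolynomial (Fin 2) k} (hf : 0 < f.totalDegree) {γ : G k} {c : k}
    (h : γ f = C c * f) : c ≠ 0 := by
  rintro rfl
  rw [map_zero, zero_mul] at h
  have : f = 0 := by simpa using h
  rw [this] at hf; simp at hf

lemma pres_deg {f : MvPolynomial (Fin 2) k} (hf : 0 < f.totalDegree) {γ : G k}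
    (h : ∃ c : k, γ f = C c * f) : (γ f).totalDegree = f.totalDegree := by
  obtain ⟨c, hc⟩ := h
  rw [hc, SS_C_mul (pres_ne hf hc)]

lemma decomp [IsAlgClosed k] {f : MvPolynomial (Fin 2) k} (hf : 0 < f.totalDegree)
    (hmin : ∀ θ : G k, f.totalDegree ≤ (θ f).totalDegree) {γ : G k}
    (h : ∃ c : k, γ f = C c * f) (hγ : γ ∉ Aff k) :
    ∃ β e α : G k, β ∈ Aff k ∧ e ∈ J k ∧ e ∉ Aff k ∧ α ∈ Aff k ∧ γ = β * (e * α) := by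
  rcases word_all γ with hw | ⟨β, φ0, n, hβ, hr, rfl⟩
  · exact absurd hw hγ
  have h1 := pres_deg hf h
  rw [AlgEquiv.mul_apply, hβ] at h1
  have h2 := (hr.degree hf hmin).2
  have h3 := hr.pos
  have hn : n = 1 := by
    by_contra hn
    have := h2 (by omega)
    omega
  cases hr with
  | one e α he he' hα => exact ⟨β, e, α, hβ, he, he', hα, rfl⟩
  | succ n e α φ hr1 _ _ _ _ =>
    have := hr1.pos
    omega

lemma mid_SS {f : MvPolynomial (Fin 2) k} (hf : 0 < f.totalDegree) {β e α : G k}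
    (hβ : β ∈ Aff k) (he : e ∈ J k) (he' : e ∉ Aff k) (hα : α ∈ Aff k)
    (h : ∃ c : k, (β * (e * α)) f = C c * f) : SS (α f) := by
  have h1 := pres_deg hf h
  rw [AlgEquiv.mul_apply, hβ, AlgEquiv.mul_apply] at h1
  apply SS_of_J he he'
  · intro h0
    have : f = 0 := by simpa using h0
    rw [this] at hf; simp at hf
  · rw [h1, hα]

lemma le_J [IsAlgClosed k] {Γ : Subgroup (G k)} {f : MvPolynomial (Fin 2) k}
    (hf : 0 < f.totalDegree) (hmin : ∀ θ : G k, f.totalDegree ≤ (θ f).totalDegree)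
    (h : ∀ γ ∈ Γ, ∃ c : k, γ f = C c * f) (hS : SS f) {γ0 : G k} (h0 : γ0 ∈ Γ)
    (h0A : γ0 ∉ Aff k) : Γ ≤ J k := by
  have key : ∀ γ ∈ Γ, γ ∉ Aff k → γ ∈ J k := by
    intro γ hγ hγA
    obtain ⟨β, e, α, hβ, he, he', hα, rfl⟩ := decomp hf hmin (h γ hγ) hγA
    have h1 := Aff_J_of_SS hα hf hS (mid_SS hf hβ he he' hα (h _ hγ))
    have h2 : α⁻¹ * (e⁻¹ * β⁻¹) ∈ Γ := by
      have := Γ.inv_mem hγ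
      convert this using 1; group
    have h3 := Aff_J_of_SS ((Aff k).inv_mem hβ) hf hS (mid_SS hf ((Aff k).inv_mem hα)
      ((J k).inv_mem he) (fun hh => he' ((Aff k).inv_mem_iff.1 hh)) ((Aff k).inv_mem hβ) (h _ h2))
    exact (J k).mul_mem ((J k).inv_mem_iff.1 h3) ((J k).mul_mem he h1)
  intro γ hγ
  by_cases hA : γ ∈ Aff k
  · have h1 : γ * γ0 ∉ Aff k := fun hh => h0A (((Aff k).mul_mem_cancel_left hA).1 hh)
    exact ((J k).mul_mem_cancel_right (key γ0 h0 h0A)).1 (key _ (Γ.mul_mem hγ h0) h1)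
  · exact key γ hγ hA

end Words

section Bounded

/-- bounded degree -/
lemma FG_map {G₁ G₂ : Type*} [Group G₁] [Group G₂] (e : G₁ →* G₂) {H : Subgroup G₁}
    (h : H.FG) : (H.map e).FG := by
  classical
  obtain ⟨S, hS⟩ := h
  exact ⟨S.image e, by rw [Finset.coe_image, ← MonoidHom.map_closure, hS]⟩

def Bd (Γ : Subgroup (G k)) : Prop := ∃ N : ℕ, ∀ φ ∈ Γ, adeg φ ≤ N

lemma td_apply_le (φ : G k) (g : MvPolynomial (Fin 2) k) :
    (φ g).totalDegree ≤ adeg φ * g.totalDegree := by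
  rw [← wle_one_iff, ← aeval_G]
  refine WLe.aeval (w' := fun _ => (adeg φ : ℚ)) ?_ ?_
  · intro i
    fin_cases i
    · exact wle_one_iff.2 (le_max_left _ _)
    · exact wle_one_iff.2 (le_max_right _ _)
  · intro d hd
    have := td_le_iff.1 (le_refl g.totalDegree) d hd
    rw [Set.mem_Iic, weight_fin2, ← add_mul, mul_comm]
    exact_mod_cast Nat.mul_le_mul_left (adeg φ) this

lemma adeg_mul_le (φ ψ : G k) : adeg (φ * ψ) ≤ adeg φ * adeg ψ := by
  apply max_le
  · exact (td_apply_le φ _).trans (Nat.mul_le_mul_left _ (le_max_left _ _))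
  · exact (td_apply_le φ _).trans (Nat.mul_le_mul_left _ (le_max_right _ _))

lemma Bd_conj (θ : G k) {Γ : Subgroup (G k)} (h : Bd (Γ.map (MulAut.conj θ).toMonoidHom)) :
    Bd Γ := by
  obtain ⟨N, hN⟩ := h
  refine ⟨adeg θ⁻¹ * N * adeg θ, fun φ hφ => ?_⟩
  have h1 := hN _ (Subgroup.mem_map_of_mem (MulAut.conj θ).toMonoidHom hφ)
  have h2 : φ = θ⁻¹ * (MulAut.conj θ).toMonoidHom φ * θ := by simp [mul_assoc]
  rw [h2]
  refine (adeg_mul_le _ _).trans (Nat.mul_le_mul_right _ ((adeg_mul_le _ _).trans ?_))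
  exact Nat.mul_le_mul_left _ h1

lemma Bd_of_le_Aff {Γ : Subgroup (G k)} (h : Γ ≤ Aff k) : Bd Γ := by
  refine ⟨1, fun φ hφ => ?_⟩
  apply max_le
  · rw [h hφ]; simp
  · rw [h hφ]; simp

/-- the bounded subgroups of the de Jonquières group -/
def JB (k : Type*) [Field k] (d : ℕ) : Subgroup (G k) where
  carrier := {φ | φ ∈ J k ∧ WLe ![(d : ℚ), 1] d (φ (X 0)) ∧ WLe ![(d : ℚ), 1] d (φ⁻¹ (X 0))}
  mul_mem' := by
    rintro φ ψ ⟨h1, h2, h3⟩ ⟨h1', h2', h3'⟩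
    refine ⟨(J k).mul_mem h1 h1', ?_, ?_⟩
    · exact J_filt h1 h2 h2'
    · rw [mul_inv_rev]
      exact J_filt ((J k).inv_mem h1') h3' h3
  one_mem' := by
    refine ⟨(J k).one_mem, ?_, ?_⟩
    · exact (WHom_X (k := k) ![(d : ℚ), 1] 0).isLead.wle
    · rw [inv_one]; exact (WHom_X (k := k) ![(d : ℚ), 1] 0).isLead.wle
  inv_mem' := by
    rintro φ ⟨h1, h2, h3⟩
    exact ⟨(J k).inv_mem h1, h3, by rwa [inv_inv]⟩

lemma Bd_of_le_J {Γ : Subgroup (G k)} (hΓ : Γ.FG) (h : Γ ≤ J k) : Bd Γ := by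
  classical
  obtain ⟨S, hS⟩ := hΓ
  have hSJ : ∀ s ∈ S, s ∈ J k := fun s hs => h (hS ▸ Subgroup.subset_closure hs)
  have hst : ∀ s ∈ S, ∃ (a : k) (P : Polynomial k), a ≠ 0 ∧
      s (X 0) = C a * X 0 + Polynomial.aeval (X 1) P := by
    intro s hs
    obtain ⟨a, b, c, P, ha, hb, h0, h1⟩ := J_struct (hSJ s hs)
    exact ⟨a, P, ha, h0⟩
  choose! a P ha hP using hst
  set d := S.sup (fun s => (P s).natDegree) + 1 with hd
  have hle : Γ ≤ JB k d := by
    rw [← hS, Subgroup.closure_le]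
    intro s hs
    have hPs : (P s).natDegree ≤ d := (Finset.le_sup (f := fun s => (P s).natDegree) hs).trans (by omega)
    exact ⟨hSJ s hs, (J_lead_X0 (hP s hs) d hPs).wle, J_filt_inv (hSJ s hs) (ha s hs) (hP s hs) d hPs⟩
  refine ⟨d, fun φ hφ => ?_⟩
  obtain ⟨⟨b, c, h1⟩, h2, -⟩ := hle hφ
  apply max_le
  · rw [td_le_iff]
    intro d' hd'
    have := h2 d' hd'
    rw [Set.mem_Iic, weight_fin2] at this
    simp only [Matrix.cons_val_zero, Matrix.cons_val_one, mul_one] at this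
    have h3 : d' 0 * d + d' 1 ≤ d := by exact_mod_cast this
    have h4 : d' 0 ≤ d' 0 * d := Nat.le_mul_of_pos_right _ (by omega)
    omega
  · rw [h1]
    refine (totalDegree_add _ _).trans (max_le ?_ (by simp))
    refine (totalDegree_mul _ _).trans ?_
    simp
    omega

lemma pres_conj {Γ : Subgroup (G k)} {f : MvPolynomial (Fin 2) k} (θ : G k)
    (h : ∀ γ ∈ Γ, ∃ c : k, γ f = C c * f) :
    ∀ γ ∈ Γ.map (MulAut.conj θ).toMonoidHom, ∃ c : k, γ (θ f) = C c * θ f := by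
  rintro _ ⟨γ, hγ, rfl⟩
  obtain ⟨c, hc⟩ := h γ hγ
  refine ⟨c, ?_⟩
  have : ((MulAut.conj θ).toMonoidHom γ) (θ f) = θ (γ f) := by
    rw [← AlgEquiv.mul_apply, ← AlgEquiv.mul_apply]; simp
  rw [this, hc, map_mul, map_C']

theorem main_closed [IsAlgClosed k] {Γ : Subgroup (G k)} (hΓ : Γ.FG) {f : MvPolynomial (Fin 2) k}
    (hf : 0 < f.totalDegree) (h : ∀ γ ∈ Γ, ∃ c : k, γ f = C c * f) : Bd Γ := by
  obtain ⟨θ, hθ⟩ : ∃ θ : G k, ∀ θ' : G k, (θ f).totalDegree ≤ (θ' f).totalDegree :=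
    ⟨Function.argmin (fun θ : G k => (θ f).totalDegree),
      fun θ' => Function.argmin_le (fun θ : G k => (θ f).totalDegree) θ'⟩
  apply Bd_conj θ
  have h1 := pres_conj θ h
  have hΓ1 : (Γ.map (MulAut.conj θ).toMonoidHom).FG := FG_map _ hΓ
  have hf1 : 0 < (θ f).totalDegree := by
    by_contra h0
    have h2 : θ f = C (coeff 0 (θ f)) := totalDegree_eq_zero_iff_eq_C.1 (by omega)
    have h3 : f = C (coeff 0 (θ f)) := θ.injective (by rw [map_C']; exact h2)
    rw [h3] at hf
    simp at hf
  have hmin : ∀ θ' : G k, (θ f).totalDegree ≤ (θ' (θ f)).totalDegree := fun θ' => hθ (θ' * θ)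
  generalize Γ.map (MulAut.conj θ).toMonoidHom = Γ1 at *
  generalize θ f = f1 at *
  by_cases hA : Γ1 ≤ Aff k
  · exact Bd_of_le_Aff hA
  obtain ⟨γ0, hγ0, hγ0A⟩ := SetLike.not_le_iff_exists.1 hA
  obtain ⟨β, e, α, hβ, he, he', hα, rfl⟩ := decomp hf1 hmin (h1 γ0 hγ0) hγ0A
  have hS := mid_SS hf1 hβ he he' hα (h1 _ hγ0)
  apply Bd_conj α
  apply Bd_of_le_J (FG_map _ hΓ1)
  refine le_J (f := α f1) (by rw [hα]; exact hf1) ?_ (pres_conj α h1) hS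
    (Subgroup.mem_map_of_mem _ hγ0) ?_
  · intro θ'
    rw [hα]
    exact hmin (θ' * α)
  · intro hh
    apply hγ0A
    have h2 : β * (e * α) = α⁻¹ * (MulAut.conj α).toMonoidHom (β * (e * α)) * α := by
      simp [mul_assoc]
    rw [h2]
    exact (Aff k).mul_mem ((Aff k).mul_mem ((Aff k).inv_mem hα) hh) hα

end Bounded


end PlaneAut

namespace PlaneAut

section Reduction

lemma exists_semi (f : MvPolynomial (Fin 2) k) (hf : 0 < f.totalDegree) :
    ∃ g : MvPolynomial (Fin 2) k, 0 < g.totalDegree ∧ ∀ φ : G k,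
      Ideal.map φ (Ideal.span {f}).radical = (Ideal.span {f}).radical →
      ∃ c : k, φ g = C c * g := by
  classical
  obtain ⟨inst⟩ : Nonempty (NormalizationMonoid (MvPolynomial (Fin 2) k)) :=
    ⟨(UniqueFactorizationMonoid.strongNormalizationMonoid : StrongNormalizationMonoid _).toNormalizationMonoid⟩
  have hf0 : f ≠ 0 := by rintro rfl; simp at hf
  have hrad : (Ideal.span {f}).radical =
      Ideal.span {UniqueFactorizationMonoid.radical f} := by
    ext u
    rw [Ideal.mem_radical_iff, Ideal.mem_span_singleton,
      ← UniqueFactorizationMonoid.exists_dvd_pow_iff_radical_dvd hf0]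
    simp only [Ideal.mem_span_singleton]
  set g := UniqueFactorizationMonoid.radical f with hg
  refine ⟨g, ?_, ?_⟩
  · by_contra hcon
    have h0 : g.totalDegree = 0 := by omega
    rw [totalDegree_eq_zero_iff_eq_C] at h0
    obtain ⟨n, hn⟩ := UniqueFactorizationMonoid.exists_dvd_radical_self_pow hf0
    rw [← hg, h0, ← C_pow] at hn
    have hg0 : g ≠ 0 := UniqueFactorizationMonoid.radical_ne_zero
    have hc0 : coeff 0 g ≠ 0 := by
      intro h; rw [h, C_0] at h0; exact hg0 h0
    have hu : IsUnit f := isUnit_of_dvd_unit hn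
      ((IsUnit.mk0 _ (pow_ne_zero n hc0)).map C)
    rw [MvPolynomial.isUnit_iff_eq_C_of_isReduced] at hu
    obtain ⟨r, -, hr⟩ := hu
    rw [hr, totalDegree_C] at hf
    exact lt_irrefl _ hf
  · intro φ h
    rw [hrad, Ideal.map_span, Set.image_singleton, Ideal.span_singleton_eq_span_singleton] at h
    obtain ⟨u, hu⟩ := h.symm
    have := u.isUnit
    rw [MvPolynomial.isUnit_iff_eq_C_of_isReduced] at this
    obtain ⟨r, -, hr⟩ := this
    exact ⟨r, by rw [← hr, mul_comm]; exact hu.symm⟩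

variable (K : Type*) [Field K] [Algebra k K]

/-- base change of an algebra map -/
noncomputable def bcHom (φ : G k) : MvPolynomial (Fin 2) K →ₐ[K] MvPolynomial (Fin 2) K :=
  aeval (fun i => map (algebraMap k K) (φ (X i)))

lemma bcHom_map (φ : G k) (u : MvPolynomial (Fin 2) k) :
    bcHom K φ (map (algebraMap k K) u) = map (algebraMap k K) (φ u) := by
  induction u using MvPolynomial.induction_on with
  | C a => rw [map_C, map_C', map_C]; simp [bcHom]
  | add p q hp hq => simp only [map_add, hp, hq]
  | mul_X p i hp =>
    simp only [map_mul, hp, map_X]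
    congr 1
    simp [bcHom]

lemma bcHom_comp (φ ψ : G k) : (bcHom K φ).comp (bcHom K ψ) = bcHom K (φ * ψ) := by
  apply MvPolynomial.algHom_ext
  intro i
  rw [AlgHom.comp_apply]
  have h1 : ∀ χ : G k, bcHom K χ (X i) = map (algebraMap k K) (χ (X i)) := fun χ => by
    simp [bcHom]
  rw [h1 ψ, bcHom_map, h1]
  rfl

lemma bcHom_one : bcHom K (1 : G k) = AlgHom.id K _ := by
  apply MvPolynomial.algHom_ext
  intro i
  simp [bcHom]

/-- base change -/
noncomputable def bc : G k →* G K where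
  toFun φ := AlgEquiv.ofAlgHom (bcHom K φ) (bcHom K φ⁻¹)
    (by rw [bcHom_comp, mul_inv_cancel, bcHom_one])
    (by rw [bcHom_comp, inv_mul_cancel, bcHom_one])
  map_one' := by
    ext1 u
    change bcHom K (1 : G k) u = u
    rw [bcHom_one]; rfl
  map_mul' φ ψ := by
    ext1 u
    change bcHom K (φ * ψ) u = bcHom K φ (bcHom K ψ u)
    rw [← bcHom_comp]; rfl

lemma bc_map (φ : G k) (u : MvPolynomial (Fin 2) k) :
    bc K φ (map (algebraMap k K) u) = map (algebraMap k K) (φ u) := bcHom_map K φ u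

lemma td_map (u : MvPolynomial (Fin 2) k) :
    (map (algebraMap k K) u).totalDegree = u.totalDegree := by
  unfold totalDegree
  rw [support_map_of_injective _ (algebraMap k K).injective]

lemma adeg_bc (φ : G k) : adeg (bc K φ) = adeg φ := by
  have h1 : ∀ i, bc K φ (X i) = map (algebraMap k K) (φ (X i)) := fun i => by
    rw [← bc_map, map_X]
  unfold adeg
  rw [h1, h1, td_map, td_map]

theorem main_thm (Γ : Subgroup (G k)) (hΓ : Γ.FG)
    (f : MvPolynomial (Fin 2) k) (hf : 0 < f.totalDegree)
    (hpres : ∀ φ ∈ Γ,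
      Ideal.map φ (Ideal.span {f}).radical = (Ideal.span {f}).radical) :
    ∃ N : ℕ, ∀ φ ∈ Γ, adeg φ ≤ N := by
  obtain ⟨g, hg, H⟩ := exists_semi f hf
  let K := AlgebraicClosure k
  obtain ⟨N, hN⟩ := main_closed (k := K) (Γ := Γ.map (bc K)) (FG_map _ hΓ)
    (f := map (algebraMap k K) g) (by rw [td_map]; exact hg) (by
      rintro _ ⟨φ, hφ, rfl⟩
      obtain ⟨c, hc⟩ := H φ (hpres φ hφ)
      exact ⟨algebraMap k K c, by rw [bc_map, hc, map_mul, map_C]⟩)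
  exact ⟨N, fun φ hφ => by rw [← adeg_bc K φ]; exact hN _ ⟨φ, hφ, rfl⟩⟩

end Reduction

end PlaneAut

theorem stmt7 (Γ : Subgroup (MvPolynomial (Fin 2) k ≃ₐ[k] MvPolynomial (Fin 2) k))
    (hΓ : Γ.FG)
    (f : MvPolynomial (Fin 2) k) (hf : 0 < f.totalDegree)
    (hpres : ∀ φ ∈ Γ,
      Ideal.map φ (Ideal.span {f}).radical = (Ideal.span {f}).radical) :
    ∃ N : ℕ, ∀ φ ∈ Γ, adeg φ ≤ N := by
  exact PlaneAut.main_thm Γ hΓ f hf hpres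
end

section
/- Let k be an algebraically closed field of characteristic 0. Every torsion element of Aut(A²) is conjugate to a diagonal automorphism: if φ is a k-algebra automorphism of k[x,y] of finite order, then there exist a k-algebra automorphism ψ of k[x,y] and a, b ∈ kˣ such that (ψ ∘ φ ∘ ψ⁻¹)(x) = a x and (ψ ∘ φ ∘ ψ⁻¹)(y) = b y. -/
open MvPolynomial

namespace Lin

/-! ### Locally nilpotent derivations -/

section LND
variable {k A : Type*} [Field k] [CommRing A] [Algebra k A]

/-- `D` is locally nilpotent. -/
def LN (D : Derivation k A A) : Prop := ∀ h, ∃ n, D^[n] h = 0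

lemma iter_zero (D : Derivation k A A) (n : ℕ) : D^[n] 0 = 0 := by
  induction n with
  | zero => rfl
  | succ n ih => rw [Function.iterate_succ_apply, map_zero, ih]

lemma iter_add (D : Derivation k A A) (n : ℕ) (u v : A) :
    D^[n] (u + v) = D^[n] u + D^[n] v := by
  induction n generalizing u v with
  | zero => rfl
  | succ n ih => simp only [Function.iterate_succ_apply, map_add, ih]

lemma iter_mul_zero (D : Derivation k A A) (n : ℕ) :
    ∀ (a b : ℕ) (u v : A), a + b = n → D^[a] u = 0 → D^[b] v = 0 → D^[n] (u * v) = 0 := by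
  induction n with
  | zero =>
    intro a b u v hab hu hv
    obtain rfl : a = 0 := by omega
    have : u = 0 := hu
    simp [this]
  | succ n ih =>
    intro a b u v hab hu hv
    rcases a with _ | a
    · have : u = 0 := hu
      rw [this, zero_mul, iter_zero]
    rcases b with _ | b
    · have : v = 0 := hv
      rw [this, mul_zero, iter_zero]
    rw [Function.iterate_succ_apply, Derivation.leibniz, iter_add, smul_eq_mul, smul_eq_mul,
      ih (a + 1) b u (D v) (by omega) hu (by simpa using hv),
      ih (b + 1) a v (D u) (by omega) hv (by simpa using hu), add_zero]

lemma iter_of_le (D : Derivation k A A) {m n : ℕ} (h : m ≤ n) {u : A} (hu : D^[m] u = 0) :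
    D^[n] u = 0 := by
  obtain ⟨c, rfl⟩ := Nat.exists_eq_add_of_le h
  rw [add_comm, Function.iterate_add_apply, hu, iter_zero]

lemma iter_mul_top (D : Derivation k A A) (n : ℕ) :
    ∀ (a b : ℕ) (u v : A), a + b = n → D^[a + 1] u = 0 → D^[b + 1] v = 0 →
      D^[n] (u * v) = (Nat.choose n a : A) * (D^[a] u * D^[b] v) := by
  induction n with
  | zero =>
    intro a b u v hab hu hv
    obtain rfl : a = 0 := by omega
    obtain rfl : b = 0 := by omega
    simp
  | succ n ih =>
    intro a b u v hab hu hv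
    have e : D^[n + 1] (u * v) = D^[n] (u * D v) + D^[n] (v * D u) := by
      rw [Function.iterate_succ_apply, Derivation.leibniz, iter_add, smul_eq_mul, smul_eq_mul]
    rw [e]
    rcases a with _ | a
    · have hu' : D u = 0 := hu
      rw [hu', mul_zero, iter_zero, add_zero]
      obtain rfl : b = n + 1 := by omega
      rw [ih 0 n u (D v) (by omega) hu (by simpa using hv)]
      simp
    rcases b with _ | b
    · have hv' : D v = 0 := hv
      rw [hv', mul_zero, iter_zero, zero_add]
      obtain rfl : a = n := by omega
      rw [ih 0 a v (D u) (by omega) hv (by simpa using hu)]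
      simp [mul_comm]
    rw [ih (a + 1) b u (D v) (by omega) hu (by simpa using hv),
      ih (b + 1) a v (D u) (by omega) hv (by simpa using hu)]
    have h1 : Nat.choose n (b + 1) = Nat.choose n a := by
      rw [← Nat.choose_symm (by omega)]; congr 1; omega
    rw [h1, Nat.choose_succ_succ]
    simp only [Function.iterate_succ_apply]
    push_cast
    ring

lemma LN.exists_deg {D : Derivation k A A} (hD : LN D) {u : A} (hu : u ≠ 0) :
    ∃ a, D^[a] u ≠ 0 ∧ D^[a + 1] u = 0 := by
  classical
  have h := hD u
  have h0 : Nat.find h ≠ 0 := by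
    intro h0
    have := Nat.find_spec h
    rw [h0] at this
    exact hu this
  obtain ⟨a, ha⟩ := Nat.exists_eq_succ_of_ne_zero h0
  refine ⟨a, Nat.find_min h (by omega), ?_⟩
  have := Nat.find_spec h
  rwa [ha] at this

variable [IsDomain A] [CharZero A]

lemma iter_mul_ne (D : Derivation k A A) {a b : ℕ} {u v : A} (h1 : D^[a] u ≠ 0)
    (h2 : D^[a + 1] u = 0) (h3 : D^[b] v ≠ 0) (h4 : D^[b + 1] v = 0) :
    D^[a + b] (u * v) ≠ 0 := by
  rw [iter_mul_top D (a + b) a b u v rfl h2 h4]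
  refine mul_ne_zero ?_ (mul_ne_zero h1 h3)
  exact_mod_cast (Nat.choose_pos (by omega)).ne'

lemma LN.ker_of_mul {D : Derivation k A A} (hD : LN D) {u v : A} (h0 : u * v ≠ 0)
    (h : D (u * v) = 0) : D u = 0 := by
  obtain ⟨a, ha, ha'⟩ := hD.exists_deg (left_ne_zero_of_mul h0)
  obtain ⟨b, hb, hb'⟩ := hD.exists_deg (right_ne_zero_of_mul h0)
  have := iter_mul_ne D ha ha' hb hb'
  rcases Nat.eq_zero_or_pos (a + b) with h1 | h1
  · obtain rfl : a = 0 := by omega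
    exact ha'
  · exact absurd (iter_of_le D (m := 1) h1 h) this

lemma LN.ker_of_dvd {D : Derivation k A A} (hD : LN D) {u F : A} (h0 : F ≠ 0)
    (h : D F = 0) (hu : u ∣ F) : D u = 0 := by
  obtain ⟨v, rfl⟩ := hu
  exact hD.ker_of_mul h0 h

/-- A locally nilpotent derivation with `u ∣ D v`, `v ∣ D u` kills `u` or `v`. -/
lemma LN.cross {D : Derivation k A A} (hD : LN D) {u v : A} (hu : u ∣ D v) (hv : v ∣ D u) :
    D u = 0 ∨ D v = 0 := by
  by_contra! hne
  obtain ⟨s, hs⟩ := hu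
  obtain ⟨r, hr⟩ := hv
  have hsv : u * s ≠ 0 := hs ▸ hne.2
  have hru : v * r ≠ 0 := hr ▸ hne.1
  obtain ⟨a, ha, ha'⟩ := hD.exists_deg (left_ne_zero_of_mul hsv)
  obtain ⟨c, hc, hc'⟩ := hD.exists_deg (right_ne_zero_of_mul hsv)
  obtain ⟨b, hb, hb'⟩ := hD.exists_deg (left_ne_zero_of_mul hru)
  obtain ⟨e, he, he'⟩ := hD.exists_deg (right_ne_zero_of_mul hru)
  have h1 := iter_mul_ne D ha ha' hc hc'
  have h2 := iter_mul_ne D hb hb' he he'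
  rw [← hs, ← Function.iterate_succ_apply] at h1
  rw [← hr, ← Function.iterate_succ_apply] at h2
  have h3 : a + c + 1 < b + 1 := by
    by_contra h; exact h1 (iter_of_le D (by omega) hb')
  have h4 : b + e + 1 < a + 1 := by
    by_contra h; exact h2 (iter_of_le D (by omega) ha')
  omega

end LND

section Poly
variable {k : Type*} [Field k]

lemma LN_of_gens (D : Derivation k (MvPolynomial (Fin 2) k) (MvPolynomial (Fin 2) k)) (h0 : ∃ n, D^[n] (X 0) = 0)
    (h1 : ∃ n, D^[n] (X 1) = 0) : LN D := by
  intro h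
  induction h using MvPolynomial.induction_on with
  | C a => exact ⟨1, by simp⟩
  | add p q hp hq =>
    obtain ⟨m, hm⟩ := hp
    obtain ⟨n, hn⟩ := hq
    exact ⟨m + n, by rw [iter_add, iter_of_le D (by omega) hm, iter_of_le D (by omega) hn, add_zero]⟩
  | mul_X p i hp =>
    obtain ⟨m, hm⟩ := hp
    obtain ⟨n, hn⟩ : ∃ n, D^[n] (X i) = 0 := by
      fin_cases i
      · exact h0
      · exact h1
    exact ⟨m + n, iter_mul_zero D _ m n _ _ rfl hm hn⟩

/-- Weight of an exponent vector. -/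
def wt (p q : ℤ) (m : Fin 2 →₀ ℕ) : ℤ := p * m 0 + q * m 1

lemma wt_add (p q : ℤ) (m n : Fin 2 →₀ ℕ) : wt p q (m + n) = wt p q m + wt p q n := by
  simp [wt]; ring

lemma ext2 {m n : Fin 2 →₀ ℕ} (h0 : m 0 = n 0) (h1 : m 1 = n 1) : m = n := by
  ext i; fin_cases i
  · exact h0
  · exact h1

/-- Polynomials whose monomials all have weight in `s`. -/
def W (k : Type*) [Field k] (p q : ℤ) (s : Set ℤ) :
    Submodule k (MvPolynomial (Fin 2) k) where
  carrier := {h | ∀ m, coeff m h ≠ 0 → wt p q m ∈ s}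
  add_mem' := by
    intro a b ha hb m hm
    rw [coeff_add] at hm
    by_cases h : coeff m a = 0
    · exact hb m (by rintro h'; simp [h, h'] at hm)
    · exact ha m h
  zero_mem' := by intro m hm; simp at hm
  smul_mem' := by
    intro c a ha m hm
    rw [coeff_smul] at hm
    exact ha m (right_ne_zero_of_smul hm)

variable {p q : ℤ} {s t u : Set ℤ} {f g : (MvPolynomial (Fin 2) k)}

lemma W_mono (h : s ⊆ t) (hf : f ∈ W k p q s) : f ∈ W k p q t := fun m hm => h (hf m hm)

lemma W_mul (h : ∀ a ∈ s, ∀ b ∈ t, a + b ∈ u) (hf : f ∈ W k p q s) (hg : g ∈ W k p q t) :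
    f * g ∈ W k p q u := by
  classical
  intro m hm
  rw [coeff_mul] at hm
  obtain ⟨⟨a, b⟩, hab, hne⟩ := Finset.exists_ne_zero_of_sum_ne_zero hm
  rw [Finset.HasAntidiagonal.mem_antidiagonal] at hab
  simp only at hab hne
  rw [← hab, wt_add]
  exact h _ (hf a (left_ne_zero_of_mul hne)) _ (hg b (right_ne_zero_of_mul hne))

lemma W_pderiv0 (h : ∀ a ∈ s, a - p ∈ u) (hf : f ∈ W k p q s) : pderiv 0 f ∈ W k p q u := by
  intro m hm
  rw [coeff_pderiv] at hm
  have := h _ (hf _ (left_ne_zero_of_mul hm))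
  convert this using 1
  rw [wt_add]; simp [wt]

lemma W_pderiv1 (h : ∀ a ∈ s, a - q ∈ u) (hf : f ∈ W k p q s) : pderiv 1 f ∈ W k p q u := by
  intro m hm
  rw [coeff_pderiv] at hm
  have := h _ (hf _ (left_ne_zero_of_mul hm))
  convert this using 1
  rw [wt_add]; simp [wt]

/-- Jacobian bracket as a derivation. -/
noncomputable def jac (f : (MvPolynomial (Fin 2) k)) : Derivation k (MvPolynomial (Fin 2) k) (MvPolynomial (Fin 2) k) := pderiv 0 f • pderiv 1 - pderiv 1 f • pderiv 0

lemma jac_apply (f g : (MvPolynomial (Fin 2) k)) : jac f g = pderiv 0 f * pderiv 1 g - pderiv 1 f * pderiv 0 g := by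
  simp [jac]

lemma W_jac (h : ∀ a ∈ s, ∀ b ∈ t, a + b - p - q ∈ u) (hf : f ∈ W k p q s) (hg : g ∈ W k p q t) :
    jac f g ∈ W k p q u := by
  rw [jac_apply]
  refine sub_mem ?_ ?_
  · refine W_mul (s := {c | c + p ∈ s}) (t := {c | c + q ∈ t}) ?_ (W_pderiv0 ?_ hf) (W_pderiv1 ?_ hg)
    · intro a ha b hb
      have := h _ ha _ hb
      convert this using 1; ring
    · intro a ha; simpa using ha
    · intro a ha; simpa using ha
  · refine W_mul (s := {c | c + q ∈ s}) (t := {c | c + p ∈ t}) ?_ (W_pderiv1 ?_ hf) (W_pderiv0 ?_ hg)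
    · intro a ha b hb
      have := h _ ha _ hb
      convert this using 1; ring
    · intro a ha; simpa using ha
    · intro a ha; simpa using ha

lemma W_C (c : k) (h : 0 ∈ s) : C c ∈ W k p q s := by
  classical
  intro m hm
  rw [coeff_C] at hm
  have : m = 0 := by by_contra h'; simp [Ne.symm h'] at hm
  subst this
  simpa [wt] using h

lemma W_X0 (h : p ∈ s) : (X 0 : (MvPolynomial (Fin 2) k)) ∈ W k p q s := by
  classical
  intro m hm
  rw [coeff_X] at hm
  have : Finsupp.single 0 1 = m := by by_contra h'; simp [h'] at hm
  subst this
  simpa [wt] using h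

lemma W_X1 (h : q ∈ s) : (X 1 : (MvPolynomial (Fin 2) k)) ∈ W k p q s := by
  classical
  intro m hm
  rw [coeff_X] at hm
  have : Finsupp.single 1 1 = m := by by_contra h'; simp [h'] at hm
  subst this
  simpa [wt] using h

/-- Weight at most `N`. -/
abbrev Le (k : Type*) [Field k] (p q N : ℤ) :
    Submodule k (MvPolynomial (Fin 2) k) := W k p q (Set.Iic N)
/-- Homogeneous of weight `N`. -/
abbrev Ho (k : Type*) [Field k] (p q N : ℤ) :
    Submodule k (MvPolynomial (Fin 2) k) := W k p q {N}

lemma Le_mono {M N : ℤ} (h : M ≤ N) (hf : f ∈ Le k p q M) : f ∈ Le k p q N :=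
  W_mono (Set.Iic_subset_Iic.2 h) hf

lemma Ho_Le {N : ℤ} (hf : f ∈ Ho k p q N) : f ∈ Le k p q N :=
  W_mono (by simp) hf

lemma Le_mul {M N : ℤ} (hf : f ∈ Le k p q M) (hg : g ∈ Le k p q N) : f * g ∈ Le k p q (M + N) :=
  W_mul (fun a ha b hb => by simp only [Set.mem_Iic] at *; omega) hf hg

lemma Ho_mul {M N : ℤ} (hf : f ∈ Ho k p q M) (hg : g ∈ Ho k p q N) : f * g ∈ Ho k p q (M + N) :=
  W_mul (fun a ha b hb => by simp only [Set.mem_singleton_iff] at *; omega) hf hg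

lemma Le_C (c : k) : C c ∈ Le k p q 0 := W_C c (by simp)
lemma Ho_C (c : k) : C c ∈ Ho k p q 0 := W_C c (by simp)

lemma Le_pow {N : ℤ} (hf : f ∈ Le k p q N) (n : ℕ) : f ^ n ∈ Le k p q (n * N) := by
  induction n with
  | zero => simpa using Le_C (1 : k)
  | succ n ih =>
    rw [pow_succ]
    convert Le_mul ih hf using 2
    push_cast; ring

lemma Ho_pow {N : ℤ} (hf : f ∈ Ho k p q N) (n : ℕ) : f ^ n ∈ Ho k p q (n * N) := by
  induction n with
  | zero => simpa using Ho_C (1 : k)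
  | succ n ih =>
    rw [pow_succ]
    convert Ho_mul ih hf using 2
    push_cast; ring

lemma Ho_Le_zero {M N : ℤ} (hf : f ∈ Ho k p q N) (hg : f ∈ Le k p q M) (h : M < N) : f = 0 := by
  ext m
  by_contra hm
  rw [coeff_zero] at hm
  have h1 := hf m hm
  have h2 := hg m hm
  simp only [Set.mem_Iic, Set.mem_singleton_iff] at h1 h2
  omega

/-- `F` is the weight-`N` leading form of `f` (possibly zero). -/
def Top (p q N : ℤ) (F f : (MvPolynomial (Fin 2) k)) : Prop := F ∈ Ho k p q N ∧ f - F ∈ Le k p q (N - 1)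

lemma exists_Top {N : ℤ} (hf : f ∈ Le k p q N) : ∃ F, Top p q N F f := by
  classical
  refine ⟨∑ m ∈ f.support.filter (fun m => wt p q m = N), monomial m (coeff m f), ?_, ?_⟩
  · refine sum_mem ?_
    intro m hm n hn
    rw [coeff_monomial] at hn
    have : m = n := by by_contra h; simp [h] at hn
    subst this
    simpa using (Finset.mem_filter.1 hm).2
  · intro m hm
    rw [coeff_sub, coeff_sum] at hm
    simp only [coeff_monomial, Finset.sum_ite_eq', Finset.mem_filter, mem_support_iff] at hm
    by_cases h0 : coeff m f = 0
    · simp [h0] at hm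
    · have h1 := hf m h0
      simp only [Set.mem_Iic] at h1 ⊢
      by_cases h2 : wt p q m = N
      · simp [h0, h2] at hm
      · omega

lemma Top.Le {N : ℤ} {F : (MvPolynomial (Fin 2) k)} (h : Top p q N F f) : f ∈ Le k p q N := by
  have := add_mem (Le_mono (by omega) h.2) (Ho_Le h.1)
  simpa using this

lemma Top.Le_of_zero {N : ℤ} (h : Top p q N 0 f) : f ∈ Lin.Le k p q (N - 1) := by
  simpa using h.2

lemma Top.ne {N M : ℤ} {F : (MvPolynomial (Fin 2) k)} (h : Top p q N F f) (h0 : F ≠ 0) (hf : f ∈ Lin.Le k p q M) : N ≤ M := by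
  by_contra hlt
  apply h0
  refine Ho_Le_zero h.1 (M := N - 1) ?_ (by omega)
  have := sub_mem (Le_mono (by omega) hf) h.2
  simpa using this

lemma Top.mul {M N : ℤ} {F G : (MvPolynomial (Fin 2) k)} (hf : Top p q M F f) (hg : Top p q N G g) :
    Top p q (M + N) (F * G) (f * g) := by
  refine ⟨Ho_mul hf.1 hg.1, ?_⟩
  have e : f * g - F * G = (f - F) * g + F * (g - G) := by ring
  rw [e]
  refine add_mem ?_ ?_
  · exact Le_mono (by omega) (Le_mul hf.2 hg.Le)
  · exact Le_mono (by omega) (Le_mul (Ho_Le hf.1) hg.2)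

lemma Top.jac {M N : ℤ} {F G : (MvPolynomial (Fin 2) k)} (hf : Top p q M F f) (hg : Top p q N G g) :
    Top p q (M + N - p - q) (Lin.jac F G) (Lin.jac f g) := by
  refine ⟨W_jac ?_ hf.1 hg.1, ?_⟩
  · intro a ha b hb; simp only [Set.mem_singleton_iff] at *; omega
  have e : Lin.jac f g - Lin.jac F G = Lin.jac (f - F) g + Lin.jac F (g - G) := by
    simp only [jac_apply, map_sub]; ring
  rw [e]
  refine add_mem ?_ ?_
  · refine W_jac ?_ hf.2 hg.Le
    intro a ha b hb; simp only [Set.mem_Iic] at *; omega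
  · refine W_jac ?_ hf.1 hg.2
    intro a ha b hb; simp only [Set.mem_Iic, Set.mem_singleton_iff] at *; omega

lemma Top_refl {N : ℤ} (h : f ∈ Ho k p q N) : Top p q N f f := ⟨h, by simp⟩

lemma Top.pow {N : ℤ} {F : (MvPolynomial (Fin 2) k)} (hf : Top p q N F f) (n : ℕ) :
    Top p q (n * N) (F ^ n) (f ^ n) := by
  induction n with
  | zero => simpa using Top_refl (Ho_C (1 : k))
  | succ n ih =>
    rw [pow_succ, pow_succ]
    convert Top.mul ih hf using 1
    push_cast; ring

lemma Top.add_lower {N : ℤ} {F : (MvPolynomial (Fin 2) k)} (hf : Top p q N F f) (hg : g ∈ Lin.Le k p q (N - 1)) :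
    Top p q N F (f + g) := by
  refine ⟨hf.1, ?_⟩
  have := add_mem hf.2 hg
  convert this using 1; ring

lemma Top.C_mul {N : ℤ} {F : (MvPolynomial (Fin 2) k)} (hf : Top p q N F f) (c : k) :
    Top p q N (C c * F) (C c * f) := by
  have := (Top_refl (Ho_C (p := p) (q := q) c)).mul hf
  simpa using this

lemma Top.iter {M N : ℤ} {F G : (MvPolynomial (Fin 2) k)} (hf : Top p q M F f) (hg : Top p q N G g) (n : ℕ) :
    Top p q (N + n * (M - p - q)) ((Lin.jac F)^[n] G) ((Lin.jac f)^[n] g) := by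
  induction n with
  | zero => simpa using hg
  | succ n ih =>
    rw [Function.iterate_succ_apply', Function.iterate_succ_apply']
    convert hf.jac ih using 1
    push_cast; ring

lemma Top_zero {N : ℤ} {F : (MvPolynomial (Fin 2) k)} (h : Top p q N F 0) : F = 0 := by
  refine Ho_Le_zero h.1 (M := N - 1) ?_ (by omega)
  have := h.2
  rw [zero_sub] at this
  simpa using neg_mem this

lemma LN_Top {M : ℤ} {F : (MvPolynomial (Fin 2) k)} (hf : Top p q M F f) (h : LN (Lin.jac f)) : LN (Lin.jac F) := by
  refine LN_of_gens _ ?_ ?_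
  · obtain ⟨n, hn⟩ := h (X 0)
    have := hf.iter (Top_refl (W_X0 (p := p) (q := q) rfl)) n
    rw [hn] at this
    exact ⟨n, Top_zero this⟩
  · obtain ⟨n, hn⟩ := h (X 1)
    have := hf.iter (Top_refl (W_X1 (p := p) (q := q) rfl)) n
    rw [hn] at this
    exact ⟨n, Top_zero this⟩

lemma subst_mono (σ : (MvPolynomial (Fin 2) k) →ₐ[k] (MvPolynomial (Fin 2) k)) (m : Fin 2 →₀ ℕ) (c : k) :
    σ (monomial m c) = C c * (σ (X 0) ^ m 0 * σ (X 1) ^ m 1) := by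
  have : (monomial m c : (MvPolynomial (Fin 2) k)) = C c * (X 0 ^ m 0 * X 1 ^ m 1) := by
    rw [monomial_eq, Finsupp.prod_fintype _ _ (by simp), Fin.prod_univ_two]
  rw [this]
  simp only [map_mul, map_pow]
  congr 1
  exact σ.commutes c

lemma Le_subst {a b N : ℤ} (σ : (MvPolynomial (Fin 2) k) →ₐ[k] (MvPolynomial (Fin 2) k)) (h0 : σ (X 0) ∈ Le k p q a) (h1 : σ (X 1) ∈ Le k p q b)
    (hf : f ∈ Le k a b N) : σ f ∈ Le k p q N := by
  rw [f.as_sum, map_sum]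
  refine sum_mem fun m hm => ?_
  rw [subst_mono]
  have h := hf m (mem_support_iff.1 hm)
  refine Le_mono ?_ (Le_mul (Le_C _) (Le_mul (Le_pow h0 _) (Le_pow h1 _)))
  simp only [wt, Set.mem_Iic] at h
  linarith

lemma Ho_subst {a b N : ℤ} (σ : (MvPolynomial (Fin 2) k) →ₐ[k] (MvPolynomial (Fin 2) k)) (h0 : σ (X 0) ∈ Ho k p q a) (h1 : σ (X 1) ∈ Ho k p q b)
    (hf : f ∈ Ho k a b N) : σ f ∈ Ho k p q N := by
  rw [f.as_sum, map_sum]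
  refine sum_mem fun m hm => ?_
  rw [subst_mono]
  have h := hf m (mem_support_iff.1 hm)
  simp only [wt, Set.mem_singleton_iff] at h
  have := (Ho_mul (Ho_C (coeff m f)) (Ho_mul (Ho_pow h0 (m 0)) (Ho_pow h1 (m 1))))
  convert this using 2
  linarith

lemma pderiv_subst (σ : (MvPolynomial (Fin 2) k) →ₐ[k] (MvPolynomial (Fin 2) k)) (i : Fin 2) (f : (MvPolynomial (Fin 2) k)) :
    pderiv i (σ f) = σ (pderiv 0 f) * pderiv i (σ (X 0)) + σ (pderiv 1 f) * pderiv i (σ (X 1)) := by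
  induction f using MvPolynomial.induction_on with
  | C a =>
    have : σ (C a) = C a := σ.commutes a
    simp [this]
  | add f g hf hg => simp only [map_add, hf, hg]; ring
  | mul_X f j hf =>
    simp only [map_mul, Derivation.leibniz, hf, smul_eq_mul, map_add]
    fin_cases j
    · simp; ring
    · simp; ring

lemma jac_subst (σ : (MvPolynomial (Fin 2) k) →ₐ[k] (MvPolynomial (Fin 2) k)) (f g : (MvPolynomial (Fin 2) k)) :
    jac (σ f) (σ g) = σ (jac f g) * jac (σ (X 0)) (σ (X 1)) := by
  simp only [jac_apply, pderiv_subst σ _ f, pderiv_subst σ _ g, map_sub, map_mul]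
  ring

lemma jac_const (θ : (MvPolynomial (Fin 2) k) ≃ₐ[k] (MvPolynomial (Fin 2) k)) : ∃ c : k, c ≠ 0 ∧ jac (θ (X 0)) (θ (X 1)) = C c := by
  have h := jac_subst (θ : (MvPolynomial (Fin 2) k) →ₐ[k] (MvPolynomial (Fin 2) k)) (θ.symm (X 0)) (θ.symm (X 1))
  have h1 : jac (X 0 : (MvPolynomial (Fin 2) k)) (X 1) = 1 := by simp [jac_apply]
  simp only [AlgEquiv.coe_toAlgHom, AlgEquiv.apply_symm_apply, h1] at h
  have hu : IsUnit (jac (θ (X 0)) (θ (X 1))) := IsUnit.of_mul_eq_one_right _ h.symm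
  rw [MvPolynomial.isUnit_iff_eq_C_of_isReduced] at hu
  obtain ⟨r, hr, h⟩ := hu
  exact ⟨r, hr.ne_zero, h⟩

lemma jac_self (f : (MvPolynomial (Fin 2) k)) : jac f f = 0 := by rw [jac_apply]; ring

lemma LN_coord (θ : (MvPolynomial (Fin 2) k) ≃ₐ[k] (MvPolynomial (Fin 2) k)) : LN (jac (θ (X 0))) := by
  obtain ⟨c, hc, h⟩ := jac_const θ
  have key : ∀ f : (MvPolynomial (Fin 2) k), ∃ n, (jac (θ (X 0)))^[n] (θ f) = 0 := by
    intro f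
    induction f using MvPolynomial.induction_on with
    | C a =>
      have : θ (C a) = C a := θ.commutes a
      exact ⟨1, by simp [this]⟩
    | add p q hp hq =>
      obtain ⟨m, hm⟩ := hp
      obtain ⟨n, hn⟩ := hq
      exact ⟨m + n, by
        rw [map_add, iter_add, iter_of_le _ (by omega) hm, iter_of_le _ (by omega) hn, add_zero]⟩
    | mul_X p i hp =>
      obtain ⟨m, hm⟩ := hp
      obtain ⟨n, hn⟩ : ∃ n, (jac (θ (X 0)))^[n] (θ (X i)) = 0 := by
        fin_cases i
        · exact ⟨1, by simp [jac_self]⟩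
        · exact ⟨2, by simp [h]⟩
      exact ⟨m + n, by rw [map_mul]; exact iter_mul_zero _ _ m n _ _ rfl hm hn⟩
  intro f
  simpa using key (θ.symm f)

end Poly
end Lin

namespace Lin
section Poly2
variable {k : Type*} [Field k]

/-- A univariate polynomial evaluated at `y`. -/
noncomputable def rY (r : Polynomial k) : MvPolynomial (Fin 2) k := Polynomial.aeval (X 1) r

lemma rY_add (r s : Polynomial k) : rY (r + s) = rY r + rY s := by simp [rY]
lemma rY_neg (r : Polynomial k) : rY (-r) = - rY r := by simp [rY]
lemma rY_monomial (n : ℕ) (c : k) : rY (Polynomial.monomial n c) = C c * X 1 ^ n := by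
  simp [rY, Polynomial.aeval_monomial, algebraMap_eq]

lemma map_rY (σ : MvPolynomial (Fin 2) k →ₐ[k] MvPolynomial (Fin 2) k) (r : Polynomial k) :
    σ (rY r) = Polynomial.aeval (σ (X 1)) r := by
  rw [rY, Polynomial.aeval_algHom_apply]

lemma hom_ext2 {B : Type*} [CommRing B] [Algebra k B] {σ τ : MvPolynomial (Fin 2) k →ₐ[k] B}
    (h0 : σ (X 0) = τ (X 0)) (h1 : σ (X 1) = τ (X 1)) : σ = τ := by
  apply MvPolynomial.algHom_ext
  intro i; fin_cases i
  · exact h0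
  · exact h1

/-- The elementary automorphism `x ↦ x + r(y)`, `y ↦ y`. -/
noncomputable def tau (r : Polynomial k) : MvPolynomial (Fin 2) k ≃ₐ[k] MvPolynomial (Fin 2) k :=
  AlgEquiv.ofAlgHom (aeval ![X 0 + rY r, X 1]) (aeval ![X 0 - rY r, X 1])
    (hom_ext2 (by simp [map_rY]; simp [rY]) (by simp))
    (hom_ext2 (by simp [map_rY]; simp [rY]) (by simp))

@[simp] lemma tau_X0 (r : Polynomial k) : tau r (X 0) = X 0 + rY r := by
  simp [tau]
@[simp] lemma tau_X1 (r : Polynomial k) : tau r (X 1) = X 1 := by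
  simp [tau]
@[simp] lemma tau_rY (r s : Polynomial k) : tau r (rY s) = rY s := by
  have := map_rY (tau r : MvPolynomial (Fin 2) k →ₐ[k] MvPolynomial (Fin 2) k) s
  simpa [rY] using this
@[simp] lemma alg_C (σ : MvPolynomial (Fin 2) k ≃ₐ[k] MvPolynomial (Fin 2) k) (c : k) :
    σ (C c) = C c := σ.commutes c

lemma tau_tau (r s : Polynomial k) (f : MvPolynomial (Fin 2) k) :
    tau s (tau r f) = tau (r + s) f := by
  have : ((tau s : MvPolynomial (Fin 2) k →ₐ[k] MvPolynomial (Fin 2) k).comp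
      (tau r : MvPolynomial (Fin 2) k →ₐ[k] MvPolynomial (Fin 2) k)) =
      (tau (r + s) : MvPolynomial (Fin 2) k →ₐ[k] MvPolynomial (Fin 2) k) := by
    apply hom_ext2
    · simp [rY_add]; ring
    · simp
  exact DFunLike.congr_fun this f

lemma tau_zero (f : MvPolynomial (Fin 2) k) : tau 0 f = f := by
  have : (tau (0 : Polynomial k) : MvPolynomial (Fin 2) k →ₐ[k] MvPolynomial (Fin 2) k) = AlgHom.id k _ := by
    apply hom_ext2
    · simp [rY]
    · simp
  exact DFunLike.congr_fun this f

lemma tau_neg_tau (r : Polynomial k) (f : MvPolynomial (Fin 2) k) :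
    tau (-r) (tau r f) = f := by
  rw [tau_tau, add_neg_cancel, tau_zero]

variable {p q : ℤ} {f g F G : MvPolynomial (Fin 2) k}

lemma mono_of_unique {m : Fin 2 →₀ ℕ} (h : ∀ n, coeff n F ≠ 0 → n = m) :
    F = C (coeff m F) * (X 0 ^ m 0 * X 1 ^ m 1) := by
  have h1 : F = monomial m (coeff m F) := by
    classical
    ext n
    rw [coeff_monomial]
    split_ifs with hn
    · rw [hn]
    · by_contra h'; exact hn (h n h').symm
  have := subst_mono (AlgHom.id k _) m (coeff m F)
  rw [← h1] at this
  exact this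

lemma coeff_X1_pow (c : k) (n : ℕ) (m : Fin 2 →₀ ℕ) :
    coeff m (C c * X 1 ^ n) = if Finsupp.single 1 n = m then c else 0 := by
  classical
  rw [← coeff_monomial]
  congr 1
  rw [monomial_eq]; simp

variable [CharZero k]

lemma pderiv1_zero (h : pderiv 1 F = 0) {m : Fin 2 →₀ ℕ} (hm : coeff m F ≠ 0) : m 1 = 0 := by
  by_contra h1
  have h2 := coeff_pderiv (i := 1) F (m - Finsupp.single 1 1)
  have h3 : m - Finsupp.single 1 1 + Finsupp.single 1 1 = m := by
    apply ext2
    · simp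
    · simp; omega
  rw [h, h3, coeff_zero] at h2
  have h4 : (((m - Finsupp.single 1 1 : Fin 2 →₀ ℕ) 1 : ℕ) : k) + 1 ≠ 0 := Nat.cast_add_one_ne_zero _
  exact mul_ne_zero hm h4 h2.symm

lemma pderiv0_zero (h : pderiv 0 F = 0) {m : Fin 2 →₀ ℕ} (hm : coeff m F ≠ 0) : m 0 = 0 := by
  by_contra h1
  have h2 := coeff_pderiv (i := 0) F (m - Finsupp.single 0 1)
  have h3 : m - Finsupp.single 0 1 + Finsupp.single 0 1 = m := by
    apply ext2
    · simp; omega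
    · simp
  rw [h, h3, coeff_zero] at h2
  have h4 : (((m - Finsupp.single 0 1 : Fin 2 →₀ ℕ) 0 : ℕ) : k) + 1 ≠ 0 := Nat.cast_add_one_ne_zero _
  exact mul_ne_zero hm h4 h2.symm

lemma jac_swap (f g : MvPolynomial (Fin 2) k) : jac f g = - jac g f := by
  simp only [jac_apply]; ring

lemma ker_u (p : ℕ) (hp : 1 ≤ p) (l : k) {M : ℤ} (hG : G ∈ Ho k p 1 M)
    (hj : jac (X 0 - C l * X 1 ^ p) G = 0) (h0 : G ≠ 0) :
    ∃ (c : k) (s : ℕ), c ≠ 0 ∧ G = C c * (X 0 - C l * X 1 ^ p) ^ s ∧ (p * s : ℤ) = M := by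
  set r := Polynomial.monomial p l with hr
  have e0 : tau r (X 0 - C l * X 1 ^ p) = X 0 := by
    rw [← rY_monomial, map_sub, tau_rY, tau_X0, add_sub_cancel_right]
  have h1 := jac_subst (tau r : MvPolynomial (Fin 2) k →ₐ[k] MvPolynomial (Fin 2) k)
    (X 0 - C l * X 1 ^ p) G
  rw [hj, map_zero, zero_mul] at h1
  simp only [AlgEquiv.coe_toAlgHom] at h1
  rw [e0, jac_apply] at h1
  have h2 : pderiv 1 (tau r G) = 0 := by simpa [pderiv_X_of_ne] using h1
  have h3 : tau r G ∈ Ho k p 1 M := by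
    refine Ho_subst (tau r : MvPolynomial (Fin 2) k →ₐ[k] MvPolynomial (Fin 2) k) ?_ ?_ hG
    · simp only [AlgEquiv.coe_toAlgHom, tau_X0, hr, rY_monomial]
      refine add_mem (W_X0 rfl) ?_
      have := Ho_mul (Ho_C (p := (p : ℤ)) (q := 1) l) (Ho_pow (W_X1 (k := k) (p := (p : ℤ)) (q := 1) rfl) p)
      simpa using this
    · rw [AlgEquiv.coe_toAlgHom, tau_X1]; exact W_X1 rfl
  have h4 : tau r G ≠ 0 := by simpa using h0
  obtain ⟨m, hm⟩ := MvPolynomial.ne_zero_iff.1 h4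
  have h5 : ∀ n, coeff n (tau r G) ≠ 0 → (n 1 = 0 ∧ (p * n 0 : ℤ) = M) := by
    intro n hn
    have := pderiv1_zero h2 hn
    refine ⟨this, ?_⟩
    have h6 := h3 n hn
    simpa [wt, this] using h6
  have h6 := mono_of_unique (F := tau r G) (m := m) (by
    intro n hn
    have a := h5 n hn
    have b := h5 m hm
    apply ext2
    · have : (p * n 0 : ℤ) = p * m 0 := a.2.trans b.2.symm
      have hp' : (p : ℤ) ≠ 0 := by omega
      exact_mod_cast mul_left_cancel₀ hp' this
    · rw [a.1, b.1])
  refine ⟨_, m 0, hm, ?_, (h5 m hm).2⟩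
  apply (tau r).injective
  rw [map_mul, map_pow, e0, alg_C]
  conv_lhs => rw [h6]
  rw [(h5 m hm).1]; simp

lemma div_lemma (p q d : ℕ) (hq : 1 ≤ q) (hc : Nat.Coprime p q) (hF : F ∈ Ho k p q (q * d))
    (μ : k) (hμ : ∑ m ∈ F.support, coeff m F * μ ^ m 0 = 0) :
    (X 0 ^ q - C (μ ^ q) * X 1 ^ p) ∣ F := by
  have key : F = ∑ m ∈ F.support, C (coeff m F) * (X 0 ^ m 0 * X 1 ^ m 1 - C (μ ^ m 0) * X 1 ^ d) := by
    have h1 : F = ∑ m ∈ F.support, C (coeff m F) * (X 0 ^ m 0 * X 1 ^ m 1) := by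
      conv_lhs => rw [F.as_sum]
      refine Finset.sum_congr rfl fun m _ => ?_
      exact subst_mono (AlgHom.id k _) m (coeff m F)
    have h2 : ∑ m ∈ F.support, C (coeff m F) * (C (μ ^ m 0) * X 1 ^ d : MvPolynomial (Fin 2) k) = 0 := by
      simp only [← mul_assoc, ← C_mul]
      rw [← Finset.sum_mul, ← map_sum, hμ, map_zero, zero_mul]
    simp only [mul_sub]
    rw [Finset.sum_sub_distrib, h2, sub_zero]
    exact h1
  rw [key]
  refine Finset.dvd_sum fun m hm => Dvd.dvd.mul_left ?_ _
  have h := hF m (mem_support_iff.1 hm)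
  simp only [wt, Set.mem_singleton_iff] at h
  have h' : p * m 0 + q * m 1 = q * d := by exact_mod_cast h
  have hd : q ∣ m 0 := by
    have : q ∣ p * m 0 := by
      rw [Nat.dvd_add_iff_left (Dvd.intro _ rfl : q ∣ q * m 1), h']
      exact Dvd.intro _ rfl
    exact hc.symm.dvd_of_dvd_mul_left this
  obtain ⟨i, hi⟩ := hd
  have hd : d = p * i + m 1 := by
    rw [hi] at h'
    apply Nat.eq_of_mul_eq_mul_left (show 0 < q by omega)
    rw [← h']; ring
  rw [hi, hd]
  have e : (X 0 ^ (q * i) * X 1 ^ m 1 - C (μ ^ (q * i)) * X 1 ^ (p * i + m 1) : MvPolynomial (Fin 2) k)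
      = ((X 0 ^ q) ^ i - (C (μ ^ q) * X 1 ^ p) ^ i) * X 1 ^ m 1 := by
    rw [pow_mul, pow_mul, C_pow, mul_pow, ← pow_mul, pow_add]; ring
  rw [e]
  exact Dvd.dvd.mul_right (sub_dvd_pow_sub_pow _ _ _) _

lemma root_lemma [IsAlgClosed k] {N : ℤ} (hq : q ≠ 0) (hF : F ∈ Ho k p q N) {m : Fin 2 →₀ ℕ}
    (hm : coeff m F ≠ 0) (hm0 : m 0 ≠ 0) :
    ∃ μ : k, ∑ m ∈ F.support, coeff m F * μ ^ m 0 = 0 ∧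
      ∀ n, coeff n F ≠ 0 → n 0 = 0 → μ ≠ 0 := by
  classical
  set Q : Polynomial k := ∑ m ∈ F.support, Polynomial.monomial (m 0) (coeff m F) with hQ
  have hco : ∀ n, coeff n F ≠ 0 → Q.coeff (n 0) = coeff n F := by
    intro n hn
    rw [hQ, Polynomial.finsetSum_coeff, Finset.sum_eq_single n]
    · simp
    · intro b hb hbn
      rw [Polynomial.coeff_monomial, if_neg]
      intro h
      apply hbn
      apply ext2 h
      have h1 := hF b (mem_support_iff.1 hb)
      have h2 := hF n hn
      simp only [wt, Set.mem_singleton_iff] at h1 h2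
      rw [← h2, h] at h1
      have : q * (b 1 : ℤ) = q * n 1 := by linarith
      exact_mod_cast mul_left_cancel₀ hq this
    · intro h; simp at h; exact absurd h hn
  have hev : ∀ μ, Q.eval μ = ∑ m ∈ F.support, coeff m F * μ ^ m 0 := by
    intro μ; rw [hQ, Polynomial.eval_finsetSum]; simp
  have hdeg : Q.degree ≠ 0 := by
    intro h
    have := hco m hm
    rw [Polynomial.eq_C_of_degree_eq_zero h, Polynomial.coeff_C, if_neg hm0] at this
    exact hm this.symm
  obtain ⟨μ, hμ⟩ := IsAlgClosed.exists_root Q hdeg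
  refine ⟨μ, by rw [← hev]; exact hμ, ?_⟩
  rintro n hn hn0 rfl
  have := hco n hn
  rw [hn0, Polynomial.coeff_zero_eq_eval_zero, hμ.eq_zero] at this
  exact hn this.symm

lemma struct_std [IsAlgClosed k] {n : ℕ} (hF : F ∈ Ho k 1 1 n) (h0 : F ≠ 0) (hL : LN (jac F)) :
    (∃ c : k, c ≠ 0 ∧ F = C c * X 1 ^ n) ∨
      ∃ c l : k, c ≠ 0 ∧ F = C c * (X 0 - C l * X 1) ^ n := by
  by_cases hex : ∃ m, coeff m F ≠ 0 ∧ m 0 ≠ 0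
  · right
    obtain ⟨m, hm, hm0⟩ := hex
    obtain ⟨μ, hμ, -⟩ := root_lemma one_ne_zero hF hm hm0
    have hd := div_lemma 1 1 n le_rfl (by simp) (by simpa using hF) μ hμ
    have h1 := hL.ker_of_dvd h0 (jac_self F) hd
    rw [jac_swap, neg_eq_zero, pow_one, pow_one] at h1
    obtain ⟨c, s, hc, he, hs⟩ := ker_u 1 le_rfl μ (by simpa using hF) h1 h0
    refine ⟨c, μ, hc, ?_⟩
    have : s = n := by simpa using hs
    rw [← this]; simpa using he
  · left
    push Not at hex
    obtain ⟨m, hm⟩ := MvPolynomial.ne_zero_iff.1 h0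
    have h5 : ∀ m, coeff m F ≠ 0 → m = Finsupp.single 1 n := by
      intro m hm
      have h1 := hF m hm
      have h2 := hex m hm
      simp only [wt, Set.mem_singleton_iff, h2] at h1
      apply ext2
      · simpa using h2
      · simp; simpa using h1
    have := mono_of_unique h5
    refine ⟨coeff m F, hm, ?_⟩
    conv_lhs => rw [this]
    rw [h5 m hm]
    simp

lemma Top_coeff {N : ℤ} (h : Top p q N F f) {m : Fin 2 →₀ ℕ} (hm : wt p q m = N) :
    coeff m F = coeff m f := by
  by_contra hne
  have := h.2 m (by rw [coeff_sub]; intro h; exact hne (sub_eq_zero.1 h).symm)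
  simp only [Set.mem_Iic] at this
  omega

lemma X0_not_dvd : ¬ (X 1 : MvPolynomial (Fin 2) k) ∣ X 0 := by
  intro h
  have := (X_dvd_X (R := k)).1 h
  simp at this
lemma X1_not_dvd : ¬ (X 0 : MvPolynomial (Fin 2) k) ∣ X 1 := by
  intro h
  have := (X_dvd_X (R := k)).1 h
  simp at this

end Poly2
end Lin

namespace Lin
section Poly3
variable {k : Type*} [Field k] [CharZero k] [IsAlgClosed k]
variable {f g F G : MvPolynomial (Fin 2) k}

/-- A coordinate of degree at least two involves `x`. -/
lemma coord_involves (θ : MvPolynomial (Fin 2) k ≃ₐ[k] MvPolynomial (Fin 2) k) {d : ℕ} (hd : 2 ≤ d)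
    (hc : coeff (Finsupp.single 1 d) (θ (X 0)) ≠ 0) :
    ∃ m, coeff m (θ (X 0)) ≠ 0 ∧ m 0 ≠ 0 := by
  by_contra! hno
  obtain ⟨κ, hκ, hj⟩ := jac_const θ
  have h0 : pderiv 0 (θ (X 0)) = 0 := by
    ext m
    rw [coeff_pderiv, coeff_zero]
    by_contra h
    have := hno _ (left_ne_zero_of_mul h)
    simp at this
  rw [jac_apply, h0, zero_mul, zero_sub] at hj
  have hu : IsUnit (pderiv 1 (θ (X 0))) := by
    refine isUnit_of_mul_isUnit_left (y := - pderiv 0 (θ (X 1))) ?_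
    rw [mul_neg, hj]
    exact (isUnit_iff_ne_zero.2 hκ).map C
  rw [MvPolynomial.isUnit_iff_eq_C_of_isReduced] at hu
  obtain ⟨b, -, hb⟩ := hu
  have h2 := coeff_pderiv (i := 1) (θ (X 0)) (Finsupp.single 1 (d - 1))
  rw [hb, ← Finsupp.single_add, show d - 1 + 1 = d by omega, coeff_C, if_neg] at h2
  · have h4 : (((Finsupp.single 1 (d - 1) : Fin 2 →₀ ℕ) 1 : ℕ) : k) + 1 ≠ 0 := Nat.cast_add_one_ne_zero _
    exact mul_ne_zero hc h4 h2.symm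
  · intro h
    have := DFunLike.congr_fun h 1
    simp at this
    omega

/-- No locally nilpotent Jacobian derivation kills `x^q - a y^p` for `p, q ≥ 2`. -/
lemma no_cusp {p q : ℕ} (hp : 2 ≤ p) (hq : 2 ≤ q) {a : k} (ha : a ≠ 0) (hL : LN (jac F))
    (hk : jac F (X 0 ^ q - C a * X 1 ^ p) = 0) : jac F (X 0) = 0 := by
  set D := jac F with hD
  have e : (q : MvPolynomial (Fin 2) k) * X 0 ^ (q - 1) * D (X 0)
      = C a * (p : MvPolynomial (Fin 2) k) * X 1 ^ (p - 1) * D (X 1) := by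
    rw [map_sub, Derivation.leibniz, Derivation.leibniz_pow, Derivation.leibniz_pow] at hk
    have : D (C a) = 0 := by
      have := D.map_algebraMap a
      rwa [algebraMap_eq] at this
    rw [this] at hk
    simp only [smul_eq_mul, nsmul_eq_mul, smul_zero, add_zero] at hk
    linear_combination hk
  have hqC : (q : MvPolynomial (Fin 2) k) = C (q : k) := by simp
  have hpC : (p : MvPolynomial (Fin 2) k) = C (p : k) := by simp
  have hq0 : IsUnit (C (q : k) : MvPolynomial (Fin 2) k) :=
    (isUnit_iff_ne_zero.2 (by exact_mod_cast (by omega : q ≠ 0))).map C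
  have hp0 : IsUnit (C a * C (p : k) : MvPolynomial (Fin 2) k) :=
    ((isUnit_iff_ne_zero.2 ha).map C).mul
      ((isUnit_iff_ne_zero.2 (by exact_mod_cast (by omega : p ≠ 0))).map C)
  rw [hqC, hpC] at e
  have P0 : Prime (X 0 : MvPolynomial (Fin 2) k) := X_prime
  have P1 : Prime (X 1 : MvPolynomial (Fin 2) k) := X_prime
  have d1 : (X 1 : MvPolynomial (Fin 2) k) ∣ D (X 0) := by
    have h : (X 1 : MvPolynomial (Fin 2) k) ∣ C (q : k) * X 0 ^ (q - 1) * D (X 0) := by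
      rw [e]
      exact Dvd.dvd.mul_right (Dvd.dvd.mul_left (dvd_pow_self _ (by omega)) _) _
    rcases P1.dvd_or_dvd h with h | h
    · rcases P1.dvd_or_dvd h with h | h
      · exact absurd (isUnit_of_dvd_unit h hq0) P1.not_unit
      · exact absurd (P1.dvd_of_dvd_pow h) X0_not_dvd
    · exact h
  have d0 : (X 0 : MvPolynomial (Fin 2) k) ∣ D (X 1) := by
    have h : (X 0 : MvPolynomial (Fin 2) k) ∣ C a * C (p : k) * X 1 ^ (p - 1) * D (X 1) := by
      rw [← e]
      exact Dvd.dvd.mul_right (Dvd.dvd.mul_left (dvd_pow_self _ (by omega)) _) _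
    rcases P0.dvd_or_dvd h with h | h
    · rcases P0.dvd_or_dvd h with h | h
      · exact absurd (isUnit_of_dvd_unit h hp0) P0.not_unit
      · exact absurd (P0.dvd_of_dvd_pow h) X1_not_dvd
    · exact h
  rcases hL.cross d0 d1 with h | h
  · exact h
  · rw [h, mul_zero] at e
    rcases mul_eq_zero.1 e with e | e
    · rcases mul_eq_zero.1 e with e | e
      · exact absurd e hq0.ne_zero
      · exact absurd (pow_eq_zero_iff (by omega) |>.1 e) P0.ne_zero
    · exact e

/-- Newton polygon reduction. -/
lemma newton (θ : MvPolynomial (Fin 2) k ≃ₐ[k] MvPolynomial (Fin 2) k) {d : ℕ} (hd : 2 ≤ d)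
    {c : k} (hc : c ≠ 0) (hT : Top 1 1 d (C c * X 1 ^ d) (θ (X 0))) :
    ∃ r : Polynomial k, tau r (θ (X 0)) ∈ Le k 1 1 (d - 1) := by
  classical
  set f := θ (X 0) with hf
  have hcd : coeff (Finsupp.single 1 d) f = c := by
    rw [← Top_coeff hT (by simp [wt]), coeff_X1_pow, if_pos rfl]
  have hw : ∀ m, coeff m f ≠ 0 → m 0 ≠ 0 → m 0 + m 1 < d := by
    intro m hm hm0
    have := hT.2 m (by
      rw [coeff_sub, coeff_X1_pow, if_neg, sub_zero]
      · exact hm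
      · rintro rfl; simp at hm0)
    simp only [wt, Set.mem_Iic] at this
    omega
  have hw' : ∀ m, coeff m f ≠ 0 → m 0 = 0 → m 1 ≤ d := by
    intro m hm hm0
    have := hT.Le m hm
    simp only [wt, Set.mem_Iic] at this
    omega
  obtain ⟨m1, hm1, hm10⟩ := coord_involves θ hd (by rw [← hf, hcd]; exact hc)
  obtain ⟨m, hm, hmin⟩ := Finset.exists_min_image (f.support.filter (fun m => m 0 ≠ 0))
    (fun m => ((d : ℚ) - m 1) / m 0) ⟨m1, by simp; exact ⟨hm1, hm10⟩⟩
  rw [Finset.mem_filter, mem_support_iff] at hm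
  obtain ⟨hm, hm0⟩ := hm
  have hlt := hw m hm hm0
  obtain ⟨b, hb⟩ : ∃ b, d = m 1 + b := ⟨d - m 1, by omega⟩
  have hab : m 0 < b := by omega
  have hmin' : ∀ n, coeff n f ≠ 0 → b * n 0 + m 0 * n 1 ≤ m 0 * d := by
    intro n hn
    by_cases hn0 : n 0 = 0
    · rw [hn0, mul_zero, zero_add]
      exact Nat.mul_le_mul_left _ (hw' n hn hn0)
    · have := hmin n (by simp; exact ⟨hn, hn0⟩)
      rw [div_le_div_iff₀ (by exact_mod_cast Nat.pos_of_ne_zero hm0)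
        (by exact_mod_cast Nat.pos_of_ne_zero hn0)] at this
      have h2 : (b * n 0 + m 0 * n 1 : ℚ) ≤ m 0 * d := by
        have hdq : (d : ℚ) - m 1 = b := by rw [hb]; push_cast; ring
        rw [hdq] at this
        linarith
      exact_mod_cast h2
  obtain ⟨g, p, q, hg0, hcop, hbp, haq⟩ : ∃ g p q : ℕ, 0 < g ∧ Nat.Coprime p q ∧ b = p * g ∧ m 0 = q * g := by
    obtain ⟨p, q, h1, h2, h3⟩ := Nat.exists_coprime b (m 0)
    exact ⟨_, p, q, Nat.gcd_pos_of_pos_left _ (by omega), h1, h2, h3⟩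
  have hq1 : 1 ≤ q := by
    rcases Nat.eq_zero_or_pos q with h | h
    · simp [h] at haq; omega
    · exact h
  have hpq : q < p := by
    rw [hbp, haq] at hab
    exact lt_of_mul_lt_mul_right hab (by omega)
  have hle : f ∈ Le k p q (q * d) := by
    intro n hn
    have h1 := hmin' n hn
    rw [hbp, haq] at h1
    have h2 : g * (p * n 0 + q * n 1) ≤ g * (q * d) := by linarith
    have h3 := Nat.le_of_mul_le_mul_left h2 hg0
    simp only [wt, Set.mem_Iic]
    exact_mod_cast h3
  obtain ⟨F, hF⟩ := exists_Top hle
  have hFd : coeff (Finsupp.single 1 d) F ≠ 0 := by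
    rw [Top_coeff hF (by simp [wt]), hcd]; exact hc
  have hFm : coeff m F ≠ 0 := by
    rw [Top_coeff hF]
    · exact hm
    · simp only [wt]
      have : p * m 0 + q * m 1 = q * d := by
        rw [hb, hbp, haq]; ring
      exact_mod_cast this
  have hF0 : F ≠ 0 := by rintro rfl; simp at hFd
  have hL : LN (jac F) := LN_Top hF (LN_coord θ)
  obtain ⟨μ, hμ, hμ0⟩ := root_lemma (by omega) hF.1 hFm hm0
  have hμ0 : μ ≠ 0 := hμ0 _ hFd (by simp)
  have hdiv := div_lemma p q d hq1 hcop hF.1 μ hμ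
  have hker := hL.ker_of_dvd hF0 (jac_self F) hdiv
  have hq : q = 1 := by
    by_contra hne
    have := no_cusp (by omega) (by omega) (pow_ne_zero q hμ0) hL hker
    rw [jac_apply] at this
    simp at this
    have h3 := pderiv1_zero this hFd
    simp at h3
    omega
  subst hq
  rw [jac_swap, neg_eq_zero, pow_one, pow_one] at hker
  obtain ⟨c', s, hc', hFe, hs⟩ := ker_u p (by omega) μ (by simpa using hF.1) hker hF0
  refine ⟨Polynomial.monomial p μ, ?_⟩
  have hs' : p * s = d := by
    have : ((p * s : ℕ) : ℤ) = d := by push_cast; simpa using hs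
    exact_mod_cast this
  have hsd : s < d := by
    rw [← hs']
    have : 0 < s := by
      rcases Nat.eq_zero_or_pos s with h | h
      · subst h; omega
      · exact h
    nlinarith
  have e0 : tau (Polynomial.monomial p μ) (X 0 - C μ * X 1 ^ p) = X 0 := by
    rw [← rY_monomial, map_sub, tau_rY, tau_X0, add_sub_cancel_right]
  have e : tau (Polynomial.monomial p μ) f = C c' * X 0 ^ s + tau (Polynomial.monomial p μ) (f - F) := by
    have : f = F + (f - F) := by ring
    conv_lhs => rw [this, map_add]
    congr 1
    rw [hFe, map_mul, map_pow, e0, alg_C]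
  rw [e]
  refine add_mem ?_ ?_
  · refine Le_mono ?_ (Le_mul (Le_C c') (Le_pow (W_X0 (s := Set.Iic 1) (by simp)) s))
    omega
  · have := Le_subst (tau (Polynomial.monomial p μ) : MvPolynomial (Fin 2) k →ₐ[k] MvPolynomial (Fin 2) k)
      (p := 1) (q := 1) (a := p) (b := 1) (N := d - 1) (f := f - F) ?_ ?_ ?_
    · exact this
    · simp only [AlgEquiv.coe_toAlgHom, tau_X0, rY_monomial]
      refine add_mem (W_X0 (by simp; omega)) ?_
      refine Le_mono ?_ (Le_mul (Le_C μ) (Le_pow (W_X1 (s := Set.Iic 1) (by simp)) p))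
      omega
    · simp only [AlgEquiv.coe_toAlgHom, tau_X1]
      exact W_X1 (by simp)
    · simpa using hF.2

end Poly3
end Lin

namespace Lin
section Poly4
variable {k : Type*} [Field k]

/-- `φ` is conjugate to a diagonal automorphism. -/
def Diag (φ : MvPolynomial (Fin 2) k ≃ₐ[k] MvPolynomial (Fin 2) k) : Prop :=
  ∃ (ψ : MvPolynomial (Fin 2) k ≃ₐ[k] MvPolynomial (Fin 2) k) (a b : kˣ),
      (ψ * φ * ψ⁻¹) (X 0) = C (a : k) * X 0 ∧
        (ψ * φ * ψ⁻¹) (X 1) = C (b : k) * X 1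

lemma Diag_conj (σ φ : MvPolynomial (Fin 2) k ≃ₐ[k] MvPolynomial (Fin 2) k)
    (h : Diag (σ * φ * σ⁻¹)) : Diag φ := by
  obtain ⟨ψ, a, b, h0, h1⟩ := h
  refine ⟨ψ * σ, a, b, ?_, ?_⟩
  · rw [← h0, mul_inv_rev]; simp only [mul_assoc]
  · rw [← h1, mul_inv_rev]; simp only [mul_assoc]

lemma conj_pow_one {σ φ : MvPolynomial (Fin 2) k ≃ₐ[k] MvPolynomial (Fin 2) k} {m : ℕ}
    (h : φ ^ m = 1) : (σ * φ * σ⁻¹) ^ m = 1 := by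
  rw [conj_pow, h, mul_one, mul_inv_cancel]

lemma avg [CharZero k] {V : Type*} [AddCommGroup V] [Module k V] (φ : V →ₗ[k] V) {m : ℕ}
    (hm : m ≠ 0) (h1 : φ ^ m = 1) (N : Submodule k V) (hN : ∀ h ∈ N, φ h ∈ N) {v : V} (hv : v ∉ N)
    {a : k} (ha : a ≠ 0) (hav : φ v - a • v ∈ N) : ∃ w, w - v ∈ N ∧ φ w = a • w := by
  have hj : ∀ j : ℕ, (φ ^ j) v - a ^ j • v ∈ N := by
    intro j
    induction j with
    | zero => simp
    | succ j ih =>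
      have := add_mem (hN _ ih) (N.smul_mem (a ^ j) hav)
      convert this using 1
      rw [pow_succ' φ, Module.End.mul_apply, map_sub, map_smul, smul_sub, smul_smul, ← pow_succ]
      abel
  have ham : a ^ m = 1 := by
    by_contra hne
    have := hj m
    rw [h1, Module.End.one_apply] at this
    have h2 : v - a ^ m • v = (1 - a ^ m) • v := by rw [sub_smul, one_smul]
    rw [h2] at this
    exact hv ((N.smul_mem_iff (sub_ne_zero.2 (Ne.symm hne))).1 this)
  have hmk : (m : k) ≠ 0 := by exact_mod_cast hm
  set S := ∑ j ∈ Finset.range m, (a⁻¹) ^ j • (φ ^ j) v with hS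
  refine ⟨(m : k)⁻¹ • S, ?_, ?_⟩
  · have : (m : k)⁻¹ • S - v = (m : k)⁻¹ • ∑ j ∈ Finset.range m, (a⁻¹) ^ j • ((φ ^ j) v - a ^ j • v) := by
      have h3 : ∀ j ∈ Finset.range m, (a⁻¹) ^ j • ((φ ^ j) v - a ^ j • v) = (a⁻¹) ^ j • (φ ^ j) v - v := by
        intro j _
        rw [smul_sub, smul_smul, ← mul_pow, inv_mul_cancel₀ ha, one_pow, one_smul]
      rw [Finset.sum_congr rfl h3, Finset.sum_sub_distrib, Finset.sum_const, Finset.card_range,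
        smul_sub, ← hS, ← Nat.cast_smul_eq_nsmul k, smul_smul, inv_mul_cancel₀ hmk, one_smul]
    rw [this]
    exact N.smul_mem _ (sum_mem fun j _ => N.smul_mem _ (hj j))
  · rw [map_smul, smul_comm]
    congr 1
    have h4 : φ S = a • ∑ j ∈ Finset.range m, (a⁻¹) ^ (j + 1) • (φ ^ (j + 1)) v := by
      rw [hS, map_sum, Finset.smul_sum]
      refine Finset.sum_congr rfl fun j _ => ?_
      rw [map_smul, smul_smul, pow_succ' φ, Module.End.mul_apply, pow_succ, mul_comm, mul_assoc,
        inv_mul_cancel₀ ha, mul_one]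
    rw [h4]
    congr 1
    have h5 := Finset.sum_range_succ (fun j => (a⁻¹) ^ j • (φ ^ j) v) m
    rw [Finset.sum_range_succ'] at h5
    simp only [h1, inv_pow, ham] at h5
    rw [hS]
    simpa using h5

lemma exists_rY [CharZero k] {h : MvPolynomial (Fin 2) k} (h0 : pderiv 0 h = 0) : ∃ r, h = rY r := by
  refine ⟨∑ m ∈ h.support, Polynomial.monomial (m 1) (coeff m h), ?_⟩
  rw [rY, map_sum]
  conv_lhs => rw [h.as_sum]
  refine Finset.sum_congr rfl fun m hm => ?_
  have := subst_mono (AlgHom.id k _) m (coeff m h)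
  rw [pderiv0_zero h0 (mem_support_iff.1 hm)] at this
  have h2 := rY_monomial (m 1) (coeff m h)
  rw [rY] at h2
  rw [h2]
  simpa using this

/-- `y ↦ y + c`. -/
noncomputable def shiftY (c : k) : MvPolynomial (Fin 2) k ≃ₐ[k] MvPolynomial (Fin 2) k :=
  AlgEquiv.ofAlgHom (aeval ![X 0, X 1 + C c]) (aeval ![X 0, X 1 - C c])
    (hom_ext2 (by simp) (by simp [algebraMap_eq])) (hom_ext2 (by simp) (by simp [algebraMap_eq]))

lemma tri [CharZero k] (φ : MvPolynomial (Fin 2) k ≃ₐ[k] MvPolynomial (Fin 2) k) {m : ℕ}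
    (hm : m ≠ 0) (h1 : φ ^ m = 1) {b e : k} (hy : φ (X 1) = C b * X 1 + C e) : Diag φ := by
  obtain ⟨κ, hκ, hj⟩ := jac_const φ
  have hj' : pderiv 0 (φ (X 0)) * C b = C κ := by
    rw [← hj, jac_apply, hy]; simp
  have hb : b ≠ 0 := by
    rintro rfl
    rw [map_zero, mul_zero] at hj'
    exact hκ ((C_eq_zero (σ := Fin 2)).1 hj'.symm)
  set a := κ * b⁻¹ with ha'
  have ha : a ≠ 0 := mul_ne_zero hκ (inv_ne_zero hb)
  have hx : pderiv 0 (φ (X 0)) = C a := by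
    rw [ha', C_mul, ← hj', mul_assoc, ← C_mul, mul_inv_cancel₀ hb, C_1, mul_one]
  obtain ⟨r, hr⟩ := exists_rY (h := φ (X 0) - C a * X 0) (by simp [hx])
  have hlin : ((φ : MvPolynomial (Fin 2) k →ₐ[k] MvPolynomial (Fin 2) k).toLinearMap) ^ m = 1 := by
    have key : ∀ (j : ℕ) (v : MvPolynomial (Fin 2) k),
        (((φ : MvPolynomial (Fin 2) k →ₐ[k] MvPolynomial (Fin 2) k).toLinearMap) ^ j) v = (φ ^ j) v := by
      intro j
      induction j with
      | zero => intro v; simp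
      | succ j ih => intro v; rw [pow_succ, pow_succ, Module.End.mul_apply, ih]; rfl
    refine LinearMap.ext fun v => ?_
    rw [key, h1]; rfl
  -- eigenvector near `y`
  obtain ⟨w1, hw1, he1⟩ := avg _ hm hlin (Submodule.span k {1}) (v := X 1) (a := b) (by
      intro h hh
      obtain ⟨t, rfl⟩ := Submodule.mem_span_singleton.1 hh
      simpa using hh) (by
      intro hh
      obtain ⟨t, ht⟩ := Submodule.mem_span_singleton.1 hh
      have := congrArg (pderiv 1) ht
      simp at this) hb (by
      simp only [AlgHom.toLinearMap_apply, AlgEquiv.coe_toAlgHom, hy]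
      rw [smul_eq_C_mul, add_sub_cancel_left, Submodule.mem_span_singleton]
      exact ⟨e, by rw [smul_eq_C_mul, mul_one]⟩)
  obtain ⟨w0, hw0, he0⟩ := avg _ hm hlin
    (LinearMap.range (Polynomial.aeval (X 1 : MvPolynomial (Fin 2) k) :
      Polynomial k →ₐ[k] MvPolynomial (Fin 2) k).toLinearMap) (v := X 0) (a := a) (by
      rintro h ⟨s, rfl⟩
      refine ⟨s.comp (Polynomial.C b * Polynomial.X + Polynomial.C e), ?_⟩
      simp only [AlgHom.toLinearMap_apply, AlgEquiv.coe_toAlgHom]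
      have := map_rY (φ : MvPolynomial (Fin 2) k →ₐ[k] MvPolynomial (Fin 2) k) s
      simp only [AlgEquiv.coe_toAlgHom, rY, hy] at this
      rw [this, Polynomial.aeval_comp]
      simp [algebraMap_eq]) (by
      rintro ⟨s, hs⟩
      have h2 : rY s = X 0 := hs
      have := congrArg (tau 1) h2
      rw [tau_rY, tau_X0, h2] at this
      simp [rY] at this) ha (by
      refine ⟨r, ?_⟩
      simp only [AlgHom.toLinearMap_apply, AlgEquiv.coe_toAlgHom]
      rw [smul_eq_C_mul, hr, rY])
  obtain ⟨c, hc⟩ := Submodule.mem_span_singleton.1 hw1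
  obtain ⟨s, hs⟩ := hw0
  simp only [AlgHom.toLinearMap_apply, AlgEquiv.coe_toAlgHom] at he0 he1 hs
  set σ := tau s * shiftY c with hσ
  have hσ0 : σ (X 0) = w0 := by
    have : shiftY c (X 0) = X 0 := by simp [shiftY]
    rw [hσ, AlgEquiv.mul_apply, this, tau_X0, rY, hs]; ring
  have hσ1 : σ (X 1) = w1 := by
    have : shiftY c (X 1) = X 1 + C c := by simp [shiftY]
    rw [hσ, AlgEquiv.mul_apply, this, map_add, tau_X1, alg_C]
    rw [smul_eq_C_mul, mul_one] at hc
    rw [hc]; ring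
  refine ⟨σ⁻¹, Units.mk0 a ha, Units.mk0 b hb, ?_, ?_⟩
  · rw [inv_inv, AlgEquiv.mul_apply, AlgEquiv.mul_apply, hσ0, he0, map_smul, ← hσ0,
      ← AlgEquiv.mul_apply, inv_mul_cancel, smul_eq_C_mul]; rfl
  · rw [inv_inv, AlgEquiv.mul_apply, AlgEquiv.mul_apply, hσ1, he1, map_smul, ← hσ1,
      ← AlgEquiv.mul_apply, inv_mul_cancel, smul_eq_C_mul]; rfl

lemma affine_form {h : MvPolynomial (Fin 2) k} (hh : h ∈ Le k 1 1 1) :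
    ∃ a b e : k, h = C a * X 0 + C b * X 1 + C e := by
  classical
  refine ⟨coeff (Finsupp.single 0 1) h, coeff (Finsupp.single 1 1) h, coeff 0 h, ?_⟩
  ext m
  rw [coeff_add, coeff_add, coeff_C_mul, coeff_C_mul, coeff_X, coeff_X, coeff_C]
  have n01 : (Finsupp.single 0 1 : Fin 2 →₀ ℕ) ≠ Finsupp.single 1 1 := by
    intro h; have := DFunLike.congr_fun h 0; simp at this
  by_cases hm : coeff m h = 0
  · rw [hm]
    split_ifs with h1 h2 h3 h3 h4 h5 <;> simp_all
  · have := hh m hm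
    simp only [wt, Set.mem_Iic] at this
    rcases (by omega : (m 0 = 0 ∧ m 1 = 0) ∨ (m 0 = 1 ∧ m 1 = 0) ∨ (m 0 = 0 ∧ m 1 = 1))
      with ⟨h0, h1⟩ | ⟨h0, h1⟩ | ⟨h0, h1⟩
    · obtain rfl : m = 0 := ext2 h0 h1
      simp
    · obtain rfl : m = Finsupp.single 0 1 := ext2 (by simpa using h0) (by simpa using h1)
      simp [n01.symm]
      intro h; have := DFunLike.congr_fun h 0; simp at this
    · obtain rfl : m = Finsupp.single 1 1 := ext2 (by simpa using h0) (by simpa using h1)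
      simp [n01]
      intro h; have := DFunLike.congr_fun h 1; simp at this

/-- `x ↦ y + l x`, `y ↦ x`; it sends `x - l y` to `y`. -/
noncomputable def lin (l : k) : MvPolynomial (Fin 2) k ≃ₐ[k] MvPolynomial (Fin 2) k :=
  AlgEquiv.ofAlgHom (aeval ![X 1 + C l * X 0, X 0]) (aeval ![X 1, X 0 - C l * X 1])
    (hom_ext2 (by simp [algebraMap_eq]) (by simp [algebraMap_eq]))
    (hom_ext2 (by simp [algebraMap_eq]) (by simp [algebraMap_eq]))

lemma lin_X0 (l : k) : lin l (X 0) = X 1 + C l * X 0 := by simp [lin]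
lemma lin_X1 (l : k) : lin l (X 1) = X 0 := by simp [lin]
lemma lin_u (l : k) : lin l (X 0 - C l * X 1) = X 1 := by
  rw [map_sub, map_mul, lin_X0, lin_X1, alg_C]; ring
lemma lin_inv_X0 (l : k) : (lin l)⁻¹ (X 0) = X 1 := by
  apply (lin l).injective
  rw [← AlgEquiv.mul_apply, mul_inv_cancel, lin_X1]; rfl
lemma lin_inv_X1 (l : k) : (lin l)⁻¹ (X 1) = X 0 - C l * X 1 := by
  apply (lin l).injective
  rw [← AlgEquiv.mul_apply, mul_inv_cancel, lin_u]; rfl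

lemma affine_case [CharZero k] [IsAlgClosed k]
    (φ : MvPolynomial (Fin 2) k ≃ₐ[k] MvPolynomial (Fin 2) k) {m : ℕ}
    (hm : m ≠ 0) (h1 : φ ^ m = 1) (hx : φ (X 0) ∈ Le k 1 1 1) (hy : φ (X 1) ∈ Le k 1 1 1) :
    Diag φ := by
  obtain ⟨a, b, e, hx⟩ := affine_form hx
  obtain ⟨c, d, e', hy⟩ := affine_form hy
  by_cases hc : c = 0
  · subst hc
    exact tri φ hm h1 (b := d) (e := e') (by rw [hy]; simp)
  obtain ⟨l, hl⟩ := IsAlgClosed.exists_root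
    (Polynomial.C c * Polynomial.X ^ 2 + Polynomial.C (d - a) * Polynomial.X + Polynomial.C (-b))
    (by rw [Polynomial.degree_quadratic hc]; decide)
  have hl' : c * l ^ 2 + (d - a) * l - b = 0 := by
    have := hl.eq_zero
    simp at this
    linear_combination this
  refine Diag_conj (lin l) φ (tri _ hm (conj_pow_one h1) (b := a - l * c) (e := e - l * e') ?_)
  rw [AlgEquiv.mul_apply, AlgEquiv.mul_apply, lin_inv_X1]
  have : φ (X 0 - C l * X 1) = C (a - l * c) * (X 0 - C l * X 1) + C (e - l * e') := by
    have hb : b = c * l ^ 2 + (d - a) * l := by linear_combination -hl'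
    rw [map_sub, map_mul, hx, hy, alg_C, hb]
    simp only [C_sub, C_mul, C_add, C_pow]
    ring
  rw [this, map_add, map_mul, lin_u, alg_C, alg_C]

end Poly4
end Lin

namespace Lin
section Poly5
variable {k : Type*} [Field k]
variable {f g h F G : MvPolynomial (Fin 2) k}

lemma Le_scale {D N : ℤ} (hD : 0 ≤ D) (hh : h ∈ Le k 1 1 N) : h ∈ Le k D D (D * N) := by
  intro m hm
  have := hh m hm
  simp only [wt, Set.mem_Iic] at this ⊢
  nlinarith

lemma exists_Le (h : MvPolynomial (Fin 2) k) : ∃ N : ℕ, h ∈ Le k 1 1 N := by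
  refine ⟨h.support.sup (fun m => m 0 + m 1), fun m hm => ?_⟩
  have := Finset.le_sup (f := fun m : Fin 2 →₀ ℕ => m 0 + m 1) (mem_support_iff.2 hm)
  simp only [wt, Set.mem_Iic]
  rw [one_mul, one_mul]
  exact_mod_cast this

lemma Le_zero_const (hh : h ∈ Le k 1 1 0) : ∃ c : k, h = C c := by
  refine ⟨coeff 0 h, ?_⟩
  classical
  ext m
  rw [coeff_C]
  split_ifs with h0
  · rw [h0]
  · by_contra hm
    have := hh m hm
    simp only [wt, Set.mem_Iic] at this
    exact h0 (ext2 (by simp; omega) (by simp; omega))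

lemma coord0_not_Le (θ : MvPolynomial (Fin 2) k ≃ₐ[k] MvPolynomial (Fin 2) k) :
    θ (X 0) ∉ Le k 1 1 0 := by
  intro h
  obtain ⟨c, hc⟩ := Le_zero_const h
  obtain ⟨κ, hκ, hj⟩ := jac_const θ
  rw [hc, jac_apply] at hj
  simp at hj
  exact hκ (C_eq_zero.1 hj.symm)

lemma coord1_not_Le (θ : MvPolynomial (Fin 2) k ≃ₐ[k] MvPolynomial (Fin 2) k) :
    θ (X 1) ∉ Le k 1 1 0 := by
  intro h
  obtain ⟨c, hc⟩ := Le_zero_const h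
  obtain ⟨κ, hκ, hj⟩ := jac_const θ
  rw [hc, jac_apply] at hj
  simp at hj
  exact hκ (C_eq_zero.1 hj.symm)

lemma Le_aeval {e : ℤ} (he : 0 ≤ e) (hg : g ∈ Le k 1 1 e) (r : Polynomial k) :
    Polynomial.aeval g r ∈ Le k 1 1 (r.natDegree * e) := by
  rw [Polynomial.aeval_eq_sum_range]
  refine sum_mem fun i hi => Submodule.smul_mem _ _ ?_
  refine Le_mono ?_ (Le_pow hg i)
  have : i ≤ r.natDegree := by simp at hi; omega
  exact mul_le_mul_of_nonneg_right (by exact_mod_cast this) he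

lemma X0_Le {N : ℤ} (hN : 1 ≤ N) : (X 0 : MvPolynomial (Fin 2) k) ∈ Le k 1 1 N := W_X0 (by simpa using hN)
lemma X1_Le {N : ℤ} (hN : 1 ≤ N) : (X 1 : MvPolynomial (Fin 2) k) ∈ Le k 1 1 N := W_X1 (by simpa using hN)

lemma Le_C_mul {N : ℤ} (c : k) (hh : h ∈ Le k 1 1 N) : C c * h ∈ Le k 1 1 N := by
  rw [← smul_eq_C_mul]; exact Submodule.smul_mem _ _ hh

lemma rY_Le (r : Polynomial k) : rY r ∈ Le k 1 1 r.natDegree := by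
  have := Le_aeval (k := k) zero_le_one (X1_Le le_rfl) r
  simpa [rY] using this

lemma X1pow_Ho (c : k) (n : ℕ) : (C c * X 1 ^ n : MvPolynomial (Fin 2) k) ∈ Ho k 1 1 n := by
  have := Ho_mul (Ho_C c) (Ho_pow (W_X1 (k := k) (p := 1) (q := 1) (s := {1}) rfl) n)
  simpa [Ho] using this

lemma rY_Top (r : Polynomial k) (hr : 1 ≤ r.natDegree) :
    Top 1 1 r.natDegree (C r.leadingCoeff * X 1 ^ r.natDegree) (rY r) := by
  refine ⟨X1pow_Ho _ _, ?_⟩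
  have h1 : rY r - C r.leadingCoeff * X 1 ^ r.natDegree = rY r.eraseLead := by
    conv_lhs => rw [← r.eraseLead_add_monomial_natDegree_leadingCoeff]
    rw [rY_add, rY_monomial]
    simp
  rw [h1]
  refine Le_mono ?_ (rY_Le _)
  have := r.eraseLead_natDegree_le
  omega

lemma tau_Le (r : Polynomial k) {D : ℕ} (hD : 1 ≤ D) (hr : r.natDegree ≤ D) {N : ℤ}
    (hh : h ∈ Le k 1 1 N) : tau r h ∈ Le k 1 1 (D * N) := by
  have := Le_subst (tau r : MvPolynomial (Fin 2) k →ₐ[k] MvPolynomial (Fin 2) k)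
    (p := 1) (q := 1) (a := D) (b := D) (N := D * N) (f := h) ?_ ?_ (Le_scale (by positivity) hh)
  · simpa using this
  · simp only [AlgEquiv.coe_toAlgHom, tau_X0]
    exact add_mem (X0_Le (by exact_mod_cast hD)) (Le_mono (by exact_mod_cast hr) (rY_Le r))
  · simp only [AlgEquiv.coe_toAlgHom, tau_X1]
    exact X1_Le (by exact_mod_cast hD)

lemma subst_Top (σ : MvPolynomial (Fin 2) k ≃ₐ[k] MvPolynomial (Fin 2) k) {D : ℕ} (hD : 1 ≤ D)
    (h0 : σ (X 0) ∈ Le k 1 1 D) (h1 : σ (X 1) ∈ Le k 1 1 D) {e : ℤ} (hF : Top 1 1 e F f)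
    (hG : Top 1 1 (D * e) G (σ F)) : Top 1 1 (D * e) G (σ f) := by
  have h2 : σ (f - F) ∈ Le k 1 1 (D * e - 1) := by
    have := Le_subst (σ : MvPolynomial (Fin 2) k →ₐ[k] MvPolynomial (Fin 2) k)
      (p := 1) (q := 1) (a := D) (b := D) (N := D * (e - 1)) (f := f - F) (by simpa using h0)
      (by simpa using h1) (Le_scale (by positivity) hF.2)
    rw [AlgEquiv.coe_toAlgHom] at this
    refine Le_mono ?_ this
    have : (1 : ℤ) ≤ D := by exact_mod_cast hD
    linarith
  have := hG.add_lower h2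
  rw [map_sub] at this
  simpa using this

lemma CX_ne {c : k} (hc : c ≠ 0) (n : ℕ) : (C c * X 1 ^ n : MvPolynomial (Fin 2) k) ≠ 0 :=
  mul_ne_zero (fun h => hc (C_eq_zero.1 h)) (pow_ne_zero _ (X_ne_zero _))

lemma no_growth (φ : MvPolynomial (Fin 2) k ≃ₐ[k] MvPolynomial (Fin 2) k) {m : ℕ} (hm : m ≠ 0)
    (h1 : φ ^ m = 1) {d : ℕ} (hd : 2 ≤ d) (hx : φ (X 0) ∈ Le k 1 1 d) {c : k} (hc : c ≠ 0)
    (hy : Top 1 1 d (C c * X 1 ^ d) (φ (X 1))) : False := by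
  have key : ∀ n : ℕ, ∃ c' : k, c' ≠ 0 ∧
      Top 1 1 (d ^ n : ℕ) (C c' * X 1 ^ (d ^ n)) ((φ ^ n) (X 1)) := by
    intro n
    induction n with
    | zero => exact ⟨1, one_ne_zero, by simpa using Top_refl (W_X1 (k := k) (p := 1) (q := 1) (s := {1}) rfl)⟩
    | succ n ih =>
      obtain ⟨c', hc', ht⟩ := ih
      refine ⟨c' * c ^ (d ^ n), mul_ne_zero hc' (pow_ne_zero _ hc), ?_⟩
      rw [pow_succ' φ, AlgEquiv.mul_apply]
      have := subst_Top φ (by omega) hx hy.Le ht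
        (G := C (c' * c ^ (d ^ n)) * X 1 ^ (d ^ (n + 1))) ?_
      · convert this using 1
        push_cast; ring
      · rw [map_mul φ, map_pow φ, alg_C]
        have h2 := (hy.pow (d ^ n)).C_mul c'
        convert h2 using 1
        · push_cast; ring
        · rw [mul_pow, C_mul, C_pow, ← pow_mul, pow_succ' d n, mul_assoc]
  obtain ⟨c', hc', ht⟩ := key m
  rw [h1] at ht
  have := ht.ne (CX_ne hc' _) (X1_Le (k := k) le_rfl)
  have h3 : d ^ m ≤ 1 := by exact_mod_cast this
  have h4 := Nat.one_lt_pow hm (show 1 < d by omega)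
  omega

lemma pure_tau (r : Polynomial k) (hr : 2 ≤ r.natDegree) {e : ℕ} {c l : k} (hc : c ≠ 0)
    (hg : Top 1 1 e (C c * (X 0 - C l * X 1) ^ e) g) :
    ∃ c' : k, c' ≠ 0 ∧ Top 1 1 (r.natDegree * e : ℕ) (C c' * X 1 ^ (r.natDegree * e)) (tau r g) := by
  have hr0 : r.leadingCoeff ≠ 0 := by
    intro h0
    rw [Polynomial.leadingCoeff_eq_zero] at h0
    simp [h0] at hr
  refine ⟨c * r.leadingCoeff ^ e, mul_ne_zero hc (pow_ne_zero _ hr0), ?_⟩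
  have hD : (1 : ℤ) ≤ (r.natDegree : ℤ) - 1 := by omega
  have := subst_Top (tau r) (D := r.natDegree) (by omega) ?_ ?_ hg
    (G := C (c * r.leadingCoeff ^ e) * X 1 ^ (r.natDegree * e)) ?_
  · exact_mod_cast this
  · rw [tau_X0]; exact add_mem (X0_Le (by omega)) (rY_Le r)
  · rw [tau_X1]; exact X1_Le (by omega)
  · rw [map_mul (tau r), map_pow (tau r), map_sub (tau r), map_mul (tau r), alg_C, alg_C, tau_X0, tau_X1]
    have h2 : Top 1 1 r.natDegree (C r.leadingCoeff * X 1 ^ r.natDegree) (X 0 + rY r - C l * X 1) := by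
      have := (rY_Top r (by omega)).add_lower (sub_mem (X0_Le (k := k) hD) (Le_C_mul l (X1_Le hD)))
      convert this using 1; ring
    convert (h2.pow e).C_mul c using 1
    · push_cast; ring
    · rw [mul_pow, C_mul, C_pow, ← pow_mul, mul_assoc]

variable [CharZero k]

lemma ker_y {d : ℕ} (hG : G ∈ Ho k 1 1 d) (hj : pderiv 0 G = 0) : ∃ c : k, G = C c * X 1 ^ d := by
  refine ⟨coeff (Finsupp.single 1 d) G, ?_⟩
  have := mono_of_unique (F := G) (m := Finsupp.single 1 d) (fun n hn => ?_)
  · simpa using this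
  · have h0 := pderiv0_zero hj hn
    have h1 := hG n hn
    simp only [wt, Set.mem_singleton_iff] at h1
    exact ext2 (by simpa using h0) (by simp; omega)

lemma jac_pow_zero {c : k} (hc : c ≠ 0) {n : ℕ} (hn : n ≠ 0) {u : MvPolynomial (Fin 2) k} (hu : u ≠ 0)
    (h : jac (C c * u ^ n) G = 0) : jac u G = 0 := by
  rw [jac_swap, neg_eq_zero] at h
  rw [jac_swap, neg_eq_zero]
  rw [Derivation.leibniz, Derivation.leibniz_pow] at h
  have h3 : jac G (C c) = 0 := by simp [jac_apply]
  rw [h3] at h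
  simp only [smul_zero, add_zero, smul_eq_mul, nsmul_eq_mul] at h
  have hnk : (n : MvPolynomial (Fin 2) k) ≠ 0 := by exact_mod_cast hn
  have hCc : (C c : MvPolynomial (Fin 2) k) ≠ 0 := fun h => hc (C_eq_zero.1 h)
  simpa [hnk, hCc, hu] using h

lemma u_ne (l : k) : (X 0 - C l * X 1 : MvPolynomial (Fin 2) k) ≠ 0 := by
  intro h
  have := congrArg (pderiv 0) h
  simp at this

lemma ker_l {l : k} {e : ℕ} (hG : G ∈ Ho k 1 1 e) (hj : jac (X 0 - C l * X 1) G = 0) :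
    ∃ c : k, G = C c * (X 0 - C l * X 1) ^ e := by
  by_cases h0 : G = 0
  · exact ⟨0, by simp [h0]⟩
  obtain ⟨c, s, -, he, hs⟩ := ker_u 1 le_rfl l (by simpa using hG) (by simpa using hj) h0
  have : s = e := by simpa using hs
  subst this
  exact ⟨c, by simpa using he⟩

lemma dep [IsAlgClosed k] {d : ℕ} (hd : d ≠ 0) (hF : F ∈ Ho k 1 1 d) (hF0 : F ≠ 0) (hL : LN (jac F))
    (hG : G ∈ Ho k 1 1 d) (hj : jac F G = 0) :
    (∃ c c' : k, F = C c * X 1 ^ d ∧ G = C c' * X 1 ^ d) ∨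
      ∃ l c c' : k, F = C c * (X 0 - C l * X 1) ^ d ∧ G = C c' * (X 0 - C l * X 1) ^ d := by
  rcases struct_std hF hF0 hL with ⟨c, hc, he⟩ | ⟨c, l, hc, he⟩
  · left
    rw [he] at hj
    have h1 := jac_pow_zero hc hd (X_ne_zero _) hj
    obtain ⟨c', hc'⟩ := ker_y hG (by simpa [jac_apply] using h1)
    exact ⟨c, c', he, hc'⟩
  · right
    rw [he] at hj
    have h1 := jac_pow_zero hc hd (u_ne l) hj
    obtain ⟨c', hc'⟩ := ker_l hG h1
    exact ⟨l, c, c', he, hc'⟩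

end Poly5
end Lin

namespace Lin
section Poly6
variable {k : Type*} [Field k] [CharZero k] [IsAlgClosed k]
variable {f g h F G : MvPolynomial (Fin 2) k}

/-- Degree reduction once the two leading forms are multiples of `y ^ d`. -/
lemma stepC (φ : MvPolynomial (Fin 2) k ≃ₐ[k] MvPolynomial (Fin 2) k) {m : ℕ} (hm : m ≠ 0)
    (h1 : φ ^ m = 1) {d : ℕ} (hd : 2 ≤ d)
    (IH : ∀ φ' : MvPolynomial (Fin 2) k ≃ₐ[k] MvPolynomial (Fin 2) k, φ' ^ m = 1 →
      φ' (X 0) ∈ Le k 1 1 (d - 1) → φ' (X 1) ∈ Le k 1 1 (d - 1) → Diag φ')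
    {c0 c1 : k} (hx : Top 1 1 d (C c0 * X 1 ^ d) (φ (X 0)))
    (hy : Top 1 1 d (C c1 * X 1 ^ d) (φ (X 1))) : Diag φ := by
  classical
  have hc1 : c1 = 0 := by
    by_contra hc
    exact no_growth φ hm h1 hd hx.Le hc hy
  subst hc1
  have hy' : φ (X 1) ∈ Le k 1 1 (d - 1) := by
    refine Top.Le_of_zero ?_
    simpa using hy
  by_cases hc0 : c0 = 0
  · subst hc0
    exact IH φ h1 (Top.Le_of_zero (by simpa using hx)) hy'
  have hex : ∃ n : ℕ, ∃ r : Polynomial k, tau r (φ (X 0)) ∈ Le k 1 1 n := by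
    obtain ⟨r, hr⟩ := newton φ hd hc0 hx
    exact ⟨d - 1, r, by rwa [Nat.cast_sub (by omega)]⟩
  obtain ⟨n, ⟨r, hr⟩, hmin⟩ : ∃ n : ℕ, (∃ r : Polynomial k, tau r (φ (X 0)) ∈ Le k 1 1 n) ∧
      ∀ n' < n, ¬ ∃ r : Polynomial k, tau r (φ (X 0)) ∈ Le k 1 1 n' :=
    ⟨Nat.find hex, Nat.find_spec hex, fun n' hn' => Nat.find_min hex hn'⟩
  have hnd : n ≤ d - 1 := by
    by_contra hlt
    obtain ⟨r, hr⟩ := newton φ hd hc0 hx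
    exact hmin (d - 1) (by omega) ⟨r, by rwa [Nat.cast_sub (by omega)]⟩
  set θ := tau r * φ with hθ
  have hθ0 : θ (X 0) = tau r (φ (X 0)) := rfl
  have hθ1 : θ (X 1) = tau r (φ (X 1)) := rfl
  have hback0 : φ (X 0) = tau (-r) (θ (X 0)) := by rw [hθ0, tau_neg_tau]
  have hback1 : φ (X 1) = tau (-r) (θ (X 1)) := by rw [hθ1, tau_neg_tau]
  rw [← hθ0] at hr
  have hn1 : 1 ≤ n := by
    by_contra hlt
    obtain rfl : n = 0 := by omega
    exact coord0_not_Le θ (by simpa using hr)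
  obtain ⟨F, hF⟩ := exists_Top hr
  have hF0 : F ≠ 0 := by
    rintro rfl
    refine hmin (n - 1) (by omega) ⟨r, ?_⟩
    rw [Nat.cast_sub hn1]
    exact hF.Le_of_zero
  have hdx : ∀ M : ℤ, φ (X 0) ∈ Le k 1 1 M → (d : ℤ) ≤ M := fun M hM => hx.ne (CX_ne hc0 d) hM
  rcases struct_std hF.1 hF0 (LN_Top hF (LN_coord θ)) with ⟨c, hc, rfl⟩ | ⟨c, l, hc, rfl⟩
  · exfalso
    by_cases hn2 : 2 ≤ n
    · obtain ⟨s, hs⟩ := newton θ hn2 hc hF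
      refine hmin (n - 1) (by omega) ⟨r + s, ?_⟩
      rw [Nat.cast_sub hn1, ← tau_tau]
      exact hs
    · obtain rfl : n = 1 := by omega
      have h2 := hF.2
      simp only [Nat.cast_one, sub_self, pow_one] at h2
      obtain ⟨e, he⟩ := Le_zero_const h2
      have h3 : θ (X 0) = C c * X 1 + C e := by rw [← he]; ring
      have h4 := hdx 1 (by
        rw [hback0, h3, map_add, map_mul, alg_C, alg_C, tau_X1]
        exact add_mem (Le_C_mul _ (X1_Le le_rfl)) (Le_mono zero_le_one (Le_C e)))
      omega
  have hnr : (-r).natDegree = r.natDegree := Polynomial.natDegree_neg r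
  have hρ : 2 ≤ r.natDegree := by
    by_contra hlt
    have h2 := tau_Le (-r) (D := 1) le_rfl (by omega) hr
    rw [← hback0] at h2
    have := hdx _ h2
    push_cast at this
    omega
  -- the second coordinate
  have hex2 := exists_Le (θ (X 1))
  obtain ⟨e, he, hemin⟩ : ∃ e : ℕ, θ (X 1) ∈ Le k 1 1 e ∧ ∀ e' < e, θ (X 1) ∉ Le k 1 1 e' :=
    ⟨Nat.find hex2, Nat.find_spec hex2, fun n' hn' => Nat.find_min hex2 hn'⟩
  have he1 : 1 ≤ e := by
    by_contra hlt
    obtain rfl : e = 0 := by omega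
    exact coord1_not_Le θ (by simpa using he)
  obtain ⟨G, hG⟩ := exists_Top he
  have hG0 : G ≠ 0 := by
    rintro rfl
    refine hemin (e - 1) (by omega) ?_
    rw [Nat.cast_sub he1]
    exact hG.Le_of_zero
  have fin : ∀ (c' l' : k), c' ≠ 0 → Top 1 1 e (C c' * (X 0 - C l' * X 1) ^ e) (θ (X 1)) →
      Diag φ := by
    intro c' l' hc' hT
    obtain ⟨c'', hc'', ht⟩ := pure_tau (-r) (by omega) hc' hT
    rw [← hback1, hnr] at ht
    have h2 := ht.ne (CX_ne hc'' _) hy'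
    have h3 : e ≤ r.natDegree * e := Nat.le_mul_of_pos_left e (by omega)
    have h3' : (e : ℤ) ≤ (r.natDegree * e : ℕ) := by exact_mod_cast h3
    have hinv : ∀ v, (tau r)⁻¹ v = tau (-r) v := by
      intro v
      apply (tau r).injective
      rw [tau_tau, neg_add_cancel, tau_zero]
      exact (tau r).apply_symm_apply v
    refine Diag_conj (tau r) φ (IH _ (conj_pow_one h1) ?_ ?_)
    · rw [← hθ, AlgEquiv.mul_apply, hinv, tau_X0, map_add, rY_neg, map_neg]
      refine add_mem (Le_mono (by omega) hr) (neg_mem ?_)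
      have h5 := map_rY (θ : MvPolynomial (Fin 2) k →ₐ[k] MvPolynomial (Fin 2) k) r
      rw [AlgEquiv.coe_toAlgHom] at h5
      rw [h5]
      refine Le_mono ?_ (Le_aeval (by omega) he r)
      exact_mod_cast h2
    · rw [← hθ, AlgEquiv.mul_apply, hinv, tau_X1]
      exact Le_mono (by omega) he
  by_cases hj : jac (C c * (X 0 - C l * X 1) ^ n) G = 0
  · obtain ⟨c', rfl⟩ := ker_l hG.1 (jac_pow_zero hc (by omega) (u_ne l) hj)
    refine fin c' l ?_ hG
    rintro rfl
    simp at hG0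
  · obtain ⟨κ, hκ, hκj⟩ := jac_const θ
    have h2 := (hF.jac hG).ne hj (M := 0) (by rw [hκj]; exact Le_C κ)
    obtain rfl : e = 1 := by omega
    obtain ⟨a, b, t, hab⟩ := affine_form (by simpa using he)
    by_cases ha : a = 0
    · subst ha
      refine tri φ hm h1 (b := b) (e := t) ?_
      rw [hback1, hab]
      simp
    · refine fin a (- b / a) ha ?_
      have h6 : C a * (X 0 - C (- b / a) * X 1) ^ 1 = (C a * X 0 + C b * X 1 : MvPolynomial (Fin 2) k) := by
        rw [pow_one, mul_sub, ← mul_assoc, ← C_mul, mul_div_cancel₀ _ ha, C_neg]; ring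
      rw [h6, hab]
      refine ⟨?_, ?_⟩
      · refine add_mem ?_ ?_
        · rw [← smul_eq_C_mul]; exact Submodule.smul_mem _ _ (W_X0 (by simp))
        · rw [← smul_eq_C_mul]; exact Submodule.smul_mem _ _ (W_X1 (by simp))
      · rw [add_sub_cancel_left]; simpa using Le_C t

lemma lin_Ho (l : k) {N : ℤ} (hh : h ∈ Ho k 1 1 N) : lin l h ∈ Ho k 1 1 N := by
  have := Ho_subst (lin l : MvPolynomial (Fin 2) k →ₐ[k] MvPolynomial (Fin 2) k)
    (p := 1) (q := 1) (a := 1) (b := 1) (N := N) (f := h) ?_ ?_ hh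
  · simpa using this
  · simp only [AlgEquiv.coe_toAlgHom, lin_X0]
    refine add_mem (W_X1 (by simp)) ?_
    rw [← smul_eq_C_mul]; exact Submodule.smul_mem _ _ (W_X0 (by simp))
  · simp only [AlgEquiv.coe_toAlgHom, lin_X1]
    exact W_X0 (by simp)

lemma lin_Le (l : k) {N : ℤ} (hh : h ∈ Le k 1 1 N) : lin l h ∈ Le k 1 1 N := by
  have := Le_subst (lin l : MvPolynomial (Fin 2) k →ₐ[k] MvPolynomial (Fin 2) k)
    (p := 1) (q := 1) (a := 1) (b := 1) (N := N) (f := h) ?_ ?_ hh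
  · simpa using this
  · simp only [AlgEquiv.coe_toAlgHom, lin_X0]
    exact add_mem (X1_Le le_rfl) (Le_C_mul l (X0_Le le_rfl))
  · simp only [AlgEquiv.coe_toAlgHom, lin_X1]
    exact X0_Le le_rfl

lemma lin_Top (l : k) {N : ℤ} (hh : Top 1 1 N F h) : Top 1 1 N (lin l F) (lin l h) :=
  ⟨lin_Ho l hh.1, by rw [← map_sub]; exact lin_Le l hh.2⟩

lemma Top.sub {N : ℤ} (hf : Top 1 1 N F f) (hg : Top 1 1 N G g) : Top 1 1 N (F - G) (f - g) :=
  ⟨sub_mem hf.1 hg.1, by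
    have := sub_mem hf.2 hg.2
    convert this using 1; ring⟩

lemma stepL (φ : MvPolynomial (Fin 2) k ≃ₐ[k] MvPolynomial (Fin 2) k) {m : ℕ} (hm : m ≠ 0)
    (h1 : φ ^ m = 1) {d : ℕ} (hd : 2 ≤ d)
    (IH : ∀ φ' : MvPolynomial (Fin 2) k ≃ₐ[k] MvPolynomial (Fin 2) k, φ' ^ m = 1 →
      φ' (X 0) ∈ Le k 1 1 (d - 1) → φ' (X 1) ∈ Le k 1 1 (d - 1) → Diag φ')
    {c0 c1 l : k} (hx : Top 1 1 d (C c0 * (X 0 - C l * X 1) ^ d) (φ (X 0)))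
    (hy : Top 1 1 d (C c1 * (X 0 - C l * X 1) ^ d) (φ (X 1))) : Diag φ := by
  refine Diag_conj (lin l) φ (stepC _ hm (conj_pow_one h1) hd IH (c0 := c1) (c1 := c0 - l * c1) ?_ ?_)
  · rw [AlgEquiv.mul_apply, AlgEquiv.mul_apply, lin_inv_X0]
    have := lin_Top l hy
    rwa [map_mul (lin l), map_pow (lin l), lin_u, alg_C] at this
  · rw [AlgEquiv.mul_apply, AlgEquiv.mul_apply, lin_inv_X1, map_sub φ, map_mul φ, alg_C]
    have := lin_Top l (hx.sub (hy.C_mul l))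
    rw [map_sub (lin l) (C c0 * _), map_mul (lin l) (C c0), map_mul (lin l) (C l) (C c1 * _),
      map_mul (lin l) (C c1), map_pow (lin l), lin_u, alg_C, alg_C, alg_C] at this
    convert this using 1
    rw [C_sub, C_mul]; ring

lemma main {m : ℕ} (hm : m ≠ 0) (N : ℕ) :
    ∀ φ : MvPolynomial (Fin 2) k ≃ₐ[k] MvPolynomial (Fin 2) k, φ ^ m = 1 →
      φ (X 0) ∈ Le k 1 1 N → φ (X 1) ∈ Le k 1 1 N → Diag φ := by
  induction N with
  | zero =>
    intro φ h1 hx hy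
    exact (coord0_not_Le φ (by simpa using hx)).elim
  | succ N ih =>
    intro φ h1 hx hy
    by_cases hN : N = 0
    · subst hN
      exact affine_case φ hm h1 (by simpa using hx) (by simpa using hy)
    have hd : 2 ≤ N + 1 := by omega
    have IH : ∀ φ' : MvPolynomial (Fin 2) k ≃ₐ[k] MvPolynomial (Fin 2) k, φ' ^ m = 1 →
      φ' (X 0) ∈ Le k 1 1 ((N + 1 : ℕ) - 1) → φ' (X 1) ∈ Le k 1 1 ((N + 1 : ℕ) - 1) → Diag φ' := by
      intro φ' a b c
      push_cast at b c
      rw [add_sub_cancel_right] at b c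
      exact ih φ' a b c
    obtain ⟨F, hF⟩ := exists_Top hx
    obtain ⟨G, hG⟩ := exists_Top hy
    obtain ⟨κ, hκ, hκj⟩ := jac_const φ
    have hj : jac F G = 0 := by
      by_contra hj
      have h2 := (hF.jac hG).ne hj (M := 0) (by rw [hκj]; exact Le_C κ)
      omega
    by_cases hF0 : F = 0
    · by_cases hG0 : G = 0
      · subst hF0 hG0
        exact IH φ h1 hF.Le_of_zero hG.Le_of_zero
      · have hL : LN (jac (φ (X 1))) := by
          have := LN_coord (φ * lin 0)
          rw [AlgEquiv.mul_apply, lin_X0] at this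
          simpa using this
        rcases dep (by omega) hG.1 hG0 (LN_Top hG hL) hF.1 (by rw [jac_swap, hj, neg_zero]) with
          ⟨c, c', rfl, rfl⟩ | ⟨l, c, c', rfl, rfl⟩
        · exact stepC φ hm h1 hd IH hF hG
        · exact stepL φ hm h1 hd IH hF hG
    · rcases dep (by omega) hF.1 hF0 (LN_Top hF (LN_coord φ)) hG.1 hj with
          ⟨c, c', rfl, rfl⟩ | ⟨l, c, c', rfl, rfl⟩
      · exact stepC φ hm h1 hd IH hF hG
      · exact stepL φ hm h1 hd IH hF hG

end Poly6
end Lin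


theorem stmt16 {k : Type*} [Field k] [IsAlgClosed k] [CharZero k]
    (φ : MvPolynomial (Fin 2) k ≃ₐ[k] MvPolynomial (Fin 2) k)
    (hφ : IsOfFinOrder φ) :
    ∃ (ψ : MvPolynomial (Fin 2) k ≃ₐ[k] MvPolynomial (Fin 2) k) (a b : kˣ),
      (ψ * φ * ψ⁻¹) (X 0) = C (a : k) * X 0 ∧
        (ψ * φ * ψ⁻¹) (X 1) = C (b : k) * X 1 := by
  obtain ⟨m, hm, h1⟩ := isOfFinOrder_iff_pow_eq_one.1 hφ
  obtain ⟨M, hM⟩ := Lin.exists_Le (φ (X 0))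
  obtain ⟨N, hN⟩ := Lin.exists_Le (φ (X 1))
  exact Lin.main (by omega) (M + N) φ h1 (Lin.Le_mono (by push_cast; omega) hM)
    (Lin.Le_mono (by push_cast; omega) hN)
end
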